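/- Let Ω be homogeneous of degree zero on ℝⁿ \ {0}, integrable on the unit sphere S^{n-1} with ∫_{S^{n-1}} Ω(θ) dσ(θ) = 0, and suppose Ω satisfies the L¹-Dini condition. Let μ be a signed measure on ℝⁿ that is absolutely continuous with respect to Lebesgue measure with |μ|(ℝⁿ) < ∞. Then lim_{λ→0⁺} λ · m({x ∈ ℝⁿ : |T_Ω μ(x)| > λ}) = (1/n) ‖Ω‖_{L¹(S^{n-1})} · |μ(ℝⁿ)|, where m denotes Lebesgue measure. -/

import Mathlib

open MeasureTheory Filter Set

noncomputable section

/-- The unit sphere `S^{n-1}` in `ℝⁿ`. -/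
abbrev unitSphere (n : ℕ) := Metric.sphere (0 : EuclideanSpace ℝ (Fin n)) 1

/-- The surface (area) measure `σ` on the unit sphere `S^{n-1}`. -/
def sphereMeasure (n : ℕ) : Measure (unitSphere n) :=
  (volume : Measure (EuclideanSpace ℝ (Fin n))).toSphere

/-- `Ω` is homogeneous of degree zero on `ℝⁿ \ {0}`. -/
def HomogeneousZero {n : ℕ} (Ω : EuclideanSpace ℝ (Fin n) → ℝ) : Prop :=
  ∀ c : ℝ, 0 < c → ∀ x : EuclideanSpace ℝ (Fin n), x ≠ 0 → Ω (c • x) = Ω x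

/-- The `L¹` integral modulus of continuity of `Ω`, defined via rotations:
`ω₁(δ) = sup_{‖ρ‖ ≤ δ} ∫_{S^{n-1}} |Ω(ρθ) - Ω(θ)| dσ(θ)`, where `ρ` ranges over
rotations of `ℝⁿ` (linear isometries of determinant `1`) and
`‖ρ‖ = sup{ |ρx' - x'| : x' ∈ S^{n-1} }`. -/
def omegaRot (n : ℕ) (Ω : EuclideanSpace ℝ (Fin n) → ℝ) (δ : ℝ) : ℝ :=
  sSup {I : ℝ | ∃ ρ : EuclideanSpace ℝ (Fin n) ≃ₗᵢ[ℝ] EuclideanSpace ℝ (Fin n),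
    LinearMap.det (ρ.toLinearEquiv : EuclideanSpace ℝ (Fin n) →ₗ[ℝ] EuclideanSpace ℝ (Fin n)) = 1 ∧
    (∀ x : EuclideanSpace ℝ (Fin n), ‖x‖ = 1 → ‖ρ x - x‖ ≤ δ) ∧
    I = ∫ θ : unitSphere n, |Ω (ρ (θ : EuclideanSpace ℝ (Fin n))) - Ω (θ : EuclideanSpace ℝ (Fin n))| ∂(sphereMeasure n)}

/-- The `L¹` integral modulus of continuity of `Ω`, defined via translations:
`ω̃₁(δ) = sup_{|h| ≤ δ} ∫_{S^{n-1}} |Ω(θ + h) - Ω(θ)| dσ(θ)`, where `Ω` is evaluated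
off the sphere via its degree-zero homogeneous extension. -/
def omegaTrans (n : ℕ) (Ω : EuclideanSpace ℝ (Fin n) → ℝ) (δ : ℝ) : ℝ :=
  sSup {I : ℝ | ∃ h : EuclideanSpace ℝ (Fin n), ‖h‖ ≤ δ ∧
    I = ∫ θ : unitSphere n, |Ω ((θ : EuclideanSpace ℝ (Fin n)) + h) - Ω (θ : EuclideanSpace ℝ (Fin n))| ∂(sphereMeasure n)}

/-- `Ω` satisfies the `L¹`-Dini condition. -/
def L1Dini (n : ℕ) (Ω : EuclideanSpace ℝ (Fin n) → ℝ) : Prop :=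
  Integrable (fun θ : unitSphere n => Ω (θ : EuclideanSpace ℝ (Fin n))) (sphereMeasure n) ∧
  ∫⁻ δ in Ioo (0 : ℝ) 1, ENNReal.ofReal (omegaRot n Ω δ / δ) < ⊤

/-- The truncated singular integral `∫_{|x-y| > ε} Ω(x-y)|x-y|^{-n} dμ(y)` of a signed
measure `μ`, where integration against `μ` is via its Jordan decomposition. -/
def truncT (n : ℕ) (Ω : EuclideanSpace ℝ (Fin n) → ℝ)
    (μ : SignedMeasure (EuclideanSpace ℝ (Fin n))) (x : EuclideanSpace ℝ (Fin n)) (ε : ℝ) : ℝ :=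
  (∫ y in {y | ε < ‖x - y‖}, Ω (x - y) / ‖x - y‖ ^ n ∂μ.toJordanDecomposition.posPart) -
  (∫ y in {y | ε < ‖x - y‖}, Ω (x - y) / ‖x - y‖ ^ n ∂μ.toJordanDecomposition.negPart)

/-- The principal-value singular integral `T_Ω μ(x) = p.v. ∫ Ω(x-y)|x-y|^{-n} dμ(y)`. -/
def TOmega (n : ℕ) (Ω : EuclideanSpace ℝ (Fin n) → ℝ)
    (μ : SignedMeasure (EuclideanSpace ℝ (Fin n))) (x : EuclideanSpace ℝ (Fin n)) : ℝ :=
  limUnder (nhdsWithin (0 : ℝ) (Ioi 0)) (truncT n Ω μ x)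

/-- The Euclidean space `ℝⁿ`. -/
abbrev Eu (n : ℕ) := EuclideanSpace ℝ (Fin n)

section

variable {n : ℕ}

theorem volume_closedBall_five (c : Eu n) {r : ℝ} (hr : 0 ≤ r) :
    volume (Metric.closedBall c (5 * r)) = 5 ^ n * volume (Metric.closedBall c r) := by
  rw [Measure.addHaar_closedBall _ _ hr, Measure.addHaar_closedBall _ _ (by positivity),
    ← mul_assoc, mul_pow, ENNReal.ofReal_mul (by positivity)]
  simp [ENNReal.ofReal_pow]

theorem tsum_volume_closedBall_five {u : Set (Eu n)} {r : Eu n → ℝ} (hr : ∀ x ∈ u, 0 < r x) :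
    ∑' x : u, volume (Metric.closedBall (x : Eu n) (5 * r x)) =
      5 ^ n * ∑' x : u, volume (Metric.closedBall (x : Eu n) (r x)) := by
  rw [← ENNReal.tsum_mul_left]
  exact tsum_congr fun x => volume_closedBall_five _ (hr x x.2).le

theorem exists_vitali_subfamily (S : Set (Eu n)) (r : Eu n → ℝ) (R : ℝ)
    (hr : ∀ x ∈ S, 0 < r x ∧ r x ≤ R) :
    ∃ u ⊆ S, u.Countable ∧ u.PairwiseDisjoint (fun x => Metric.closedBall x (r x)) ∧
      S ⊆ ⋃ x ∈ u, Metric.closedBall x (5 * r x) := by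
  obtain ⟨u, hu, hd, hc⟩ := Vitali.exists_disjoint_subfamily_covering_enlargement_closedBall
    S id r R (fun a ha => (hr a ha).2) 5 (by norm_num)
  refine ⟨u, hu, ?_, hd, ?_⟩
  · refine hd.countable_of_nonempty_interior fun x hx => ⟨x, ?_⟩
    exact Metric.ball_subset_interior_closedBall (Metric.mem_ball_self (hr x (hu hx)).1)
  · intro a ha
    obtain ⟨b, hb, hab⟩ := hc a ha
    exact mem_biUnion hb (hab (Metric.mem_closedBall_self (hr a ha).1.le))

/-- The sum of the volumes of disjoint balls on which `G` has average at least `β` is controlled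
by the integral of `G`. -/
theorem mul_tsum_volume_le {u : Set (Eu n)} (hu : u.Countable) {r : Eu n → ℝ}
    (hd : u.PairwiseDisjoint (fun x => Metric.closedBall x (r x))) (G : Eu n → ENNReal)
    (β : ENNReal)
    (h : ∀ x ∈ u, β * volume (Metric.closedBall x (r x)) ≤ ∫⁻ y in Metric.closedBall x (r x), G y) :
    β * ∑' x : u, volume (Metric.closedBall (x : Eu n) (r x)) ≤ ∫⁻ y, G y := by
  have : Countable u := hu
  rw [← ENNReal.tsum_mul_left]
  calc _ ≤ ∑' x : u, ∫⁻ y in Metric.closedBall (x : Eu n) (r x), G y :=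
        ENNReal.tsum_le_tsum fun x => h x x.2
    _ = ∫⁻ y in ⋃ x : u, Metric.closedBall (x : Eu n) (r x), G y :=
        (lintegral_iUnion (α := Eu n) (β := u) (fun _ => measurableSet_closedBall)
          (fun a b hab => hd a.2 b.2 (fun h => hab (Subtype.ext h))) G).symm
    _ ≤ _ := setLIntegral_le_lintegral _ _

/-- The Hardy–Littlewood maximal inequality for the centred maximal function. -/
theorem mul_volume_maximal_le (G : Eu n → ENNReal) (β : ENNReal) (S : Set (Eu n)) (R : ℝ)
    (h : ∀ x ∈ S, ∃ r : ℝ, 0 < r ∧ r ≤ R ∧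
      β * volume (Metric.closedBall x r) ≤ ∫⁻ y in Metric.closedBall x r, G y) :
    β * volume S ≤ 5 ^ n * ∫⁻ y, G y := by
  choose! r hr0 hrR hr using h
  obtain ⟨u, huS, huc, hd, hcov⟩ := exists_vitali_subfamily S r R fun x hx => ⟨hr0 x hx, hrR x hx⟩
  have : Countable u := huc
  calc β * volume S ≤ β * volume (⋃ x ∈ u, Metric.closedBall x (5 * r x)) := by gcongr
    _ ≤ β * ∑' x : u, volume (Metric.closedBall (x : Eu n) (5 * r x)) := by
        gcongr
        rw [biUnion_eq_iUnion]
        exact measure_iUnion_le _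
    _ = 5 ^ n * (β * ∑' x : u, volume (Metric.closedBall (x : Eu n) (r x))) := by
        rw [tsum_volume_closedBall_five fun x hx => hr0 x (huS hx)]
        ring
    _ ≤ _ := by gcongr; exact mul_tsum_volume_le huc hd G β fun x hx => hr x (huS hx)

/-- Calderón–Zygmund decomposition of the set where averages of `f` exceed a level. -/
theorem exists_calderonZygmund_cells (hn : 0 < n) {f : Eu n → ℝ} (hf : Integrable f) {α : ℝ} (hα : 0 < α) :
    ∃ (u : Set (Eu n)) (r : Eu n → ℝ) (Q : Eu n → Set (Eu n)), u.Countable ∧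
      (∀ x ∈ u, 0 < r x ∧ MeasurableSet (Q x) ∧ Q x ⊆ Metric.closedBall x (5 * r x) ∧
        volume (Metric.closedBall x (5 * r x)) ≤ 5 ^ n * volume (Q x) ∧
        ∫⁻ y in Metric.closedBall x (5 * r x), ‖f y‖ₑ ≤
          ENNReal.ofReal α * volume (Metric.closedBall x (5 * r x))) ∧
      u.PairwiseDisjoint Q ∧
      (∀ᵐ x, x ∉ ⋃ c ∈ u, Q c → |f x| ≤ α) ∧
      ENNReal.ofReal α * ∑' x : u, volume (Metric.closedBall (x : Eu n) (5 * r x))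
        ≤ 5 ^ n * ∫⁻ y, ‖f y‖ₑ := by
  set S : Set (Eu n) := {x | ∃ r : ℝ, 0 < r ∧ ENNReal.ofReal α * volume (Metric.closedBall x r) <
    ∫⁻ y in Metric.closedBall x r, ‖f y‖ₑ} with hS
  have hα' : ENNReal.ofReal α ≠ 0 := by simpa using hα
  have hv : volume (Metric.ball (0 : Eu n) 1) ≠ 0 := (Metric.measure_ball_pos _ _ one_pos).ne'
  have hv' : volume (Metric.ball (0 : Eu n) 1) ≠ ⊤ := measure_ball_lt_top.ne
  set I := ∫⁻ y, ‖f y‖ₑ with hI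
  have hIt : I ≠ ⊤ := hf.2.ne
  set W := I / (ENNReal.ofReal α * volume (Metric.ball (0 : Eu n) 1)) with hW
  have hWt : W ≠ ⊤ := ENNReal.div_ne_top hIt (mul_ne_zero hα' hv)
  have hbound : ∀ x : Eu n, ∀ r : ℝ, 0 < r → ENNReal.ofReal α * volume (Metric.closedBall x r) <
      ∫⁻ y in Metric.closedBall x r, ‖f y‖ₑ → r ≤ 1 + W.toReal := by
    intro x r hr h
    by_contra! hlt
    have h1 : ENNReal.ofReal α * volume (Metric.closedBall x r) < I :=
      h.trans_le (setLIntegral_le_lintegral _ _)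
    rw [Measure.addHaar_closedBall _ _ hr.le, finrank_euclideanSpace_fin] at h1
    have h2 : ENNReal.ofReal (r ^ n) ≤ W := by
      rw [hW, ENNReal.le_div_iff_mul_le (Or.inl (mul_ne_zero hα' hv))
        (Or.inl (ENNReal.mul_ne_top ENNReal.ofReal_ne_top hv'))]
      calc _ = ENNReal.ofReal α * (ENNReal.ofReal (r ^ n) * volume (Metric.ball (0 : Eu n) 1)) := by
            ring
        _ ≤ I := h1.le
    have h3 : r ^ n ≤ W.toReal := (ENNReal.ofReal_le_iff_le_toReal hWt).1 h2
    have h4 : (0 : ℝ) ≤ W.toReal := ENNReal.toReal_nonneg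
    have h5 : r ≤ r ^ n := le_self_pow₀ (by linarith) hn.ne'
    linarith
  have hchoose : ∀ x ∈ S, ∃ r : ℝ, 0 < r ∧ r ≤ 1 + W.toReal ∧
      ENNReal.ofReal α * volume (Metric.closedBall x r) < ∫⁻ y in Metric.closedBall x r, ‖f y‖ₑ ∧
      ∫⁻ y in Metric.closedBall x (5 * r), ‖f y‖ₑ ≤
        ENNReal.ofReal α * volume (Metric.closedBall x (5 * r)) := by
    intro x hx
    set T : Set ℝ := {r | 0 < r ∧ ENNReal.ofReal α * volume (Metric.closedBall x r) <
      ∫⁻ y in Metric.closedBall x r, ‖f y‖ₑ}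
    have hTb : BddAbove T := ⟨_, fun r hr => hbound x r hr.1 hr.2⟩
    obtain ⟨r0, hr0⟩ := hx
    have hs : 0 < sSup T := hr0.1.trans_le (le_csSup hTb hr0)
    obtain ⟨r, hrT, hr⟩ := exists_lt_of_lt_csSup ⟨r0, hr0⟩ (show sSup T / 5 < sSup T by linarith)
    refine ⟨r, hrT.1, hbound x r hrT.1 hrT.2, hrT.2, ?_⟩
    by_contra! h
    have : 5 * r ≤ sSup T := le_csSup hTb ⟨by linarith [hrT.1], h⟩
    linarith
  choose! r hr0 hrR hr hr5 using hchoose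
  obtain ⟨u, huS, huc, hd, hcov⟩ :=
    exists_vitali_subfamily S r (1 + W.toReal) fun x hx => ⟨hr0 x hx, hrR x hx⟩
  have : Countable u := huc
  obtain ⟨e, he⟩ := exists_injective_nat u
  set P : u → Set (Eu n) := fun x =>
    Metric.closedBall (x : Eu n) (5 * r x) \ ⋃ y ∈ {y : u | y ≠ x}, Metric.closedBall (y : Eu n) (r y)
    with hP
  have hPm : ∀ x, MeasurableSet (P x) := fun x => measurableSet_closedBall.diff
    (MeasurableSet.biUnion (Set.to_countable _) fun _ _ => measurableSet_closedBall)
  set Q' : u → Set (Eu n) := fun x => P x \ ⋃ y ∈ {y : u | e y < e x}, P y with hQ'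
  have hQm : ∀ x, MeasurableSet (Q' x) := fun x => (hPm x).diff
    (MeasurableSet.biUnion (Set.to_countable _) fun _ _ => hPm _)
  have hBP : ∀ x : u, Metric.closedBall (x : Eu n) (r x) ⊆ P x := by
    intro x y hy
    refine ⟨Metric.closedBall_subset_closedBall (by linarith [hr0 x (huS x.2)]) hy, ?_⟩
    simp only [mem_iUnion, not_exists]
    intro z hz hyz
    exact (Set.disjoint_left.1 (hd z.2 x.2 fun h => hz (Subtype.ext h))) hyz hy
  have hBQ : ∀ x : u, Metric.closedBall (x : Eu n) (r x) ⊆ Q' x := by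
    intro x y hy
    refine ⟨hBP x hy, ?_⟩
    simp only [mem_iUnion, not_exists]
    intro z hz hyz
    refine hyz.2 (mem_biUnion (x := x) ?_ hy)
    rintro rfl
    exact lt_irrefl _ (show e x < e x from hz)
  have hcov' : S ⊆ ⋃ x, Q' x := by
    intro y hy
    have hex : ∃ x : u, y ∈ P x := by
      by_cases hB : ∃ x : u, y ∈ Metric.closedBall (x : Eu n) (r x)
      · obtain ⟨x, hx⟩ := hB
        exact ⟨x, hBP x hx⟩
      · push Not at hB
        obtain ⟨x, hx, hyx⟩ := mem_iUnion₂.1 (hcov hy)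
        refine ⟨⟨x, hx⟩, hyx, ?_⟩
        simp only [mem_iUnion, not_exists]
        exact fun z _ => hB z
    have hex' : ∃ k, ∃ x : u, e x = k ∧ y ∈ P x := by
      obtain ⟨x, hx⟩ := hex
      exact ⟨_, x, rfl, hx⟩
    classical
    obtain ⟨x, hxk, hx⟩ := Nat.find_spec hex'
    refine mem_iUnion.2 ⟨x, hx, ?_⟩
    simp only [mem_iUnion, not_exists]
    intro z hz hyz
    rw [mem_ofPred_eq, hxk] at hz
    exact Nat.find_min hex' hz ⟨z, rfl, hyz⟩
  classical
  set Q : Eu n → Set (Eu n) := fun x => if hx : x ∈ u then Q' ⟨x, hx⟩ else ∅ with hQ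
  have hQu : ∀ x (hx : x ∈ u), Q x = Q' ⟨x, hx⟩ := fun x hx => by simp [hQ, hx]
  refine ⟨u, r, Q, huc, ?_, ?_, ?_, ?_⟩
  · intro x hx
    refine ⟨hr0 x (huS hx), ?_, ?_, ?_, hr5 x (huS hx)⟩
    · rw [hQu x hx]; exact hQm _
    · rw [hQu x hx]; exact fun y hy => hy.1.1
    · rw [hQu x hx, volume_closedBall_five _ (hr0 x (huS hx)).le]
      gcongr
      exact hBQ ⟨x, hx⟩
  · intro x hx y hy hxy
    simp only [Function.onFun]
    rw [hQu x hx, hQu y hy, Set.disjoint_left]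
    intro z hz1 hz2
    rcases lt_trichotomy (e ⟨x, hx⟩) (e ⟨y, hy⟩) with h | h | h
    · exact hz2.2 (mem_biUnion h hz1.1)
    · exact hxy (congrArg Subtype.val (he h))
    · exact hz1.2 (mem_biUnion h hz2.1)
  · filter_upwards [IsUnifLocDoublingMeasure.ae_tendsto_average (μ := volume)
      hf.norm.locallyIntegrable 1] with x hx hxQ
    have hxS : x ∉ S := by
      intro hxS
      obtain ⟨c, hc⟩ := mem_iUnion.1 (hcov' hxS)
      exact hxQ (mem_biUnion c.2 (by rw [hQu _ c.2]; exact hc))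
    have ht := hx (l := nhdsWithin 0 (Ioi 0)) (fun _ => x) (fun t : ℝ => t) tendsto_id
      (by filter_upwards [self_mem_nhdsWithin] with t (ht : 0 < t)
          simpa using ht.le)
    refine le_of_tendsto ht ?_
    filter_upwards [self_mem_nhdsWithin] with t (ht : 0 < t)
    have h1 : ¬ (ENNReal.ofReal α * volume (Metric.closedBall x t) <
      ∫⁻ y in Metric.closedBall x t, ‖f y‖ₑ) := fun h => hxS ⟨t, ht, h⟩
    push Not at h1
    have hvp : 0 < volume.real (Metric.closedBall x t) :=
      ENNReal.toReal_pos (Metric.measure_closedBall_pos _ _ ht).ne' measure_closedBall_lt_top.ne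
    rw [setAverage_eq, smul_eq_mul, inv_mul_le_iff₀ hvp,
      integral_norm_eq_lintegral_enorm hf.1.restrict]
    refine ENNReal.toReal_le_of_le_ofReal (by positivity) (h1.trans_eq ?_)
    rw [ENNReal.ofReal_mul measureReal_nonneg, ofReal_measureReal measure_closedBall_lt_top.ne,
      mul_comm]
  · calc _ = 5 ^ n * (ENNReal.ofReal α * ∑' x : u, volume (Metric.closedBall (x : Eu n) (r x))) := by
          rw [tsum_volume_closedBall_five fun x hx => hr0 x (huS hx)]
          ring
      _ ≤ _ := by
        gcongr
        exact mul_tsum_volume_le huc hd _ _ fun x hx => (hr x (huS hx)).le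

end

section

variable {n : ℕ}

/-- A Calderón–Zygmund kernel on `ℝⁿ` whose regularity is measured in the integral sense of
Hörmander, with constants `M` and `A`. -/
structure CZKernel (K : Eu n → ℝ) (M A : ℝ) : Prop where
  two_le : 2 ≤ M
  nonneg : 0 ≤ A
  meas : Measurable K
  size : ∀ a b : ℝ, 0 < a → a ≤ b →
    ∫⁻ x in {x : Eu n | a ≤ ‖x‖ ∧ ‖x‖ ≤ b}, ‖K x‖ₑ ≤ ENNReal.ofReal (A * Real.log (b / a))
  moment : ∀ ρ : ℝ, 0 < ρ →
    ∫⁻ x in {x : Eu n | ‖x‖ ≤ ρ}, ‖x‖ₑ * ‖K x‖ₑ ≤ ENNReal.ofReal (A * ρ)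
  hormander : ∀ (h : Eu n) (s : ℝ), 0 < s → ‖h‖ ≤ s →
    ∫⁻ x in {x : Eu n | M * s ≤ ‖x‖}, ‖K (x - h) - K x‖ₑ ≤ ENNReal.ofReal A
  cancel : ∀ a b : ℝ, 0 < a → ∫ x in {x : Eu n | a < ‖x‖ ∧ ‖x‖ ≤ b}, K x = 0

/-- The truncated singular integral of a function. -/
def czT (K : Eu n → ℝ) (ε : ℝ) (f : Eu n → ℝ) (x : Eu n) : ℝ :=
  ∫ y in {y | ε < ‖x - y‖}, K (x - y) * f y

theorem measurableSet_lt_norm_sub (ε : ℝ) (x : Eu n) : MeasurableSet {y : Eu n | ε < ‖x - y‖} :=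
  measurableSet_lt measurable_const (by fun_prop)

theorem measurableSet_annulus (a b : ℝ) : MeasurableSet {x : Eu n | a < ‖x‖ ∧ ‖x‖ ≤ b} :=
  (measurableSet_lt measurable_const measurable_norm).inter
    (measurableSet_le measurable_norm measurable_const)

namespace CZKernel

variable {K : Eu n → ℝ} {M A : ℝ}

theorem lintegral_closedBall_le (hK : CZKernel K M A) {ε N : ℝ} (hε : 0 < ε) (hN : 0 ≤ N)
    (c : Eu n) : ∫⁻ x in {x : Eu n | ‖x - c‖ ≤ N ∧ ε < ‖x‖}, ‖K x‖ₑ ≤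
      ENNReal.ofReal (A * (2 * N / ε)) := by
  set a := max ε (‖c‖ - N)
  have ha : 0 < a := lt_max_of_lt_left hε
  rcases lt_or_ge (‖c‖ + N) a with h | h
  · have : {x : Eu n | ‖x - c‖ ≤ N ∧ ε < ‖x‖} = ∅ := by
      ext x
      simp only [mem_ofPred_eq, mem_empty_iff_false, iff_false, not_and, not_lt]
      intro hx
      have h1 : ‖x‖ ≤ ‖c‖ + N := by
        calc ‖x‖ = ‖c + (x - c)‖ := by congr 1; abel
          _ ≤ _ := (norm_add_le _ _).trans (by linarith)
      rcases lt_max_iff.1 h with h2 | h2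
      · linarith
      · linarith
    rw [this]; simp
  · calc _ ≤ ∫⁻ x in {x : Eu n | a ≤ ‖x‖ ∧ ‖x‖ ≤ ‖c‖ + N}, ‖K x‖ₑ := by
          refine lintegral_mono_set ?_
          rintro x ⟨hx, hx'⟩
          have h1 : ‖x‖ ≤ ‖c‖ + N := by
            calc ‖x‖ = ‖c + (x - c)‖ := by congr 1; abel
              _ ≤ _ := (norm_add_le _ _).trans (by linarith)
          have h2 : ‖c‖ ≤ ‖x‖ + N := by
            calc ‖c‖ = ‖x - (x - c)‖ := by congr 1; abel
              _ ≤ _ := (norm_sub_le _ _).trans (by linarith)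
          exact ⟨max_le hx'.le (by linarith), h1⟩
      _ ≤ _ := hK.size a _ ha h
      _ ≤ _ := by
        have h1 : Real.log ((‖c‖ + N) / a) ≤ 2 * N / ε := by
          have hpos : 0 < (‖c‖ + N) / a := div_pos (ha.trans_le h) ha
          refine (Real.log_le_sub_one_of_pos hpos).trans ?_
          have h2 : ‖c‖ + N ≤ a + 2 * N := by
            have := le_max_right ε (‖c‖ - N)
            linarith
          have h3 : (‖c‖ + N) / a ≤ (a + 2 * N) / a := by gcongr
          have h4 : (a + 2 * N) / a = 1 + 2 * N / a := by field_simp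
          have h5 : 2 * N / a ≤ 2 * N / ε := by
            gcongr
            exact le_max_left _ _
          linarith
        gcongr
        exact hK.nonneg

theorem ae_integrableOn_truncation (hK : CZKernel K M A) {f : Eu n → ℝ} (hf : Integrable f) :
    ∀ᵐ x, ∀ ε : ℝ, 0 < ε → IntegrableOn (fun y => K (x - y) * f y) {y | ε < ‖x - y‖} := by
  have key : ∀ k N : ℕ, ∀ᵐ x, x ∈ Metric.closedBall (0 : Eu n) N →
      ∫⁻ y in {y | (1 / ((k : ℝ) + 1)) < ‖x - y‖}, ‖K (x - y)‖ₑ * ‖f y‖ₑ < ⊤ := by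
    intro k N
    set ε : ℝ := 1 / ((k : ℝ) + 1)
    have hε : 0 < ε := by positivity
    have hKm := hK.meas
    set F : Eu n → Eu n → ENNReal := fun x y =>
      ({z : Eu n | ε < ‖z‖}.indicator (fun z => ‖K z‖ₑ) (x - y)) * ‖f y‖ₑ with hF
    have hms : MeasurableSet {z : Eu n | ε < ‖z‖} := measurableSet_lt measurable_const (by fun_prop)
    have hI : Measurable ({z : Eu n | ε < ‖z‖}.indicator (fun z => ‖K z‖ₑ)) :=
      hKm.enorm.indicator hms
    have hFm : AEMeasurable (Function.uncurry F)
        ((volume.restrict (Metric.closedBall (0 : Eu n) N)).prod volume) := by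
      refine AEMeasurable.mul ?_ ?_
      · exact (hI.comp (measurable_fst.sub measurable_snd)).aemeasurable
      · exact hf.1.aemeasurable.enorm.comp_quasiMeasurePreserving
          Measure.quasiMeasurePreserving_snd
    have hFin : ∫⁻ x in Metric.closedBall (0 : Eu n) N, ∫⁻ y, F x y ≠ ⊤ := by
      rw [lintegral_lintegral_swap hFm]
      have : ∀ y, ∫⁻ x in Metric.closedBall (0 : Eu n) N, F x y ≤
          ENNReal.ofReal (A * (2 * N / ε)) * ‖f y‖ₑ := by
        intro y
        simp only [hF]
        have hIy : Measurable fun x : Eu n => {z : Eu n | ε < ‖z‖}.indicator (fun z => ‖K z‖ₑ) (x - y) :=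
          hI.comp (measurable_id.sub_const y)
        rw [lintegral_mul_const _ hIy]
        gcongr
        refine le_trans (le_of_eq ?_)
          (hK.lintegral_closedBall_le hε (Nat.cast_nonneg N) (-y))
        rw [← lintegral_indicator measurableSet_closedBall, ← lintegral_indicator,
          ← lintegral_sub_right_eq_self (μ := volume) (g := y)
            (f := {x : Eu n | ‖x - -y‖ ≤ N ∧ ε < ‖x‖}.indicator (fun x => ‖K x‖ₑ))]
        · congr 1
          ext x
          by_cases h1 : ‖x‖ ≤ N <;> by_cases h2 : ε < ‖x - y‖ <;> simp [indicator, h1, h2]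
        · exact (measurableSet_le (measurable_id.sub_const (-y)).norm measurable_const).inter hms
      refine ne_top_of_le_ne_top ?_ (lintegral_mono this)
      rw [lintegral_const_mul' _ _ ENNReal.ofReal_ne_top]
      exact ENNReal.mul_ne_top ENNReal.ofReal_ne_top hf.2.ne
    have h1 := ae_lt_top' (hFm.lintegral_prod_right') hFin
    rw [ae_restrict_iff' measurableSet_closedBall] at h1
    filter_upwards [h1] with x hx hxN
    refine lt_of_le_of_lt (le_of_eq ?_) (hx hxN)
    rw [← lintegral_indicator (measurableSet_lt_norm_sub _ _)]
    congr 1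
    ext y
    by_cases h2 : ε < ‖x - y‖ <;> simp [indicator, h2, hF, Function.uncurry]
  have key' := ae_all_iff.2 fun k => ae_all_iff.2 (key k)
  filter_upwards [key'] with x hx ε hε
  obtain ⟨k, hk⟩ := exists_nat_one_div_lt hε
  obtain ⟨N, hN⟩ := exists_nat_ge ‖x‖
  have hm : AEStronglyMeasurable (fun y => K (x - y) * f y) :=
    ((hK.meas.comp (measurable_const.sub measurable_id)).aestronglyMeasurable).mul hf.1
  refine ⟨hm.restrict, ?_⟩
  refine lt_of_le_of_lt ?_ (hx k N (by simpa using hN))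
  have hsub : {y | ε < ‖x - y‖} ⊆ {y | 1 / ((k : ℝ) + 1) < ‖x - y‖} :=
    fun y hy => hk.trans (show ε < ‖x - y‖ from hy)
  refine (lintegral_mono_set hsub).trans (le_of_eq ?_)
  simp only [enorm_mul]

theorem integrableOn_annulus (hK : CZKernel K M A) {a b : ℝ} (ha : 0 < a) :
    IntegrableOn K {x : Eu n | a < ‖x‖ ∧ ‖x‖ ≤ b} := by
  refine ⟨hK.meas.aestronglyMeasurable, ?_⟩
  rcases lt_or_ge b a with h | h
  · have : {x : Eu n | a < ‖x‖ ∧ ‖x‖ ≤ b} = ∅ := by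
      ext x
      simp only [mem_ofPred_eq, mem_empty_iff_false, iff_false, not_and, not_le]
      intro hx
      linarith
    rw [this]; simp [HasFiniteIntegral]
  · have hsub : {x : Eu n | a < ‖x‖ ∧ ‖x‖ ≤ b} ⊆ {x : Eu n | a ≤ ‖x‖ ∧ ‖x‖ ≤ b} :=
      fun x hx => ⟨hx.1.le, hx.2⟩
    exact lt_of_le_of_lt (lintegral_mono_set hsub)
      ((hK.size a b ha h).trans_lt ENNReal.ofReal_lt_top)

end CZKernel

end

section

variable {n : ℕ}

open FourierTransform SchwartzMap in
theorem eLpNorm_fourier_eq {u : Eu n → ℂ} (h1 : Integrable u) (h2 : MemLp u 2 volume) :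
    eLpNorm (𝓕 u) 2 volume = eLpNorm u 2 volume := by
  have hcont : Continuous (𝓕 u) := by
    exact VectorFourier.fourierIntegral_continuous Real.continuous_fourierChar
      (innerSL ℝ).continuous₂ h1
  set U : Lp ℂ 2 (volume : Measure (Eu n)) := h2.toLp u with hU
  have hae : ∀ᵐ x, 𝓕 u x = (𝓕 U : Lp ℂ 2 (volume : Measure (Eu n))) x := by
    refine ae_eq_of_integral_contDiff_smul_eq hcont.locallyIntegrable
      ((Lp.memLp _).locallyIntegrable (by norm_num)) fun g hg hgc => ?_
    have hgc' : HasCompactSupport (fun x => (g x : ℂ)) := hgc.comp_left (g := fun t : ℝ => (t : ℂ)) (by simp)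
    set φ : 𝓢(Eu n, ℂ) := hgc'.toSchwartzMap (Complex.ofRealCLM.contDiff.comp hg) with hφ
    have hφg : ∀ x, φ x = (g x : ℂ) := fun x => rfl
    have e1 := congrArg (fun T : TemperedDistribution (Eu n) ℂ => T φ)
      (Lp.fourier_toTemperedDistribution_eq U)
    simp only [TemperedDistribution.fourier_apply, Lp.toTemperedDistribution_apply] at e1
    have e2 : ∫ x, (𝓕 φ) x • U x = ∫ x, (𝓕 φ) x • u x := by
      refine integral_congr_ae ?_
      filter_upwards [h2.coeFn_toLp] with x hx
      rw [hU, hx]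
    have e3 : ∫ x, (𝓕 (φ : Eu n → ℂ)) x • u x = ∫ x, φ x • (𝓕 u) x := by
      have := VectorFourier.integral_fourierIntegral_smul_eq_flip
        (μ := (volume : Measure (Eu n))) (ν := (volume : Measure (Eu n)))
        (L := innerₗ (Eu n)) (f := φ) (g := u) Real.continuous_fourierChar continuous_inner φ.integrable h1
      rw [show (innerₗ (Eu n)).flip = innerₗ (Eu n) by ext x y; simp] at this
      exact this
    calc ∫ x, g x • 𝓕 u x = ∫ x, φ x • 𝓕 u x := by simp [hφg]
      _ = ∫ x, (𝓕 φ) x • u x := by rw [← e3, SchwartzMap.fourier_coe]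
      _ = ∫ x, φ x • (𝓕 U : Lp ℂ 2 (volume : Measure (Eu n))) x := by rw [← e2, e1]
      _ = _ := by simp [hφg]
  rw [eLpNorm_congr_ae hae, ← Lp.enorm_def, ← eLpNorm_congr_ae h2.coeFn_toLp, ← Lp.enorm_def]
  rw [← ofReal_norm, ← ofReal_norm, Lp.norm_fourier_eq]

end

section

variable {n : ℕ}

theorem memLp_two_of_integrable_of_bound {g : Eu n → ℂ} (h : Integrable g) {B : ℝ}
    (hB : ∀ x, ‖g x‖ ≤ B) : MemLp g 2 volume := by
  rw [memLp_two_iff_integrable_sq_norm h.1]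
  have := h.norm.bdd_mul (f := fun x => ‖g x‖) (c := B) h.1.norm (Eventually.of_forall fun x => by simpa using hB x)
  simpa [sq] using this

theorem eLpNorm_two_sq {E : Type*} [NormedAddCommGroup E] (f : Eu n → E) :
    eLpNorm f 2 volume ^ 2 = ∫⁻ x, ‖f x‖ₑ ^ 2 := by
  rw [eLpNorm_eq_lintegral_rpow_enorm_toReal (by norm_num) (by norm_num), ← ENNReal.rpow_natCast,
    ← ENNReal.rpow_mul]
  simp

open FourierTransform Convolution in
theorem lintegral_sq_conv_le {k g : Eu n → ℝ} (hk : Integrable k) (hg : Integrable g) {B : ℝ}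
    (hB : ∀ x, |g x| ≤ B) {C : ℝ} (hC : ∀ ξ, ‖𝓕 (fun x => (k x : ℂ)) ξ‖ ≤ C) :
    ∫⁻ x, ‖∫ y, k (x - y) * g y‖ₑ ^ 2 ≤ ENNReal.ofReal C ^ 2 * ∫⁻ x, ‖g x‖ₑ ^ 2 := by
  set kc : Eu n → ℂ := fun x => (k x : ℂ) with hkc
  set gc : Eu n → ℂ := fun x => (g x : ℂ) with hgc
  have hkci : Integrable kc := hk.ofReal
  have hgci : Integrable gc := hg.ofReal
  have hgB : ∀ x, ‖gc x‖ ≤ B := fun x => by simpa [hgc] using hB x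
  have hg2 : MemLp gc 2 volume := memLp_two_of_integrable_of_bound hgci hgB
  set w : Eu n → ℂ := gc ⋆[ContinuousLinearMap.mul ℂ ℂ] kc with hw
  have hwe : ∀ x, w x = ((∫ y, k (x - y) * g y : ℝ) : ℂ) := by
    intro x
    rw [hw, convolution_def]
    refine Eq.trans ?_ (integral_ofReal (𝕜 := ℂ))
    refine integral_congr_ae (Eventually.of_forall fun y => ?_)
    simp [hkc, hgc, mul_comm]
  have hw1 : Integrable w := hgci.integrable_convolution _ hkci
  have hwB : ∀ x, ‖w x‖ ≤ B * ∫ y, |k y| := by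
    intro x
    rw [hwe, Complex.norm_real, ← integral_sub_left_eq_self (fun y => |k y|) volume x,
      ← integral_const_mul]
    refine norm_integral_le_of_norm_le ((hk.abs.comp_sub_left x).const_mul B) ?_
    refine Eventually.of_forall fun y => ?_
    rw [norm_mul, mul_comm, Real.norm_eq_abs, Real.norm_eq_abs]
    exact mul_le_mul_of_nonneg_right (hB y) (abs_nonneg _)
  have hw2 : MemLp w 2 volume := memLp_two_of_integrable_of_bound hw1 hwB
  have e1 : ∫⁻ x, ‖∫ y, k (x - y) * g y‖ₑ ^ 2 = ∫⁻ x, ‖𝓕 w x‖ₑ ^ 2 := by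
    rw [← eLpNorm_two_sq (𝓕 w), eLpNorm_fourier_eq hw1 hw2, eLpNorm_two_sq]
    refine lintegral_congr fun x => ?_
    rw [hwe, ← ofReal_norm, ← ofReal_norm, Complex.norm_real]
  have e2 : ∫⁻ x, ‖g x‖ₑ ^ 2 = ∫⁻ x, ‖𝓕 gc x‖ₑ ^ 2 := by
    rw [← eLpNorm_two_sq (𝓕 gc), eLpNorm_fourier_eq hgci hg2, eLpNorm_two_sq]
    refine lintegral_congr fun x => ?_
    rw [hgc, ← ofReal_norm, ← ofReal_norm, Complex.norm_real]
  rw [e1, e2, ← lintegral_const_mul' _ _ (by simp)]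
  refine lintegral_mono fun x => ?_
  rw [hw, Real.fourier_mul_convolution_eq hgci hkci, enorm_mul, mul_comm, mul_pow]
  gcongr
  rw [← ofReal_norm]
  exact ENNReal.ofReal_le_ofReal (hC x)

end

section

variable {n : ℕ}

/-- The restriction of a kernel to an annulus. -/
def annK (K : Eu n → ℝ) (a b : ℝ) : Eu n → ℝ := {x : Eu n | a < ‖x‖ ∧ ‖x‖ ≤ b}.indicator K

namespace CZKernel

variable {K : Eu n → ℝ} {M A : ℝ}

theorem integrable_annK (hK : CZKernel K M A) {a b : ℝ} (ha : 0 < a) : Integrable (annK K a b) :=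
  (integrable_indicator_iff (measurableSet_annulus a b)).2 (hK.integrableOn_annulus ha)

theorem integral_annK (hK : CZKernel K M A) {a b : ℝ} (ha : 0 < a) : ∫ x, annK K a b x = 0 := by
  rw [annK, integral_indicator (measurableSet_annulus a b), hK.cancel a b ha]

open FourierTransform Real in
theorem norm_fourier_annK_inner_le (hK : CZKernel K M A) {a b ρ : ℝ} (ha : 0 < a) (hρ : 0 < ρ)
    (hb : b ≤ ρ) (ξ : Eu n) :
    ‖𝓕 (fun x => (annK K a b x : ℂ)) ξ‖ ≤ 2 * π * ‖ξ‖ * (A * ρ) := by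
  have hi := hK.integrable_annK (b := b) ha
  have hic : Integrable fun x => (annK K a b x : ℂ) := hi.ofReal
  have h0 : ∫ x, (annK K a b x : ℂ) = 0 := by
    refine (integral_ofReal (𝕜 := ℂ) (f := annK K a b)).trans ?_
    rw [hK.integral_annK ha]; simp
  have hfi : Integrable fun x => Complex.exp ((↑(-2 * π * inner ℝ x ξ) * Complex.I)) • (annK K a b x : ℂ) := by
    refine Integrable.bdd_mul (c := 1) hi.ofReal (by fun_prop) (Eventually.of_forall fun x => ?_)
    rw [Complex.norm_exp_ofReal_mul_I]
  rw [Real.fourier_eq', ← sub_zero (∫ v, _ • _), ← h0]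
  refine (congrArg norm (integral_sub hfi hic).symm).le.trans ?_
  refine (norm_integral_le_lintegral_norm _).trans ?_
  refine ENNReal.toReal_le_of_le_ofReal (by have := hK.nonneg; positivity) ?_
  calc _ ≤ ∫⁻ x, ENNReal.ofReal (2 * π * ‖ξ‖) *
        {x : Eu n | ‖x‖ ≤ ρ}.indicator (fun x => ‖x‖ₑ * ‖K x‖ₑ) x := by
        refine lintegral_mono fun x => ?_
        by_cases hx : a < ‖x‖ ∧ ‖x‖ ≤ b
        · have hx2 : ‖x‖ ≤ ρ := hx.2.trans hb
          simp only [annK, indicator, mem_ofPred_eq, hx, hx2, and_self, if_true]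
          rw [← ofReal_norm, ← ofReal_norm, ← ENNReal.ofReal_mul (norm_nonneg _),
            ← ENNReal.ofReal_mul (by positivity)]
          refine ENNReal.ofReal_le_ofReal ?_
          have h1 := norm_exp_I_mul_ofReal_sub_one_le (x := -2 * π * inner ℝ x ξ)
          rw [smul_eq_mul, show ∀ u v : ℂ, u * v - v = (u - 1) * v from fun u v => by ring,
            norm_mul, Complex.norm_real, mul_comm _ Complex.I]
          have h2 : ‖-2 * π * inner ℝ x ξ‖ ≤ 2 * π * ‖ξ‖ * ‖x‖ := by
            rw [norm_mul]
            have := abs_real_inner_le_norm x ξ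
            have h3 : ‖-2 * π‖ = 2 * π := by
              rw [Real.norm_eq_abs, abs_of_neg (by have := pi_pos; linarith)]; ring
            rw [h3, Real.norm_eq_abs]
            nlinarith [pi_pos]
          rw [← mul_assoc]
          exact mul_le_mul_of_nonneg_right (h1.trans h2) (norm_nonneg _)
        · simp [annK, indicator, mem_ofPred_eq, hx]
    _ ≤ ENNReal.ofReal (2 * π * ‖ξ‖) * ENNReal.ofReal (A * ρ) := by
        rw [lintegral_const_mul' _ _ ENNReal.ofReal_ne_top,
          lintegral_indicator (measurableSet_le measurable_norm measurable_const)]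
        gcongr
        exact hK.moment ρ hρ
    _ = _ := (ENNReal.ofReal_mul (by positivity)).symm

theorem lintegral_annK_sub_le (hK : CZKernel K M A) {a b s : ℝ} (hs : 0 < s) (ha : M * s ≤ a)
    (hab : a ≤ b) {h : Eu n} (hh : ‖h‖ ≤ s) :
    ∫⁻ x, ‖annK K a b (x - h) - annK K a b x‖ₑ ≤ ENNReal.ofReal (A * (1 + 4 * Real.log 4)) := by
  have hM := hK.two_le
  have ha0 : 0 < a := by nlinarith
  have has : 2 * s ≤ a := by nlinarith
  set S : Set (Eu n) := {x | a / 2 ≤ ‖x‖ ∧ ‖x‖ ≤ 2 * a}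
  set S' : Set (Eu n) := {x | b / 2 ≤ ‖x‖ ∧ ‖x‖ ≤ 2 * b}
  have mS : ∀ a : ℝ, MeasurableSet {x : Eu n | a / 2 ≤ ‖x‖ ∧ ‖x‖ ≤ 2 * a} := fun a =>
    (measurableSet_le measurable_const measurable_norm).inter
      (measurableSet_le measurable_norm measurable_const)
  set D : Eu n → ENNReal := {x : Eu n | M * s ≤ ‖x‖}.indicator fun x => ‖K (x - h) - K x‖ₑ
  set E : Eu n → ENNReal := fun x => S.indicator (fun x => ‖K x‖ₑ) x + S'.indicator (fun x => ‖K x‖ₑ) x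
  have hKm := hK.meas
  have hE : Measurable E := (hKm.enorm.indicator (mS a)).add (hKm.enorm.indicator (mS b))
  have hint : ∀ a : ℝ, 0 < a → ∫⁻ x, {x : Eu n | a / 2 ≤ ‖x‖ ∧ ‖x‖ ≤ 2 * a}.indicator (fun x => ‖K x‖ₑ) x
      ≤ ENNReal.ofReal (A * Real.log 4) := by
    intro a ha
    rw [lintegral_indicator (mS a)]
    refine (hK.size _ _ (by positivity) (by linarith)).trans (le_of_eq ?_)
    congr 3
    field_simp
    norm_num
  have hEi : ∫⁻ x, E x ≤ ENNReal.ofReal (A * (2 * Real.log 4)) := by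
    rw [lintegral_add_left (hKm.enorm.indicator (mS a))]
    refine (add_le_add (hint a ha0) (hint b (by linarith))).trans (le_of_eq ?_)
    have := hK.nonneg
    have := Real.log_nonneg (show (1 : ℝ) ≤ 4 by norm_num)
    rw [← ENNReal.ofReal_add (by positivity) (by positivity)]
    congr 1; ring
  have key : ∀ x, ‖annK K a b (x - h) - annK K a b x‖ₑ ≤ D x + (E x + E (x - h)) := by
    intro x
    have t1 : ‖x‖ ≤ ‖x - h‖ + s := by
      calc ‖x‖ = ‖(x - h) + h‖ := by congr 1; abel
        _ ≤ _ := (norm_add_le _ _).trans (by linarith)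
    have t2 : ‖x - h‖ ≤ ‖x‖ + s := (norm_sub_le _ _).trans (by linarith)
    by_cases h1 : a < ‖x‖ ∧ ‖x‖ ≤ b <;> by_cases h2 : a < ‖x - h‖ ∧ ‖x - h‖ ≤ b
    · have : annK K a b (x - h) - annK K a b x = K (x - h) - K x := by
        simp [annK, indicator, mem_ofPred_eq, h1, h2]
      rw [this]
      have hm : x ∈ {x : Eu n | M * s ≤ ‖x‖} := ha.trans h1.1.le
      simp only [D, indicator_of_mem hm]
      exact le_self_add
    · have : annK K a b (x - h) - annK K a b x = - K x := by
        simp [annK, indicator, mem_ofPred_eq, h1, h2]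
      rw [this, enorm_neg]
      have : ‖K x‖ₑ ≤ E x := by
        by_cases h3 : a < ‖x - h‖
        · have h4 : b < ‖x - h‖ := not_le.1 fun h => h2 ⟨h3, h⟩
          have hm : x ∈ S' := ⟨by linarith, by linarith [h1.2]⟩
          simp only [E, indicator_of_mem hm]
          exact le_add_self
        · have hm : x ∈ S := ⟨by linarith, by linarith⟩
          simp only [E, indicator_of_mem hm]
          exact le_self_add
      exact this.trans (le_self_add.trans le_add_self)
    · have : annK K a b (x - h) - annK K a b x = K (x - h) := by
        simp [annK, indicator, mem_ofPred_eq, h1, h2]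
      rw [this]
      have : ‖K (x - h)‖ₑ ≤ E (x - h) := by
        by_cases h3 : a < ‖x‖
        · have h4 : b < ‖x‖ := not_le.1 fun h => h1 ⟨h3, h⟩
          have hm : x - h ∈ S' := ⟨by linarith, by linarith [h2.2]⟩
          simp only [E, indicator_of_mem hm]
          exact le_add_self
        · have hm : x - h ∈ S := ⟨by linarith, by linarith⟩
          simp only [E, indicator_of_mem hm]
          exact le_self_add
      exact this.trans (le_add_self.trans le_add_self)
    · have : annK K a b (x - h) - annK K a b x = 0 := by
        simp [annK, indicator, mem_ofPred_eq, h1, h2]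
      rw [this]; simp
  have hEt : ∫⁻ x, E (x - h) = ∫⁻ x, E x := lintegral_sub_right_eq_self E h
  calc _ ≤ ∫⁻ x, (D x + (E x + E (x - h))) := lintegral_mono key
    _ = (∫⁻ x, D x) + ((∫⁻ x, E x) + ∫⁻ x, E x) := by
        have hm : Measurable fun x => E x + E (x - h) :=
          hE.add (hE.comp (measurable_id.sub_const h))
        rw [lintegral_add_right _ hm, lintegral_add_left hE, hEt]
    _ ≤ ENNReal.ofReal A + (ENNReal.ofReal (A * (2 * Real.log 4)) +
        ENNReal.ofReal (A * (2 * Real.log 4))) := by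
        refine add_le_add ?_ (add_le_add hEi hEi)
        rw [lintegral_indicator (measurableSet_le measurable_const measurable_norm)]
        exact hK.hormander h s hs hh
    _ = _ := by
        have := hK.nonneg
        have := Real.log_nonneg (show (1 : ℝ) ≤ 4 by norm_num)
        rw [← ENNReal.ofReal_add (by positivity) (by positivity),
          ← ENNReal.ofReal_add (by positivity) (by positivity)]
        congr 1; ring

open FourierTransform Real in
theorem norm_fourier_annK_outer_le (hK : CZKernel K M A) {a b : ℝ} {ξ : Eu n} (hξ : ξ ≠ 0)
    (ha : M * (1 / (2 * ‖ξ‖)) ≤ a) (hab : a ≤ b) :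
    ‖𝓕 (fun x => (annK K a b x : ℂ)) ξ‖ ≤ A * (1 + 4 * Real.log 4) := by
  have hξ' : 0 < ‖ξ‖ := norm_pos_iff.2 hξ
  set s := 1 / (2 * ‖ξ‖) with hs
  have hs0 : 0 < s := by positivity
  have hM := hK.two_le
  have ha0 : 0 < a := by nlinarith
  set h : Eu n := (1 / (2 * ‖ξ‖ ^ 2)) • ξ with hh
  have hhs : ‖h‖ = s := by
    rw [hh, norm_smul, Real.norm_of_nonneg (by positivity), hs]
    field_simp
  have hinner : inner ℝ h ξ = 1 / 2 := by
    rw [hh, inner_smul_left, real_inner_self_eq_norm_sq]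
    simp; field_simp
  set k : Eu n → ℂ := fun x => (annK K a b x : ℂ) with hk
  have hki : Integrable k := (hK.integrable_annK ha0).ofReal
  have hsh : 𝓕 (fun x => k (x - h)) ξ = - 𝓕 k ξ := by
    rw [Real.fourier_eq', Real.fourier_eq', ← integral_sub_right_eq_self
      (fun x => Complex.exp ((-2 * π * inner ℝ x ξ : ℝ) * Complex.I) • k x) h,
      ← integral_neg]
    refine integral_congr_ae (Eventually.of_forall fun x => ?_)
    have : Complex.exp ((-2 * π * inner ℝ x ξ : ℝ) * Complex.I) =
        - Complex.exp ((-2 * π * inner ℝ (x - h) ξ : ℝ) * Complex.I) := by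
      rw [inner_sub_left, hinner, ← Complex.exp_add_pi_mul_I, ← Complex.exp_periodic.sub_eq (_ + _)]
      congr 1
      push_cast
      ring
    simp only [smul_eq_mul]
    rw [this]; ring
  have h2 : 𝓕 (fun x => k (x - h) - k x) ξ = -(2 * 𝓕 k ξ) := by
    have : 𝓕 (fun x => k (x - h) - k x) ξ = 𝓕 (fun x => k (x - h)) ξ - 𝓕 k ξ := by
      have hb : ∀ u : Eu n → ℂ, Integrable u →
          Integrable fun x => Complex.exp ((-2 * π * inner ℝ x ξ : ℝ) * Complex.I) • u x := by
        intro u hu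
        refine Integrable.bdd_mul (c := 1) hu (by fun_prop) (Eventually.of_forall fun x => ?_)
        rw [Complex.norm_exp_ofReal_mul_I]
      rw [Real.fourier_eq', Real.fourier_eq', Real.fourier_eq',
        ← integral_sub (hb _ (hki.comp_sub_right h)) (hb _ hki)]
      simp only [smul_sub]
    rw [this, hsh]; ring
  have h3 : ‖𝓕 (fun x => k (x - h) - k x) ξ‖ ≤ A * (1 + 4 * Real.log 4) := by
    refine (VectorFourier.norm_fourierIntegral_le_integral_norm _ _ _ _ _).trans ?_
    have hA := hK.nonneg
    have := Real.log_nonneg (show (1 : ℝ) ≤ 4 by norm_num)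
    have hm : AEStronglyMeasurable (fun x => k (x - h) - k x) := ((hki.comp_sub_right h).sub hki).1
    rw [integral_norm_eq_lintegral_enorm hm]
    refine ENNReal.toReal_le_of_le_ofReal (by positivity) ?_
    refine le_trans (le_of_eq ?_) (hK.lintegral_annK_sub_le hs0 ha hab hhs.le)
    refine lintegral_congr fun x => ?_
    rw [hk, ← Complex.ofReal_sub, ← ofReal_norm, ← ofReal_norm, Complex.norm_real]
  rw [h2, norm_neg, norm_mul] at h3
  simp only [RCLike.norm_ofNat] at h3
  linarith [norm_nonneg (𝓕 k ξ)]

open FourierTransform Real in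
theorem norm_fourier_annK_le (hK : CZKernel K M A) {a b : ℝ} (ha : 0 < a) (ξ : Eu n) :
    ‖𝓕 (fun x => (annK K a b x : ℂ)) ξ‖ ≤ A * (π * M + 1 + 4 * Real.log 4) := by
  have hA := hK.nonneg
  have hM := hK.two_le
  have hl := Real.log_nonneg (show (1 : ℝ) ≤ 4 by norm_num)
  rcases eq_or_ne ξ 0 with rfl | hξ
  · rw [Real.fourier_eq]
    simp only [inner_zero_right, neg_zero, AddChar.map_zero_eq_one, one_smul]
    refine (congrArg norm (integral_ofReal (𝕜 := ℂ) (f := annK K a b))).le.trans ?_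
    rw [hK.integral_annK ha]
    simp; positivity
  have hξ' : 0 < ‖ξ‖ := norm_pos_iff.2 hξ
  set ρ := M * (1 / (2 * ‖ξ‖)) with hρ
  have hρ0 : 0 < ρ := by positivity
  have e1 : 2 * π * ‖ξ‖ * (A * ρ) = A * (π * M) := by rw [hρ]; field_simp
  rcases le_or_gt b ρ with hb | hb
  · refine (hK.norm_fourier_annK_inner_le ha hρ0 hb ξ).trans ?_
    rw [e1]
    refine mul_le_mul_of_nonneg_left (by linarith) hA
  rcases le_or_gt ρ a with h | h
  · rcases le_or_gt a b with hab | hab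
    · refine (hK.norm_fourier_annK_outer_le hξ h hab).trans ?_
      refine mul_le_mul_of_nonneg_left (by have : 0 ≤ π * M := (by positivity); linarith) hA
    · have : (fun x => (annK K a b x : ℂ)) = fun _ => 0 := by
        ext x
        have : ¬ (a < ‖x‖ ∧ ‖x‖ ≤ b) := fun h => by linarith [h.1, h.2]
        simp [annK, indicator, mem_ofPred_eq, this]
      rw [this, Real.fourier_eq]
      simp; positivity
  have hsum : (fun x => (annK K a b x : ℂ)) =
      (fun x => (annK K a ρ x : ℂ)) + fun x => (annK K ρ b x : ℂ) := by
    ext x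
    simp only [annK, indicator, mem_ofPred_eq, Pi.add_apply]
    by_cases h1 : ‖x‖ ≤ ρ
    · have h2 : ¬ ρ < ‖x‖ := not_lt.2 h1
      have h3 : ‖x‖ ≤ b := h1.trans hb.le
      simp [h1, h2, h3]
    · have h2 : ρ < ‖x‖ := not_le.1 h1
      have h3 : a < ‖x‖ := h.trans h2
      simp [h1, h2, h3]
  rw [hsum]
  have hadd : 𝓕 ((fun x => (annK K a ρ x : ℂ)) + fun x => (annK K ρ b x : ℂ)) ξ =
      𝓕 (fun x => (annK K a ρ x : ℂ)) ξ + 𝓕 (fun x => (annK K ρ b x : ℂ)) ξ := by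
    have := VectorFourier.fourierIntegral_add (μ := (volume : Measure (Eu n)))
      (L := innerₗ (Eu n)) Real.continuous_fourierChar
      continuous_inner (hK.integrable_annK (b := ρ) ha).ofReal
      (hK.integrable_annK (b := b) hρ0).ofReal (𝕜 := ℝ) (E := ℂ)
    exact (congrFun this ξ)
  rw [hadd]
  refine (norm_add_le _ _).trans ((add_le_add (hK.norm_fourier_annK_inner_le ha hρ0 le_rfl ξ)
    (hK.norm_fourier_annK_outer_le hξ le_rfl hb.le)).trans ?_)
  rw [e1]
  linarith

end CZKernel

end

section

variable {n : ℕ}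

/-- The norm bound on `L²` of truncated Calderón–Zygmund operators. -/
def czL2 (M A : ℝ) : ℝ := A * (Real.pi * M + 1 + 4 * Real.log 4)

theorem czT_eq_integral_indicator (K : Eu n → ℝ) (ε : ℝ) (f : Eu n → ℝ) (x : Eu n) :
    czT K ε f x = ∫ y, {y | ε < ‖x - y‖}.indicator (fun y => K (x - y) * f y) y := by
  rw [czT, integral_indicator (measurableSet_lt_norm_sub ε x)]

namespace CZKernel

variable {K : Eu n → ℝ} {M A : ℝ}

open Convolution in
theorem aestronglyMeasurable_annK_conv (hK : CZKernel K M A) {ε R : ℝ} (hε : 0 < ε)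
    {g : Eu n → ℝ} (hg : Integrable g) :
    AEStronglyMeasurable fun x => ∫ y, annK K ε R (x - y) * g y := by
  have := (hg.integrable_convolution (ContinuousLinearMap.mul ℝ ℝ)
    (hK.integrable_annK (b := R) hε)).1
  refine this.congr (Eventually.of_forall fun x => ?_)
  rw [convolution_def]
  refine integral_congr_ae (Eventually.of_forall fun y => ?_)
  simp [mul_comm]

theorem tendsto_annK_conv (hK : CZKernel K M A) {ε : ℝ}
    {g : Eu n → ℝ} {x : Eu n} (hg : AEStronglyMeasurable g)
    (hx : IntegrableOn (fun y => K (x - y) * g y) {y | ε < ‖x - y‖}) :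
    Tendsto (fun N : ℕ => ∫ y, annK K ε N (x - y) * g y) atTop (nhds (czT K ε g x)) := by
  rw [czT_eq_integral_indicator]
  have hx' := (integrable_indicator_iff (measurableSet_lt_norm_sub ε x)).2 hx
  refine tendsto_integral_of_dominated_convergence _ (fun N => ?_) hx'.norm (fun N => ?_) ?_
  · refine AEStronglyMeasurable.mul ?_ hg
    have : Measurable (annK K ε N) := hK.meas.indicator (measurableSet_annulus _ _)
    exact (this.comp (measurable_const.sub measurable_id)).aestronglyMeasurable
  · refine Eventually.of_forall fun y => ?_
    by_cases h1 : ε < ‖x - y‖ <;> by_cases h2 : ‖x - y‖ ≤ N <;>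
      simp [annK, indicator, mem_ofPred_eq, h1, h2]
    positivity
  · refine Eventually.of_forall fun y => ?_
    refine tendsto_const_nhds.congr' ?_
    obtain ⟨N, hN⟩ := exists_nat_ge ‖x - y‖
    filter_upwards [eventually_ge_atTop N] with m hm
    have h2 : ‖x - y‖ ≤ m := hN.trans (by exact_mod_cast hm)
    by_cases h1 : ε < ‖x - y‖ <;> simp [annK, indicator, mem_ofPred_eq, h1, h2]

theorem aestronglyMeasurable_czT (hK : CZKernel K M A) {ε : ℝ} (hε : 0 < ε)
    {g : Eu n → ℝ} (hg : Integrable g) : AEStronglyMeasurable (czT K ε g) := by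
  refine aestronglyMeasurable_of_tendsto_ae atTop
    (fun N : ℕ => hK.aestronglyMeasurable_annK_conv (R := N) hε hg) ?_
  filter_upwards [hK.ae_integrableOn_truncation hg] with x hx
  exact hK.tendsto_annK_conv hg.1 (hx ε hε)

theorem lintegral_sq_czT_le (hK : CZKernel K M A) {ε : ℝ} (hε : 0 < ε)
    {g : Eu n → ℝ} (hg : Integrable g) {B : ℝ} (hB : ∀ x, |g x| ≤ B) :
    ∫⁻ x, ‖czT K ε g x‖ₑ ^ 2 ≤ ENNReal.ofReal (czL2 M A) ^ 2 * ∫⁻ x, ‖g x‖ₑ ^ 2 := by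
  set F : ℕ → Eu n → ENNReal := fun N x => ‖∫ y, annK K ε N (x - y) * g y‖ₑ ^ 2
  have hF : ∀ N, AEMeasurable (F N) := fun N =>
    (hK.aestronglyMeasurable_annK_conv (R := N) hε hg).enorm.pow_const 2
  calc _ = ∫⁻ x, liminf (fun N => F N x) atTop := by
        refine lintegral_congr_ae ?_
        filter_upwards [hK.ae_integrableOn_truncation hg] with x hx
        have h1 := hK.tendsto_annK_conv hg.1 (hx ε hε)
        have h2 : Tendsto (fun N => F N x) atTop (nhds (‖czT K ε g x‖ₑ ^ 2)) :=
          (ENNReal.continuous_pow 2).tendsto _ |>.comp ((continuous_enorm.tendsto _).comp h1)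
        exact h2.liminf_eq.symm
    _ ≤ liminf (fun N => ∫⁻ x, F N x) atTop := lintegral_liminf_le' hF
    _ ≤ _ := by
        refine (liminf_le_liminf (Eventually.of_forall fun N : ℕ =>
          lintegral_sq_conv_le (hK.integrable_annK (b := (N : ℝ)) hε) hg hB
            (hK.norm_fourier_annK_le hε))).trans ?_
        simp [czL2]

end CZKernel

end

section

variable {n : ℕ}

/-- A Calderón–Zygmund decomposition of `f` at height `α` with good part `g`: the bad part `f - g`
lives on the pairwise disjoint cells `Q c ⊆ closedBall c (ρ c)`, `c ∈ u`. -/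
structure CZDecomposition (f : Eu n → ℝ) (α : ℝ) (u : Set (Eu n)) (ρ : Eu n → ℝ)
    (Q : Eu n → Set (Eu n)) (g : Eu n → ℝ) : Prop where
  countable : u.Countable
  pos : ∀ c ∈ u, 0 < ρ c
  measurableSet : ∀ c ∈ u, MeasurableSet (Q c)
  subset : ∀ c ∈ u, Q c ⊆ Metric.closedBall c (ρ c)
  disjoint : u.PairwiseDisjoint Q
  integrable : Integrable g
  bound : ∀ x, |g x| ≤ 5 ^ n * α
  lintegral_le : ∫⁻ x, ‖g x‖ₑ ≤ ∫⁻ x, ‖f x‖ₑ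
  mean_zero : ∀ c ∈ u, ∫ x in Q c, (f x - g x) = 0
  bad_le : ∀ c ∈ u, ∫⁻ x in Q c, ‖f x - g x‖ₑ ≤ ENNReal.ofReal (2 * 5 ^ n * α) * volume (Q c)
  ae_eq : ∀ᵐ x, x ∉ ⋃ c ∈ u, Q c → f x = g x
  tsum_le : ENNReal.ofReal α * ∑' c : u, volume (Metric.closedBall (c : Eu n) (ρ c)) ≤
    5 ^ n * ∫⁻ x, ‖f x‖ₑ

theorem exists_czDecomposition (hn : 0 < n) {f : Eu n → ℝ} (hf : Integrable f) {α : ℝ}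
    (hα : 0 < α) : ∃ u ρ Q g, CZDecomposition f α u ρ Q g := by
  classical
  obtain ⟨u, r, Q, hu, hQ, hd, hae, hs⟩ := exists_calderonZygmund_cells hn hf hα
  have : Countable u := hu
  set a : Eu n → ℝ := fun c => ⨍ x in Q c, f x with ha
  set U : Set (Eu n) := ⋃ c ∈ u, Q c with hU
  have hUm : MeasurableSet U := MeasurableSet.biUnion hu fun c hc => (hQ c hc).2.1
  set g : Eu n → ℝ := fun y => if h : ∃ c ∈ u, y ∈ Q c then a h.choose else
    if |f y| ≤ α then f y else 0 with hg
  have hgQ : ∀ c ∈ u, ∀ y ∈ Q c, g y = a c := by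
    intro c hc y hy
    have h : ∃ c ∈ u, y ∈ Q c := ⟨c, hc, hy⟩
    have h1 : g y = a h.choose := by simp only [hg]; rw [dif_pos h]
    rw [h1]
    congr 1
    by_contra hne
    exact disjoint_left.1 (hd h.choose_spec.1 hc hne) h.choose_spec.2 hy
  have hgU : ∀ y, y ∉ U → g y = if |f y| ≤ α then f y else 0 := by
    intro y hy
    have h : ¬ ∃ c ∈ u, y ∈ Q c := by simpa [hU] using hy
    simp only [hg]; rw [dif_neg h]
  have hfg : ∀ᵐ x, x ∉ U → f x = g x := by
    filter_upwards [hae] with x hx hxU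
    rw [hgU x hxU, if_pos (hx hxU)]
  have hBfin : ∀ c, volume (Metric.closedBall c (5 * r c)) ≠ ⊤ := fun c =>
    measure_closedBall_lt_top.ne
  have hQfin : ∀ c ∈ u, volume (Q c) ≠ ⊤ := fun c hc =>
    ne_top_of_le_ne_top (hBfin c) (measure_mono (hQ c hc).2.2.1)
  have hQpos : ∀ c ∈ u, volume (Q c) ≠ 0 := by
    intro c hc h0
    have h1 := (hQ c hc).2.2.2.1
    rw [h0, mul_zero] at h1
    have : 0 < volume (Metric.closedBall c (5 * r c)) :=
      Metric.measure_closedBall_pos _ _ (by linarith [(hQ c hc).1])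
    exact absurd h1 (not_le.2 this)
  have havg : ∀ c ∈ u, ‖a c‖ₑ * volume (Q c) ≤ ∫⁻ x in Q c, ‖f x‖ₑ := by
    intro c hc
    have h1 : ENNReal.ofReal (volume.real (Q c)) = volume (Q c) := ENNReal.ofReal_toReal (hQfin c hc)
    have h2 := measure_smul_setAverage f (hQfin c hc)
    calc _ = ‖volume.real (Q c) • a c‖ₑ := by
          rw [smul_eq_mul, enorm_mul, mul_comm, Real.enorm_of_nonneg measureReal_nonneg, h1]
      _ = ‖∫ x in Q c, f x‖ₑ := by rw [h2]
      _ ≤ _ := enorm_integral_le_lintegral_enorm _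
  have hfQ : ∀ c ∈ u, ∫⁻ x in Q c, ‖f x‖ₑ ≤ ENNReal.ofReal (5 ^ n * α) * volume (Q c) := by
    intro c hc
    calc _ ≤ ∫⁻ x in Metric.closedBall c (5 * r c), ‖f x‖ₑ := lintegral_mono_set (hQ c hc).2.2.1
      _ ≤ _ := (hQ c hc).2.2.2.2
      _ ≤ ENNReal.ofReal α * (5 ^ n * volume (Q c)) := by gcongr; exact (hQ c hc).2.2.2.1
      _ = _ := by
        rw [ENNReal.ofReal_mul (by positivity), ENNReal.ofReal_pow (by norm_num)]
        simp; ring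
  have habd : ∀ c ∈ u, ‖a c‖ₑ ≤ ENNReal.ofReal (5 ^ n * α) := by
    intro c hc
    exact (ENNReal.mul_le_mul_iff_left (hQpos c hc) (hQfin c hc)).1 ((havg c hc).trans (hfQ c hc))
  have hone : (1 : ℝ) ≤ 5 ^ n := one_le_pow₀ (by norm_num)
  have hgm : AEStronglyMeasurable g := by
    have h1 : AEStronglyMeasurable g (volume.restrict U) := by
      rw [hU, biUnion_eq_iUnion, aestronglyMeasurable_iUnion_iff]
      intro c
      refine (aestronglyMeasurable_const (b := a c)).congr ?_
      filter_upwards [ae_restrict_mem (hQ c c.2).2.1] with y hy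
      exact (hgQ c c.2 y hy).symm
    have h2 : AEStronglyMeasurable g (volume.restrict Uᶜ) := by
      refine hf.1.restrict.congr ?_
      filter_upwards [ae_restrict_of_ae hfg, ae_restrict_mem hUm.compl] with y hy hyU
      exact hy hyU
    have := aestronglyMeasurable_union_iff.2 ⟨h1, h2⟩
    rwa [union_compl_self, Measure.restrict_univ] at this
  have hlin : ∀ F : Eu n → ENNReal, ∫⁻ x in U, F x = ∑' c : u, ∫⁻ x in Q c, F x := by
    intro F
    rw [hU, biUnion_eq_iUnion]
    exact lintegral_iUnion (α := Eu n) (β := u) (fun c => (hQ c c.2).2.1)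
      (fun a b hab => hd a.2 b.2 (fun h => hab (Subtype.ext h))) F
  have hgf : ∫⁻ x, ‖g x‖ₑ ≤ ∫⁻ x, ‖f x‖ₑ := by
    rw [← lintegral_add_compl _ hUm, ← lintegral_add_compl (fun x => ‖f x‖ₑ) hUm, hlin, hlin]
    refine add_le_add (ENNReal.tsum_le_tsum fun c => ?_) (le_of_eq ?_)
    · rw [setLIntegral_congr_fun (g := fun _ => ‖a c‖ₑ) (hQ c c.2).2.1
        (fun y hy => by simp only [hgQ c c.2 y hy]), setLIntegral_const]
      exact havg c c.2
    · refine lintegral_congr_ae ?_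
      filter_upwards [ae_restrict_of_ae hfg, ae_restrict_mem hUm.compl] with y hy hyU
      rw [hy hyU]
  have hgi : Integrable g := ⟨hgm, hgf.trans_lt hf.2⟩
  refine ⟨u, fun c => 5 * r c, Q, g, hu, fun c hc => by linarith [(hQ c hc).1],
    fun c hc => (hQ c hc).2.1, fun c hc => (hQ c hc).2.2.1, hd, hgi, fun x => ?_, hgf,
    fun c hc => ?_, fun c hc => ?_, hfg, hs⟩
  · by_cases hx : x ∈ U
    · obtain ⟨c, hc, hxc⟩ := mem_iUnion₂.1 hx
      rw [hgQ c hc x hxc]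
      have := habd c hc
      rw [← ofReal_norm, ENNReal.ofReal_le_ofReal_iff (by positivity)] at this
      exact this
    · rw [hgU x hx]
      split_ifs with h
      · nlinarith
      · simp; positivity
  · rw [integral_sub hf.integrableOn hgi.integrableOn,
      setIntegral_congr_fun (g := fun _ => a c) (hQ c hc).2.1 (fun y hy => hgQ c hc y hy),
      setIntegral_const, measure_smul_setAverage f (hQfin c hc), sub_self]
  · calc _ ≤ ∫⁻ x in Q c, (‖f x‖ₑ + ‖g x‖ₑ) := lintegral_mono fun x => enorm_sub_le
      _ = (∫⁻ x in Q c, ‖f x‖ₑ) + ∫⁻ x in Q c, ‖g x‖ₑ :=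
          lintegral_add_left' hf.1.enorm.restrict _
      _ ≤ ENNReal.ofReal (5 ^ n * α) * volume (Q c) + ENNReal.ofReal (5 ^ n * α) * volume (Q c) := by
          refine add_le_add (hfQ c hc) ?_
          rw [setLIntegral_congr_fun (g := fun _ => ‖a c‖ₑ) (hQ c hc).2.1
            (fun y hy => by simp only [hgQ c hc y hy]), setLIntegral_const]
          exact mul_le_mul_left (habd c hc) _
      _ = _ := by
          rw [← add_mul, ← ENNReal.ofReal_add (by positivity) (by positivity)]
          congr 2; ring

end

section

variable {n : ℕ}

/-- The contribution at `x` of a cell `Q` centred at `c` to the error made by freezing the kernel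
at the centre of the cell. -/
def cellError (K : Eu n → ℝ) (b : Eu n → ℝ) (β : ℝ) (Q : Set (Eu n)) (c x : Eu n) : ENNReal :=
  ∫⁻ y in Q, ‖K (x - y) - K (x - c)‖ₑ * (‖b y‖ₑ + ENNReal.ofReal β)

namespace CZKernel

variable {K : Eu n → ℝ} {M A : ℝ}

theorem enorm_cell_integral_le (hK : CZKernel K M A) {b : Eu n → ℝ} (hb : Integrable b) {β : ℝ}
    {Q : Set (Eu n)} {c x : Eu n} {ρ ε : ℝ} (hQm : MeasurableSet Q)
    (hQ : Q ⊆ Metric.closedBall c ρ) (h0 : ∫ y in Q, b y = 0)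
    (hβ : ∫⁻ y in Q, ‖b y‖ₑ ≤ ENNReal.ofReal β * volume Q)
    (hx : IntegrableOn (fun y => K (x - y) * b y) {y | ε < ‖x - y‖})
    (hxc : (M + 3) * ρ < ‖x - c‖) :
    ‖∫ y in {y | ε < ‖x - y‖} ∩ Q, K (x - y) * b y‖ₑ ≤ cellError K b β Q c x +
      ENNReal.ofReal β * ∫⁻ y in Q, {y | ε / 2 ≤ ‖x - y‖ ∧ ‖x - y‖ ≤ 2 * ε}.indicator
        (fun y => ‖K (x - y)‖ₑ) y := by
  have hM := hK.two_le
  have hKm := hK.meas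
  have hKx : Measurable fun y => K (x - y) := hKm.comp (measurable_const.sub measurable_id)
  have hV := measurableSet_lt_norm_sub ε x
  by_cases hsub : Q ⊆ {y | ε < ‖x - y‖}
  · rw [inter_eq_self_of_subset_right hsub]
    have e1 : ∫ y in Q, K (x - y) * b y = ∫ y in Q, (K (x - y) - K (x - c)) * b y := by
      have : ∫ y in Q, K (x - c) * b y = 0 := by rw [integral_const_mul, h0, mul_zero]
      rw [← sub_zero (∫ y in Q, K (x - y) * b y), ← this,
        ← integral_sub (hx.mono_set hsub) (hb.integrableOn.const_mul _)]
      simp only [sub_mul]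
    rw [e1]
    refine (enorm_integral_le_lintegral_enorm _).trans (le_trans ?_ le_self_add)
    refine lintegral_mono fun y => ?_
    rw [enorm_mul]
    gcongr
    exact le_self_add
  by_cases hdis : {y | ε < ‖x - y‖} ∩ Q = ∅
  · rw [hdis]; simp
  obtain ⟨y1, hy1, hy1'⟩ := not_subset.1 hsub
  have hy1' : ‖x - y1‖ ≤ ε := not_lt.1 hy1'
  obtain ⟨y2, hy2', hy2⟩ := nonempty_iff_ne_empty.2 hdis
  have hy2' : ε < ‖x - y2‖ := hy2'
  have hc : ∀ y ∈ Q, ‖y - c‖ ≤ ρ := fun y hy => by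
    have := hQ hy; rwa [mem_closedBall_iff_norm] at this
  have hρ : 0 ≤ ρ := (norm_nonneg _).trans (hc y1 hy1)
  have hdist : ∀ y ∈ Q, ∀ y' ∈ Q, ‖x - y‖ ≤ ‖x - y'‖ + 2 * ρ := by
    intro y hy y' hy'
    calc ‖x - y‖ = ‖(x - y') + ((y' - c) - (y - c))‖ := by congr 1; abel
      _ ≤ ‖x - y'‖ + (‖y' - c‖ + ‖y - c‖) := (norm_add_le _ _).trans (by gcongr; exact norm_sub_le _ _)
      _ ≤ _ := by linarith [hc y hy, hc y' hy']
  have h4 : 4 * ρ ≤ ε := by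
    have : ‖x - c‖ ≤ ‖x - y1‖ + ‖y1 - c‖ := by
      calc ‖x - c‖ = ‖(x - y1) + (y1 - c)‖ := by congr 1; abel
        _ ≤ _ := norm_add_le _ _
    nlinarith [hc y1 hy1]
  have hann : ∀ y ∈ Q, y ∈ {y | ε / 2 ≤ ‖x - y‖ ∧ ‖x - y‖ ≤ 2 * ε} := fun y hy =>
    ⟨by linarith [hdist y2 hy2 y hy], by linarith [hdist y hy y1 hy1]⟩
  rw [setLIntegral_congr_fun (g := fun y => ‖K (x - y)‖ₑ) hQm
    (fun y hy => by simp only [indicator_of_mem (hann y hy)])]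
  have hbm : AEMeasurable (fun y => ‖b y‖ₑ) (volume.restrict Q) := hb.1.enorm.restrict
  calc _ ≤ ∫⁻ y in {y | ε < ‖x - y‖} ∩ Q, ‖K (x - y) * b y‖ₑ :=
        enorm_integral_le_lintegral_enorm _
    _ ≤ ∫⁻ y in Q, ‖K (x - y) * b y‖ₑ := lintegral_mono_set inter_subset_right
    _ ≤ ∫⁻ y in Q, (‖K (x - y) - K (x - c)‖ₑ * ‖b y‖ₑ + ‖K (x - c)‖ₑ * ‖b y‖ₑ) := by
        refine lintegral_mono fun y => ?_
        rw [enorm_mul, ← add_mul]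
        gcongr
        calc ‖K (x - y)‖ₑ = ‖(K (x - y) - K (x - c)) + K (x - c)‖ₑ := by congr 1; ring
          _ ≤ _ := enorm_add_le _ _
    _ = (∫⁻ y in Q, ‖K (x - y) - K (x - c)‖ₑ * ‖b y‖ₑ) + ‖K (x - c)‖ₑ * ∫⁻ y in Q, ‖b y‖ₑ := by
        rw [lintegral_add_right' _ (hbm.const_mul _), lintegral_const_mul'' _ hbm]
    _ ≤ (∫⁻ y in Q, ‖K (x - y) - K (x - c)‖ₑ * ‖b y‖ₑ) +
        ENNReal.ofReal β * ∫⁻ _ in Q, ‖K (x - c)‖ₑ := by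
        refine add_le_add le_rfl ?_
        rw [setLIntegral_const, mul_left_comm]
        gcongr
    _ ≤ (∫⁻ y in Q, ‖K (x - y) - K (x - c)‖ₑ * ‖b y‖ₑ) +
        ENNReal.ofReal β * ∫⁻ y in Q, (‖K (x - y) - K (x - c)‖ₑ + ‖K (x - y)‖ₑ) := by
        gcongr with y
        calc ‖K (x - c)‖ₑ = ‖K (x - y) - (K (x - y) - K (x - c))‖ₑ := by congr 1; ring
          _ ≤ _ := enorm_sub_le
          _ = _ := add_comm _ _
    _ = _ := by
        have m1 : Measurable fun y => ‖K (x - y) - K (x - c)‖ₑ := (hKx.sub_const _).enorm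
        rw [lintegral_add_left m1, mul_add, ← add_assoc, cellError]
        congr 1
        have m2 : AEMeasurable (fun y => ‖K (x - y) - K (x - c)‖ₑ * ‖b y‖ₑ) (volume.restrict Q) :=
          m1.aemeasurable.mul hbm
        rw [← lintegral_const_mul _ m1, ← lintegral_add_left' m2]
        refine lintegral_congr fun y => ?_
        ring

theorem lintegral_cellError_le (hK : CZKernel K M A) {b : Eu n → ℝ} (hb : Integrable b) {β : ℝ}
    {Q : Set (Eu n)} {c : Eu n} {ρ : ℝ} (hρ : 0 < ρ) (hQm : MeasurableSet Q)
    (hQ : Q ⊆ Metric.closedBall c ρ)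
    (hβ : ∫⁻ y in Q, ‖b y‖ₑ ≤ ENNReal.ofReal β * volume Q) :
    ∫⁻ x in (Metric.closedBall c ((M + 3) * ρ))ᶜ, cellError K b β Q c x ≤
      ENNReal.ofReal (2 * A * β) * volume Q := by
  have hKm := hK.meas
  have hA := hK.nonneg
  have hm : AEMeasurable (fun p : Eu n × Eu n =>
      ‖K (p.1 - p.2) - K (p.1 - c)‖ₑ * (‖b p.2‖ₑ + ENNReal.ofReal β))
      ((volume.restrict (Metric.closedBall c ((M + 3) * ρ))ᶜ).prod (volume.restrict Q)) := by
    have hm1 : Measurable fun p : Eu n × Eu n => ‖K (p.1 - p.2) - K (p.1 - c)‖ₑ :=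
      ((hKm.comp (measurable_fst.sub measurable_snd)).sub
        (hKm.comp (measurable_fst.sub_const c))).enorm
    have hm2 : AEMeasurable (fun y => ‖b y‖ₑ + ENNReal.ofReal β) (volume.restrict Q) :=
      hb.1.restrict.aemeasurable.enorm.add_const _
    exact hm1.aemeasurable.mul
      (hm2.comp_quasiMeasurePreserving Measure.quasiMeasurePreserving_snd)
  simp only [cellError]
  rw [lintegral_lintegral_swap hm]
  calc _ ≤ ∫⁻ y in Q, ENNReal.ofReal A * (‖b y‖ₑ + ENNReal.ofReal β) := by
        refine setLIntegral_mono' hQm fun y hy => ?_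
        have hmx : Measurable fun x => ‖K (x - y) - K (x - c)‖ₑ :=
          ((hKm.comp (measurable_id.sub_const y)).sub (hKm.comp (measurable_id.sub_const c))).enorm
        rw [lintegral_mul_const _ hmx]
        gcongr
        have hyc : ‖y - c‖ ≤ ρ := by
          have := hQ hy; rwa [mem_closedBall_iff_norm] at this
        refine le_trans ?_ (hK.hormander (y - c) ρ hρ hyc)
        rw [← lintegral_indicator measurableSet_closedBall.compl, ← lintegral_indicator
          (measurableSet_le measurable_const measurable_norm),
          ← lintegral_sub_right_eq_self (μ := volume) (g := c)
            (f := {x : Eu n | M * ρ ≤ ‖x‖}.indicator (fun x => ‖K (x - (y - c)) - K x‖ₑ))]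
        refine lintegral_mono fun x => ?_
        by_cases hx : x ∈ (Metric.closedBall c ((M + 3) * ρ))ᶜ
        · have h2 : x - c ∈ {x : Eu n | M * ρ ≤ ‖x‖} := by
            rw [mem_compl_iff, mem_closedBall_iff_norm, not_le] at hx
            show M * ρ ≤ ‖x - c‖
            linarith
          rw [indicator_of_mem hx, indicator_of_mem h2]
          simp
        · rw [indicator_of_notMem hx]
          exact zero_le
    _ = ENNReal.ofReal A * ((∫⁻ y in Q, ‖b y‖ₑ) + ENNReal.ofReal β * volume Q) := by
        rw [lintegral_const_mul' _ _ ENNReal.ofReal_ne_top, lintegral_add_right _ measurable_const,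
          setLIntegral_const]
    _ ≤ ENNReal.ofReal A * (ENNReal.ofReal β * volume Q + ENNReal.ofReal β * volume Q) := by gcongr
    _ = _ := by
        rw [mul_assoc 2, ENNReal.ofReal_mul (by norm_num), ENNReal.ofReal_mul hA]
        simp; ring

theorem enorm_czT_bad_le (hK : CZKernel K M A) {b : Eu n → ℝ} (hb : Integrable b) {β : ℝ}
    {u : Set (Eu n)} {ρ : Eu n → ℝ} {Q : Eu n → Set (Eu n)} (hu : u.Countable)
    (hQm : ∀ c ∈ u, MeasurableSet (Q c))
    (hQ : ∀ c ∈ u, Q c ⊆ Metric.closedBall c (ρ c)) (hd : u.PairwiseDisjoint Q)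
    (h0 : ∀ c ∈ u, ∫ y in Q c, b y = 0)
    (hβ0 : 0 ≤ β)
    (hβ : ∀ c ∈ u, ∫⁻ y in Q c, ‖b y‖ₑ ≤ ENNReal.ofReal β * volume (Q c))
    (hb0 : ∀ᵐ x, x ∉ ⋃ c ∈ u, Q c → b x = 0) {x : Eu n} {ε : ℝ} (hε : 0 < ε)
    (hx : IntegrableOn (fun y => K (x - y) * b y) {y | ε < ‖x - y‖})
    (hxc : ∀ c ∈ u, (M + 3) * ρ c < ‖x - c‖) :
    ‖czT K ε b x‖ₑ ≤ (∑' c : u, cellError K b β (Q c) c x) +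
      ENNReal.ofReal (β * (A * Real.log 4)) := by
  have : Countable u := hu
  have hV := measurableSet_lt_norm_sub ε x
  have hKx : Measurable fun y => K (x - y) := hK.meas.comp (measurable_const.sub measurable_id)
  set V : Set (Eu n) := {y | ε < ‖x - y‖}
  set S : Set (Eu n) := {y | ε / 2 ≤ ‖x - y‖ ∧ ‖x - y‖ ≤ 2 * ε}
  have hS : MeasurableSet S := (measurableSet_le measurable_const
    (measurable_const.sub measurable_id).norm).inter (measurableSet_le
    (measurable_const.sub measurable_id).norm measurable_const)
  have hdis : Pairwise (Function.onFun Disjoint fun c : u => Q c) :=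
    fun a b hab => hd a.2 b.2 (fun h => hab (Subtype.ext h))
  have hdis' : Pairwise (Function.onFun Disjoint fun c : u => V ∩ Q c) :=
    fun a b hab => (hdis hab).mono inter_subset_right inter_subset_right
  have e1 : czT K ε b x = ∑' c : u, ∫ y in V ∩ Q c, K (x - y) * b y := by
    rw [← integral_iUnion (fun c : u => hV.inter (hQm c c.2)) hdis'
      (hx.mono_set (iUnion_subset fun c => inter_subset_left)), ← inter_iUnion, czT]
    refine setIntegral_eq_of_subset_of_ae_sdiff_eq_zero (f := fun y => K (x - y) * b y)
      hV.nullMeasurableSet inter_subset_left ?_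
    filter_upwards [hb0] with y hy hyV
    have : y ∉ ⋃ c ∈ u, Q c := by
      rw [biUnion_eq_iUnion]
      exact fun h => hyV.2 ⟨hyV.1, h⟩
    rw [hy this, mul_zero]
  rw [e1]
  refine (enorm_tsum_le_tsum_enorm).trans ?_
  calc _ ≤ ∑' c : u, (cellError K b β (Q c) c x + ENNReal.ofReal β *
          ∫⁻ y in Q c, S.indicator (fun y => ‖K (x - y)‖ₑ) y) :=
        ENNReal.tsum_le_tsum fun c => hK.enorm_cell_integral_le hb (hQm c c.2) (hQ c c.2)
          (h0 c c.2) (hβ c c.2) hx (hxc c c.2)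
    _ = (∑' c : u, cellError K b β (Q c) c x) + ENNReal.ofReal β *
          ∫⁻ y in ⋃ c : u, Q c, S.indicator (fun y => ‖K (x - y)‖ₑ) y := by
        rw [ENNReal.tsum_add, ENNReal.tsum_mul_left, lintegral_iUnion (fun c : u => hQm c c.2) hdis]
    _ ≤ (∑' c : u, cellError K b β (Q c) c x) + ENNReal.ofReal β * ENNReal.ofReal (A * Real.log 4) := by
        gcongr
        refine (setLIntegral_le_lintegral _ _).trans ?_
        have h1 := hK.size (ε / 2) (2 * ε) (by positivity) (by linarith)
        rw [show 2 * ε / (ε / 2) = 4 by field_simp; norm_num] at h1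
        refine le_trans (le_of_eq ?_) h1
        have hS' : MeasurableSet {x : Eu n | ε / 2 ≤ ‖x‖ ∧ ‖x‖ ≤ 2 * ε} :=
          (measurableSet_le measurable_const measurable_norm).inter
            (measurableSet_le measurable_norm measurable_const)
        rw [← lintegral_indicator hS', ← lintegral_sub_left_eq_self
          ({x : Eu n | ε / 2 ≤ ‖x‖ ∧ ‖x‖ ≤ 2 * ε}.indicator fun x => ‖K x‖ₑ) x]
        refine lintegral_congr fun y => ?_
        by_cases hy : y ∈ S
        · have hy' : x - y ∈ {x : Eu n | ε / 2 ≤ ‖x‖ ∧ ‖x‖ ≤ 2 * ε} := hy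
          rw [indicator_of_mem hy, indicator_of_mem hy']
        · have hy' : x - y ∉ {x : Eu n | ε / 2 ≤ ‖x‖ ∧ ‖x‖ ≤ 2 * ε} := hy
          rw [indicator_of_notMem hy, indicator_of_notMem hy']
    _ = _ := by rw [← ENNReal.ofReal_mul hβ0]

end CZKernel

end

section

variable {n : ℕ}

theorem czL2_nonneg {K : Eu n → ℝ} {M A : ℝ} (hK : CZKernel K M A) : 0 ≤ czL2 M A := by
  have := hK.nonneg
  have := hK.two_le
  have := Real.log_nonneg (show (1 : ℝ) ≤ 4 by norm_num)
  have := Real.pi_pos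
  unfold czL2
  positivity

namespace CZKernel

variable {K : Eu n → ℝ} {M A : ℝ}

theorem abs_czT_le_near (hK : CZKernel K M A) {g : Eu n → ℝ} {B : ℝ}
    (hB0 : 0 ≤ B) (hB : ∀ x, |g x| ≤ B) {δ ε : ℝ} (hδ : 0 < δ) (hδε : 2 * δ ≤ ε) {x x' : Eu n}
    (hx : IntegrableOn (fun y => K (x - y) * g y) {y | ε < ‖x - y‖})
    (hx' : IntegrableOn (fun y => K (x' - y) * g y) {y | δ < ‖x' - y‖})
    (hxx : ‖x - x'‖ ≤ ε / M) :
    |czT K ε g x| ≤ |czT K δ g x'| +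
      |czT K δ ((Metric.closedBall x ε).indicator g) x'| + A * B := by
  have hM := hK.two_le
  have hA := hK.nonneg
  have hε : 0 < ε := by linarith
  set V : Set (Eu n) := {y | ε < ‖x - y‖} with hV
  set V' : Set (Eu n) := {y | δ < ‖x' - y‖} with hV'
  have hVm : MeasurableSet V := measurableSet_lt_norm_sub ε x
  have hVm' : MeasurableSet V' := measurableSet_lt_norm_sub δ x'
  have hcomp : V = (Metric.closedBall x ε)ᶜ := by
    ext y
    simp [hV, dist_eq_norm, norm_sub_rev y x, mem_ofPred_eq]
  have hsub : V ⊆ V' := by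
    intro y hy
    have hy : ε < ‖x - y‖ := hy
    show δ < ‖x' - y‖
    have h1 : ‖x - y‖ ≤ ‖x - x'‖ + ‖x' - y‖ := by
      calc ‖x - y‖ = ‖(x - x') + (x' - y)‖ := by congr 1; abel
        _ ≤ _ := norm_add_le _ _
    have h2 : ε / M ≤ ε / 2 := by gcongr
    linarith
  have e1 : czT K δ g x' = (∫ y in V, K (x' - y) * g y) +
      czT K δ ((Metric.closedBall x ε).indicator g) x' := by
    have e2 : czT K δ ((Metric.closedBall x ε).indicator g) x' =
        ∫ y in V' \ V, K (x' - y) * g y := by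
      rw [czT, hcomp, sdiff_compl, ← setIntegral_indicator measurableSet_closedBall]
      refine integral_congr_ae (Eventually.of_forall fun y => ?_)
      by_cases hy : y ∈ Metric.closedBall x ε <;> simp [indicator, hy]
    rw [e2, czT, setIntegral_sdiff hVm hx' hsub, add_sub_cancel]
  have e3 : czT K ε g x = (∫ y in V, (K (x - y) - K (x' - y)) * g y) +
      ∫ y in V, K (x' - y) * g y := by
    have h1 : IntegrableOn (fun y => K (x' - y) * g y) V := hx'.mono_set hsub
    rw [czT, ← sub_eq_iff_eq_add, ← integral_sub hx h1]
    simp only [sub_mul]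
  have e4 : |∫ y in V, (K (x - y) - K (x' - y)) * g y| ≤ A * B := by
    rw [← Real.norm_eq_abs]
    refine (norm_integral_le_lintegral_norm _).trans ?_
    refine ENNReal.toReal_le_of_le_ofReal (b := A * B) (by positivity) ?_
    calc _ ≤ ∫⁻ y in V, ENNReal.ofReal B * ‖K (x - y) - K (x' - y)‖ₑ := by
          refine lintegral_mono fun y => ?_
          rw [← ofReal_norm, ← ENNReal.ofReal_mul hB0, norm_mul, mul_comm]
          exact ENNReal.ofReal_le_ofReal (mul_le_mul_of_nonneg_right (hB y) (norm_nonneg _))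
      _ ≤ ENNReal.ofReal B * ENNReal.ofReal A := by
          rw [lintegral_const_mul' _ _ ENNReal.ofReal_ne_top]
          gcongr
          refine le_trans ?_ (hK.hormander (x - x') (ε / M) (by positivity) hxx)
          rw [← lintegral_indicator hVm, ← lintegral_indicator
            (measurableSet_le measurable_const measurable_norm),
            ← lintegral_sub_left_eq_self
              ({x : Eu n | M * (ε / M) ≤ ‖x‖}.indicator fun z => ‖K (z - (x - x')) - K z‖ₑ) x]
          refine lintegral_mono fun y => ?_
          by_cases hy : y ∈ V
          · have hy' : x - y ∈ {x : Eu n | M * (ε / M) ≤ ‖x‖} := by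
              show M * (ε / M) ≤ ‖x - y‖
              rw [mul_div_cancel₀ _ (by linarith)]
              exact le_of_lt hy
            rw [indicator_of_mem hy, indicator_of_mem hy', enorm_sub_rev]
            rw [show x - y - (x - x') = x' - y by abel]
          · rw [indicator_of_notMem hy]; exact zero_le
      _ = _ := by rw [← ENNReal.ofReal_mul hB0, mul_comm]
  have e5 : czT K ε g x = (∫ y in V, (K (x - y) - K (x' - y)) * g y) + (czT K δ g x' -
      czT K δ ((Metric.closedBall x ε).indicator g) x') := by
    rw [e3]; linarith
  rw [e5]
  refine (abs_add_le _ _).trans ?_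
  have := abs_sub (czT K δ g x') (czT K δ ((Metric.closedBall x ε).indicator g) x')
  linarith

theorem sq_mul_volume_closedBall_le (hK : CZKernel K M A) {g : Eu n → ℝ}
    (hg : Integrable g) {B : ℝ} (hB0 : 0 < B) (hB : ∀ x, |g x| ≤ B) {δ ε : ℝ} (hδ : 0 < δ)
    (hδε : 2 * δ ≤ ε) {x : Eu n}
    (hx : IntegrableOn (fun y => K (x - y) * g y) {y | ε < ‖x - y‖})
    (hT : B * (A + 2 * (czL2 M A * M ^ n + 1)) < |czT K ε g x|) :
    ENNReal.ofReal (B ^ 2) * volume (Metric.closedBall x (ε / M)) ≤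
      ∫⁻ y in Metric.closedBall x (ε / M), ‖czT K δ g y‖ₑ ^ 2 := by
  have hM := hK.two_le
  have hA := hK.nonneg
  have hL := czL2_nonneg hK
  have hε : 0 < ε := by linarith
  set L := czL2 M A
  set P := Metric.closedBall x (ε / M) with hP
  set g1 := (Metric.closedBall x ε).indicator g with hg1
  have hg1i : Integrable g1 := hg.indicator measurableSet_closedBall
  have hg1B : ∀ y, |g1 y| ≤ B := by
    intro y
    by_cases hy : y ∈ Metric.closedBall x ε
    · rw [hg1, indicator_of_mem hy]; exact hB y
    · rw [hg1, indicator_of_notMem hy, abs_zero]; exact hB0.le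
  have hvol : volume (Metric.closedBall x ε) = ENNReal.ofReal (M ^ n) * volume P := by
    have h1 : ε = M * (ε / M) := by field_simp
    rw [hP, Measure.addHaar_closedBall volume x hε.le,
      Measure.addHaar_closedBall volume x (r := ε / M) (by positivity), ← mul_assoc,
      ← ENNReal.ofReal_mul (by positivity)]
    congr 2
    conv_lhs => rw [h1, mul_pow]
    simp
  have hPfin : volume P ≠ ⊤ := measure_closedBall_lt_top.ne
  have hb : ∫⁻ y in P, ‖czT K δ g1 y‖ₑ ^ 2 ≤ ENNReal.ofReal (L ^ 2 * B ^ 2 * M ^ n) * volume P := by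
    calc _ ≤ ∫⁻ y, ‖czT K δ g1 y‖ₑ ^ 2 := setLIntegral_le_lintegral _ _
      _ ≤ ENNReal.ofReal L ^ 2 * ∫⁻ y, ‖g1 y‖ₑ ^ 2 := hK.lintegral_sq_czT_le hδ hg1i hg1B
      _ ≤ ENNReal.ofReal L ^ 2 * ∫⁻ y in Metric.closedBall x ε, ENNReal.ofReal (B ^ 2) := by
          refine mul_le_mul_right ?_ _
          rw [← lintegral_indicator measurableSet_closedBall]
          refine lintegral_mono fun y => ?_
          by_cases hy : y ∈ Metric.closedBall x ε
          · rw [indicator_of_mem hy, ENNReal.ofReal_pow hB0.le]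
            gcongr
            rw [← ofReal_norm]
            exact ENNReal.ofReal_le_ofReal (hg1B y)
          · rw [indicator_of_notMem hy, hg1, indicator_of_notMem hy]; simp
      _ = _ := by
          rw [setLIntegral_const, hvol, ← mul_assoc, ← mul_assoc, ENNReal.ofReal_mul (by positivity),
            ENNReal.ofReal_mul (by positivity), ENNReal.ofReal_pow hL]
  have hmain : ENNReal.ofReal (4 * B ^ 2 * (L * M ^ n + 1) ^ 2) * volume P ≤
      ∫⁻ y in P, (2 * ‖czT K δ g y‖ₑ ^ 2 + 2 * ‖czT K δ g1 y‖ₑ ^ 2) := by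
    rw [← setLIntegral_const]
    refine lintegral_mono_ae ?_
    filter_upwards [ae_restrict_of_ae (hK.ae_integrableOn_truncation hg),
      ae_restrict_mem measurableSet_closedBall] with y hy hyP
    have hxy : ‖x - y‖ ≤ ε / M := by rwa [hP, mem_closedBall_iff_norm, norm_sub_rev] at hyP
    have h1 := hK.abs_czT_le_near hB0.le hB hδ hδε hx (hy δ hδ) hxy
    have h2 : 2 * B * (L * M ^ n + 1) ≤ |czT K δ g y| + |czT K δ g1 y| := by linarith
    have h3 : (2 * B * (L * M ^ n + 1)) ^ 2 ≤ (|czT K δ g y| + |czT K δ g1 y|) ^ 2 := by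
      gcongr
    have h4 : 4 * B ^ 2 * (L * M ^ n + 1) ^ 2 ≤ 2 * |czT K δ g y| ^ 2 + 2 * |czT K δ g1 y| ^ 2 := by
      nlinarith [sq_nonneg (|czT K δ g y| - |czT K δ g1 y|)]
    refine (ENNReal.ofReal_le_ofReal h4).trans (le_of_eq ?_)
    rw [ENNReal.ofReal_add (by positivity) (by positivity), ENNReal.ofReal_mul (by norm_num),
      ENNReal.ofReal_mul (by norm_num), ENNReal.ofReal_pow (abs_nonneg _),
      ENNReal.ofReal_pow (abs_nonneg _), ← Real.norm_eq_abs, ← Real.norm_eq_abs, ofReal_norm,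
      ofReal_norm]
    simp
  have hm1 : AEMeasurable (fun y => 2 * ‖czT K δ g y‖ₑ ^ 2) (volume.restrict P) :=
    ((hK.aestronglyMeasurable_czT hδ hg).enorm.pow_const 2).restrict.const_mul 2
  rw [lintegral_add_left' hm1, lintegral_const_mul' _ _ (by norm_num),
    lintegral_const_mul' _ _ (by norm_num)] at hmain
  have hMn : (1 : ℝ) ≤ M ^ n := one_le_pow₀ (by linarith)
  have hnum : 2 * B ^ 2 + 2 * (L ^ 2 * B ^ 2 * M ^ n) ≤ 4 * B ^ 2 * (L * M ^ n + 1) ^ 2 := by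
    have h1 : L ^ 2 * M ^ n ≤ (L * M ^ n) ^ 2 := by
      rw [mul_pow]; gcongr; nlinarith
    have h2 : (L * M ^ n) ^ 2 + 1 ≤ (L * M ^ n + 1) ^ 2 := by
      have : 0 ≤ L * M ^ n := by positivity
      nlinarith
    nlinarith [sq_nonneg B]
  have h5 : 2 * (ENNReal.ofReal (B ^ 2) * volume P) +
      2 * (ENNReal.ofReal (L ^ 2 * B ^ 2 * M ^ n) * volume P) ≤
      2 * (∫⁻ y in P, ‖czT K δ g y‖ₑ ^ 2) +
      2 * (ENNReal.ofReal (L ^ 2 * B ^ 2 * M ^ n) * volume P) := by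
    calc _ = ENNReal.ofReal (2 * B ^ 2 + 2 * (L ^ 2 * B ^ 2 * M ^ n)) * volume P := by
          rw [ENNReal.ofReal_add (by positivity) (by positivity), ENNReal.ofReal_mul (p := 2) (by norm_num),
            ENNReal.ofReal_mul (p := 2) (by norm_num)]
          simp; ring
      _ ≤ ENNReal.ofReal (4 * B ^ 2 * (L * M ^ n + 1) ^ 2) * volume P := by gcongr
      _ ≤ _ := hmain.trans (by gcongr)
  have h6 := (ENNReal.add_le_add_iff_right (ENNReal.mul_ne_top (by norm_num)
    (ENNReal.mul_ne_top ENNReal.ofReal_ne_top hPfin))).1 h5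
  exact (ENNReal.mul_le_mul_iff_right (by norm_num) (by norm_num)).1 h6

/-- Weak type estimate for the maximal truncation of a bounded integrable function. -/
theorem mul_volume_czT_good_le (hK : CZKernel K M A) {g : Eu n → ℝ}
    (hg : Integrable g) {B : ℝ} (hB0 : 0 < B) (hB : ∀ x, |g x| ≤ B) :
    ENNReal.ofReal B * volume {x | (∀ ε : ℝ, 0 < ε →
        IntegrableOn (fun y => K (x - y) * g y) {y | ε < ‖x - y‖}) ∧
        ∃ ε : ℝ, 0 < ε ∧ B * (A + 2 * (czL2 M A * M ^ n + 1)) < |czT K ε g x|} ≤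
      ENNReal.ofReal (5 ^ n * czL2 M A ^ 2) * ∫⁻ x, ‖g x‖ₑ := by
  have hM := hK.two_le
  have hL := czL2_nonneg hK
  set S : ℕ → Set (Eu n) := fun k => {x | (∀ ε : ℝ, 0 < ε →
        IntegrableOn (fun y => K (x - y) * g y) {y | ε < ‖x - y‖}) ∧
        ∃ ε : ℝ, 2 * (1 / ((k : ℝ) + 1)) ≤ ε ∧ ε ≤ k ∧
          B * (A + 2 * (czL2 M A * M ^ n + 1)) < |czT K ε g x|} with hS
  have hmono : Monotone S := by
    intro k l hkl x hx
    obtain ⟨h1, ε, h2, h3, h4⟩ := hx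
    have hkl' : (k : ℝ) ≤ l := by exact_mod_cast hkl
    refine ⟨h1, ε, le_trans ?_ h2, h3.trans hkl', h4⟩
    gcongr
  have hk : ∀ k, ENNReal.ofReal (B ^ 2) * volume (S k) ≤
      ENNReal.ofReal (5 ^ n * czL2 M A ^ 2) * (ENNReal.ofReal B * ∫⁻ x, ‖g x‖ₑ) := by
    intro k
    have hδ : (0 : ℝ) < 1 / ((k : ℝ) + 1) := by positivity
    have h1 := mul_volume_maximal_le (fun y => ‖czT K (1 / ((k : ℝ) + 1)) g y‖ₑ ^ 2)
      (ENNReal.ofReal (B ^ 2)) (S k) k (by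
        rintro x ⟨h1, ε, h2, h3, h4⟩
        have hε : 0 < ε := by linarith
        refine ⟨ε / M, by positivity, ?_, hK.sq_mul_volume_closedBall_le hg hB0 hB hδ h2 (h1 ε hε) h4⟩
        refine le_trans ?_ h3
        exact div_le_self hε.le (by linarith))
    refine h1.trans ?_
    calc _ ≤ 5 ^ n * (ENNReal.ofReal (czL2 M A) ^ 2 * ∫⁻ x, ‖g x‖ₑ ^ 2) := by
          gcongr
          exact hK.lintegral_sq_czT_le hδ hg hB
      _ ≤ 5 ^ n * (ENNReal.ofReal (czL2 M A) ^ 2 * (ENNReal.ofReal B * ∫⁻ x, ‖g x‖ₑ)) := by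
          gcongr
          rw [← lintegral_const_mul' _ _ ENNReal.ofReal_ne_top]
          refine lintegral_mono fun x => ?_
          rw [sq]
          gcongr
          rw [← ofReal_norm]
          exact ENNReal.ofReal_le_ofReal (hB x)
      _ = _ := by
          rw [ENNReal.ofReal_mul (by positivity), ENNReal.ofReal_pow hL,
            ENNReal.ofReal_pow (by norm_num)]
          simp; ring
  have hsub : {x | (∀ ε : ℝ, 0 < ε →
        IntegrableOn (fun y => K (x - y) * g y) {y | ε < ‖x - y‖}) ∧
        ∃ ε : ℝ, 0 < ε ∧ B * (A + 2 * (czL2 M A * M ^ n + 1)) < |czT K ε g x|} ⊆ ⋃ k, S k := by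
    rintro x ⟨h1, ε, h2, h3⟩
    obtain ⟨k, hk⟩ := exists_nat_ge ε
    obtain ⟨l, hl⟩ := exists_nat_one_div_lt (half_pos h2)
    refine mem_iUnion.2 ⟨max k l, h1, ε, ?_, hk.trans (by exact_mod_cast le_max_left k l), h3⟩
    have hl' : (l : ℝ) ≤ (max k l : ℕ) := by exact_mod_cast le_max_right k l
    have : 1 / (((max k l : ℕ) : ℝ) + 1) ≤ 1 / ((l : ℝ) + 1) := by gcongr
    linarith
  have hfinal : ENNReal.ofReal (B ^ 2) * volume (⋃ k, S k) ≤
      ENNReal.ofReal (5 ^ n * czL2 M A ^ 2) * (ENNReal.ofReal B * ∫⁻ x, ‖g x‖ₑ) := by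
    rw [hmono.measure_iUnion, ENNReal.mul_iSup]
    exact iSup_le hk
  have h7 : ENNReal.ofReal B * (ENNReal.ofReal B * volume (⋃ k, S k)) ≤
      ENNReal.ofReal B * (ENNReal.ofReal (5 ^ n * czL2 M A ^ 2) * ∫⁻ x, ‖g x‖ₑ) := by
    rw [← mul_assoc, ← sq, ← ENNReal.ofReal_pow hB0.le, mul_left_comm]
    exact hfinal
  refine le_trans (mul_le_mul_right (measure_mono hsub) _) ?_
  exact (ENNReal.mul_le_mul_iff_right (by simpa using hB0) ENNReal.ofReal_ne_top).1 h7

end CZKernel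

end

section

variable {n : ℕ}

namespace CZKernel

variable {K : Eu n → ℝ} {M A : ℝ}

theorem measurable_cellError (hK : CZKernel K M A) {b : Eu n → ℝ} (hb : Integrable b) (β : ℝ)
    (Q : Set (Eu n)) (c : Eu n) : Measurable (cellError K b β Q c) := by
  have hKm := hK.meas
  have hbm := hb.1.stronglyMeasurable_mk.measurable
  have h : cellError K b β Q c = fun x => ∫⁻ y in Q, ‖K (x - y) - K (x - c)‖ₑ *
      (‖hb.1.mk b y‖ₑ + ENNReal.ofReal β) := by
    funext x
    refine lintegral_congr_ae ?_
    filter_upwards [ae_restrict_of_ae hb.1.ae_eq_mk] with y hy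
    rw [hy]
  rw [h]
  have hm1 : Measurable fun p : Eu n × Eu n => ‖K (p.1 - p.2) - K (p.1 - c)‖ₑ :=
    ((hKm.comp (measurable_fst.sub measurable_snd)).sub
      (hKm.comp (measurable_fst.sub_const c))).enorm
  have hm2 : Measurable fun p : Eu n × Eu n => ‖hb.1.mk b p.2‖ₑ + ENNReal.ofReal β :=
    ((hbm.comp measurable_snd).enorm).add_const _
  exact (hm1.mul hm2).lintegral_prod_right'

def weakHeight (n : ℕ) (M A : ℝ) : ℝ :=
  5 ^ n * (A + 2 * (czL2 M A * M ^ n + 1)) + 1 + 2 * 5 ^ n * (A * Real.log 4)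

def weakMass (n : ℕ) (M A : ℝ) : ℝ :=
  (M + 3) ^ n * 5 ^ n + 2 * A * (2 * 5 ^ n) * 5 ^ n + 5 ^ n * czL2 M A ^ 2

theorem weakHeight_pos (hK : CZKernel K M A) : 0 < weakHeight n M A := by
  have := czL2_nonneg hK
  have := hK.nonneg
  have := hK.two_le
  have := Real.log_nonneg (show (1 : ℝ) ≤ 4 by norm_num)
  unfold weakHeight
  positivity

theorem czT_sub {f g : Eu n → ℝ} {ε : ℝ} {x : Eu n}
    (hf : IntegrableOn (fun y => K (x - y) * f y) {y | ε < ‖x - y‖})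
    (hg : IntegrableOn (fun y => K (x - y) * g y) {y | ε < ‖x - y‖}) :
    czT K ε (fun y => f y - g y) x = czT K ε f x - czT K ε g x := by
  rw [czT, czT, czT, ← integral_sub hf hg]
  simp only [mul_sub]

theorem mul_volume_czT_weakHeight_le (hn : 0 < n) (hK : CZKernel K M A) {f : Eu n → ℝ}
    (hf : Integrable f) {α : ℝ} (hα : 0 < α) :
    ENNReal.ofReal α * volume {x | ∃ ε : ℝ, 0 < ε ∧ weakHeight n M A * α < |czT K ε f x|} ≤
      ENNReal.ofReal (weakMass n M A) * ∫⁻ x, ‖f x‖ₑ := by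
  have hM := hK.two_le
  have hA := hK.nonneg
  have hL := czL2_nonneg hK
  obtain ⟨u, ρ, Q, g, D⟩ := exists_czDecomposition hn hf hα
  have : Countable u := D.countable
  have hg := D.integrable
  set b : Eu n → ℝ := fun x => f x - g x with hbdef
  have hb : Integrable b := hf.sub hg
  set β : ℝ := 2 * 5 ^ n * α with hβ
  have hβ0 : 0 ≤ β := by positivity
  set E : Set (Eu n) := ⋃ c : u, Metric.closedBall (c : Eu n) ((M + 3) * ρ c) with hE
  have hEm : MeasurableSet E := MeasurableSet.iUnion fun c => measurableSet_closedBall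
  set H : Eu n → ENNReal := fun x => ∑' c : u, cellError K b β (Q c) c x with hH
  have hHm : Measurable H := Measurable.tsum fun c => hK.measurable_cellError hb _ _ _
  set S : Set (Eu n) := {x | (∀ ε : ℝ, 0 < ε →
        IntegrableOn (fun y => K (x - y) * g y) {y | ε < ‖x - y‖}) ∧
        ∃ ε : ℝ, 0 < ε ∧ 5 ^ n * α * (A + 2 * (czL2 M A * M ^ n + 1)) < |czT K ε g x|} with hS
  have hsum : ENNReal.ofReal α * ∑' c : u, volume (Metric.closedBall (c : Eu n) (ρ c)) ≤
    5 ^ n * ∫⁻ x, ‖f x‖ₑ := D.tsum_le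
  have hEv : ENNReal.ofReal α * volume E ≤
      ENNReal.ofReal ((M + 3) ^ n * 5 ^ n) * ∫⁻ x, ‖f x‖ₑ := by
    calc _ ≤ ENNReal.ofReal α * ∑' c : u, volume (Metric.closedBall (c : Eu n) ((M + 3) * ρ c)) := by
          gcongr; exact measure_iUnion_le _
      _ = ENNReal.ofReal α * ∑' c : u, ENNReal.ofReal ((M + 3) ^ n) *
          volume (Metric.closedBall (c : Eu n) (ρ c)) := by
          congr 2 with c
          have h0 := D.pos c c.2
          rw [Measure.addHaar_closedBall volume (c : Eu n) (r := (M + 3) * ρ c) (by positivity),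
            Measure.addHaar_closedBall volume (c : Eu n) (r := ρ c) h0.le, ← mul_assoc,
            ← ENNReal.ofReal_mul (by positivity), mul_pow]
          simp
      _ = ENNReal.ofReal ((M + 3) ^ n) * (ENNReal.ofReal α *
          ∑' c : u, volume (Metric.closedBall (c : Eu n) (ρ c))) := by
          rw [ENNReal.tsum_mul_left]; ring
      _ ≤ ENNReal.ofReal ((M + 3) ^ n) * (5 ^ n * ∫⁻ x, ‖f x‖ₑ) := by gcongr
      _ = _ := by
          rw [ENNReal.ofReal_mul (by positivity), ENNReal.ofReal_pow (p := 5) (by norm_num)]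
          simp; ring
  have hHv : ENNReal.ofReal α * volume (Eᶜ ∩ {x | ENNReal.ofReal α ≤ H x}) ≤
      ENNReal.ofReal (2 * A * (2 * 5 ^ n) * 5 ^ n) * ∫⁻ x, ‖f x‖ₑ := by
    have hset : MeasurableSet {x | ENNReal.ofReal α ≤ H x} := measurableSet_le measurable_const hHm
    calc _ = ENNReal.ofReal α * (volume.restrict Eᶜ) {x | ENNReal.ofReal α ≤ H x} := by
          rw [Measure.restrict_apply hset, inter_comm]
      _ ≤ ∫⁻ x in Eᶜ, H x := mul_meas_ge_le_lintegral hHm _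
      _ = ∑' c : u, ∫⁻ x in Eᶜ, cellError K b β (Q c) c x :=
          lintegral_tsum fun c => (hK.measurable_cellError hb _ _ _).aemeasurable
      _ ≤ ∑' c : u, ENNReal.ofReal (2 * A * β) * volume (Metric.closedBall (c : Eu n) (ρ c)) := by
          refine ENNReal.tsum_le_tsum fun c => ?_
          calc _ ≤ ∫⁻ x in (Metric.closedBall (c : Eu n) ((M + 3) * ρ c))ᶜ,
                cellError K b β (Q c) c x :=
                lintegral_mono_set (compl_subset_compl.2 (subset_iUnion (fun c : u =>
                  Metric.closedBall (c : Eu n) ((M + 3) * ρ c)) c))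
            _ ≤ _ := hK.lintegral_cellError_le hb (D.pos c c.2) (D.measurableSet c c.2)
                (D.subset c c.2) (D.bad_le c c.2)
            _ ≤ _ := by gcongr; exact D.subset c c.2
      _ = ENNReal.ofReal (2 * A * (2 * 5 ^ n)) * (ENNReal.ofReal α *
          ∑' c : u, volume (Metric.closedBall (c : Eu n) (ρ c))) := by
          rw [ENNReal.tsum_mul_left, show 2 * A * β = 2 * A * (2 * 5 ^ n) * α by rw [hβ]; ring,
            ENNReal.ofReal_mul (q := α) (by positivity), mul_assoc]
      _ ≤ ENNReal.ofReal (2 * A * (2 * 5 ^ n)) * (5 ^ n * ∫⁻ x, ‖f x‖ₑ) := by gcongr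
      _ = _ := by
          rw [ENNReal.ofReal_mul (p := 2 * A * (2 * 5 ^ n)) (by positivity),
            ENNReal.ofReal_pow (p := 5) (by norm_num)]
          simp; ring
  have hSv : ENNReal.ofReal α * volume S ≤
      ENNReal.ofReal (5 ^ n * czL2 M A ^ 2) * ∫⁻ x, ‖f x‖ₑ := by
    calc _ ≤ ENNReal.ofReal (5 ^ n * α) * volume S := by
          gcongr
          exact le_mul_of_one_le_left hα.le (one_le_pow₀ (by norm_num))
      _ ≤ _ := hK.mul_volume_czT_good_le hg (by positivity) D.bound
      _ ≤ _ := by gcongr ENNReal.ofReal _ * ?_; exact D.lintegral_le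
  have hsub : ({x | ∃ ε : ℝ, 0 < ε ∧ weakHeight n M A * α < |czT K ε f x|} : Set (Eu n)) ≤ᵐ[volume]
      (E ∪ (Eᶜ ∩ {x | ENNReal.ofReal α ≤ H x}) ∪ S : Set (Eu n)) := by
    filter_upwards [hK.ae_integrableOn_truncation hf, hK.ae_integrableOn_truncation hg,
      hK.ae_integrableOn_truncation hb] with x hxf hxg hxb hx
    obtain ⟨ε, hε, hT⟩ : ∃ ε : ℝ, 0 < ε ∧ weakHeight n M A * α < |czT K ε f x| := hx
    by_cases hxE : x ∈ E
    · exact Or.inl (Or.inl hxE)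
    by_cases hxH : ENNReal.ofReal α ≤ H x
    · exact Or.inl (Or.inr ⟨hxE, hxH⟩)
    refine Or.inr ⟨hxg, ε, hε, ?_⟩
    have hxc : ∀ c ∈ u, (M + 3) * ρ c < ‖x - c‖ := by
      intro c hc
      by_contra! hcon
      exact hxE (mem_iUnion.2 ⟨⟨c, hc⟩, mem_closedBall_iff_norm.2 hcon⟩)
    have h1 := hK.enorm_czT_bad_le hb D.countable D.measurableSet D.subset D.disjoint D.mean_zero
      hβ0 D.bad_le (by
        filter_upwards [D.ae_eq] with y hy hyu
        rw [hbdef]; simp [hy hyu]) hε (hxb ε hε) hxc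
    have hlog := Real.log_nonneg (show (1 : ℝ) ≤ 4 by norm_num)
    have h2 : |czT K ε b x| ≤ α + β * (A * Real.log 4) := by
      have h3 : ‖czT K ε b x‖ₑ ≤ ENNReal.ofReal (α + β * (A * Real.log 4)) := by
        rw [ENNReal.ofReal_add hα.le (by positivity)]
        exact h1.trans (add_le_add_left (not_le.1 hxH).le _)
      rw [← ofReal_norm] at h3
      exact (ENNReal.ofReal_le_ofReal_iff (by positivity)).1 h3
    have h4 : czT K ε b x = czT K ε f x - czT K ε g x := czT_sub (hxf ε hε) (hxg ε hε)
    have h5 : |czT K ε f x| ≤ |czT K ε b x| + |czT K ε g x| := by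
      rw [show czT K ε f x = czT K ε b x + czT K ε g x by rw [h4]; ring]
      exact abs_add_le _ _
    have h6 : weakHeight n M A * α = 5 ^ n * α * (A + 2 * (czL2 M A * M ^ n + 1)) +
        (α + β * (A * Real.log 4)) := by
      rw [weakHeight, hβ]; ring
    linarith
  calc _ ≤ ENNReal.ofReal α * volume (E ∪ (Eᶜ ∩ {x | ENNReal.ofReal α ≤ H x}) ∪ S) := by
        gcongr 1; exact measure_mono_ae hsub
    _ ≤ ENNReal.ofReal α * (volume E + volume (Eᶜ ∩ {x | ENNReal.ofReal α ≤ H x}) + volume S) := by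
        gcongr 1
        exact (measure_union_le _ _).trans (by gcongr; exact measure_union_le _ _)
    _ ≤ _ := by
        rw [mul_add, mul_add, weakMass, ENNReal.ofReal_add (by positivity) (by positivity),
          ENNReal.ofReal_add (by positivity) (by positivity), add_mul, add_mul]
        exact add_le_add (add_le_add hEv hHv) hSv

/-- The weak type `(1,1)` estimate for the maximal truncation. -/
theorem exists_weakType (hn : 0 < n) (hK : CZKernel K M A) :
    ∃ C : ℝ, 0 ≤ C ∧ ∀ f : Eu n → ℝ, Integrable f → ∀ α : ℝ, 0 < α →
      ENNReal.ofReal α * volume {x | ∃ ε : ℝ, 0 < ε ∧ α < |czT K ε f x|} ≤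
        ENNReal.ofReal C * ∫⁻ x, ‖f x‖ₑ := by
  have hH := hK.weakHeight_pos
  have hM := hK.two_le
  have hA := hK.nonneg
  have hL := czL2_nonneg hK
  refine ⟨weakHeight n M A * weakMass n M A, mul_nonneg hH.le (by unfold weakMass; positivity),
    fun f hf α hα => ?_⟩
  have h := hK.mul_volume_czT_weakHeight_le hn hf (div_pos hα hH)
  rw [mul_div_cancel₀ _ hH.ne'] at h
  rw [ENNReal.ofReal_mul hH.le, mul_assoc]
  refine le_trans (le_of_eq ?_) (mul_le_mul_right h _)
  rw [← mul_assoc, ← ENNReal.ofReal_mul hH.le, mul_div_cancel₀ _ hH.ne']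

end CZKernel

end

section

variable {n : ℕ}

namespace CZKernel

variable {K : Eu n → ℝ} {M A : ℝ}

theorem integrable_norm_mul_indicator (hK : CZKernel K M A) :
    Integrable ({z : Eu n | ‖z‖ ≤ 1}.indicator fun z => ‖z‖ * ‖K z‖) := by
  rw [integrable_indicator_iff (measurableSet_le measurable_norm measurable_const)]
  refine ⟨(measurable_norm.mul hK.meas.norm).aestronglyMeasurable, ?_⟩
  refine lt_of_le_of_lt (le_of_eq ?_) ((hK.moment 1 one_pos).trans_lt ENNReal.ofReal_lt_top)
  refine lintegral_congr fun z => ?_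
  rw [enorm_mul, enorm_norm, enorm_norm]

theorem czT_eq_of_le_one (hK : CZKernel K M A) {f : Eu n → ℝ} {ε : ℝ} (hε : 0 < ε) (hε1 : ε ≤ 1)
    {x : Eu n} (hx : IntegrableOn (fun y => K (x - y) * f y) {y | ε < ‖x - y‖}) :
    czT K ε f x = czT K 1 f x + ∫ y, annK K ε 1 (x - y) * (f y - f x) := by
  set V1 : Set (Eu n) := {y | 1 < ‖x - y‖} with hV1
  set V : Set (Eu n) := {y | ε < ‖x - y‖} with hV
  have hVm : MeasurableSet V := measurableSet_lt_norm_sub ε x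
  have hV1m : MeasurableSet V1 := measurableSet_lt_norm_sub 1 x
  have hsub : V1 ⊆ V := fun y (hy : 1 < ‖x - y‖) => lt_of_le_of_lt hε1 hy
  have hfun : (fun y => annK K ε 1 (x - y) * f y) =
      (V \ V1).indicator fun y => K (x - y) * f y := by
    funext y
    by_cases hy : y ∈ V \ V1
    · have hy1 : ε < ‖x - y‖ := hy.1
      have hy2 : ‖x - y‖ ≤ 1 := not_lt.1 hy.2
      rw [indicator_of_mem hy, annK, indicator_of_mem]
      exact ⟨hy1, hy2⟩
    · rw [indicator_of_notMem hy, annK, indicator_of_notMem, zero_mul]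
      intro h
      have h1 : ε < ‖x - y‖ ∧ ‖x - y‖ ≤ 1 := h
      exact hy ⟨h1.1, fun (h2 : 1 < ‖x - y‖) => absurd h1.2 (not_le.2 h2)⟩
  have hi1 : Integrable (fun y => annK K ε 1 (x - y) * f y) := by
    rw [hfun]
    exact (integrable_indicator_iff (hVm.diff hV1m)).2 (hx.mono_set sdiff_subset)
  have hi2 : Integrable (fun y => annK K ε 1 (x - y)) := (hK.integrable_annK hε).comp_sub_left x
  have h0 : ∫ y, annK K ε 1 (x - y) = 0 := by
    rw [integral_sub_left_eq_self (annK K ε 1) volume x, hK.integral_annK hε]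
  have h1 : ∫ y, annK K ε 1 (x - y) * (f y - f x) = ∫ y, annK K ε 1 (x - y) * f y := by
    simp only [mul_sub]
    rw [integral_sub hi1 (hi2.mul_const _), integral_mul_const, h0, zero_mul, sub_zero]
  rw [h1, hfun, integral_indicator (hVm.diff hV1m), setIntegral_sdiff hV1m hx hsub, czT, czT,
    add_sub_cancel]

theorem tendsto_czT_of_lipschitz (hK : CZKernel K M A) {f : Eu n → ℝ} {Λ : NNReal}
    (hf : LipschitzWith Λ f) {x : Eu n} (hx : ∀ ε : ℝ, 0 < ε →
      IntegrableOn (fun y => K (x - y) * f y) {y | ε < ‖x - y‖}) :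
    ∃ l, Tendsto (fun ε => czT K ε f x) (nhdsWithin 0 (Ioi 0)) (nhds l) := by
  have hlim : Tendsto (fun ε : ℝ => ∫ y, annK K ε 1 (x - y) * (f y - f x))
      (nhdsWithin 0 (Ioi 0)) (nhds (∫ y, annK K 0 1 (x - y) * (f y - f x))) := by
    have hfm := hf.continuous.measurable
    refine tendsto_integral_filter_of_dominated_convergence (fun y =>
      ({z : Eu n | ‖z‖ ≤ 1}.indicator fun z => ‖z‖ * ‖K z‖) (x - y) * Λ) ?_ ?_ ?_ ?_
    · refine Eventually.of_forall fun ε => ?_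
      have hm : Measurable (annK K ε 1) := hK.meas.indicator (measurableSet_annulus ε 1)
      exact ((hm.comp (measurable_const.sub measurable_id)).mul
        (hfm.sub_const _)).aestronglyMeasurable
    · refine Eventually.of_forall fun ε => Eventually.of_forall fun y => ?_
      by_cases hy : x - y ∈ {x : Eu n | ε < ‖x‖ ∧ ‖x‖ ≤ 1}
      · rw [annK, indicator_of_mem hy, indicator_of_mem (s := {z : Eu n | ‖z‖ ≤ 1}) hy.2, norm_mul]
        have h1 : ‖f y - f x‖ ≤ Λ * ‖x - y‖ := by
          have := hf.norm_sub_le y x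
          rwa [norm_sub_rev y x] at this
        calc _ ≤ ‖K (x - y)‖ * (Λ * ‖x - y‖) := by gcongr
          _ = _ := by ring
      · rw [annK, indicator_of_notMem hy, zero_mul, norm_zero]
        refine mul_nonneg (indicator_nonneg (fun z _ => by positivity) _) Λ.2
    · exact (hK.integrable_norm_mul_indicator.comp_sub_left x).mul_const _
    · refine Eventually.of_forall fun y => ?_
      refine tendsto_nhds_of_eventually_eq ?_
      rcases (norm_nonneg (x - y)).eq_or_lt with h | h
      · filter_upwards [self_mem_nhdsWithin] with ε hε
        have hε : 0 < ε := hε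
        rw [annK, annK, indicator_of_notMem, indicator_of_notMem]
        · exact fun hh => absurd hh.1 (by rw [← h]; exact lt_irrefl _)
        · exact fun hh => absurd hh.1 (by rw [← h]; exact not_lt.2 hε.le)
      · filter_upwards [Ioo_mem_nhdsGT h] with ε hε
        congr 1
        by_cases h1 : ‖x - y‖ ≤ 1
        · rw [annK, annK, indicator_of_mem, indicator_of_mem]
          · exact ⟨h, h1⟩
          · exact ⟨hε.2, h1⟩
        · rw [annK, annK, indicator_of_notMem, indicator_of_notMem]
          · exact fun hh => h1 hh.2
          · exact fun hh => h1 hh.2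
  refine ⟨_, (tendsto_const_nhds.add hlim (a := czT K 1 f x)).congr' ?_⟩
  filter_upwards [Ioc_mem_nhdsGT (zero_lt_one' ℝ)] with ε hε
  exact (hK.czT_eq_of_le_one hε.1 hε.2 (hx ε hε.1)).symm

theorem exists_lipschitz_approx {f : Eu n → ℝ} (hf : Integrable f) {η : ℝ} (hη : 0 < η) :
    ∃ (g : Eu n → ℝ) (Λ : NNReal), LipschitzWith Λ g ∧ HasCompactSupport g ∧
      ∫⁻ x, ‖f x - g x‖ₑ ≤ ENNReal.ofReal η := by
  obtain ⟨g, h1, h2, h3⟩ := MemLp.exist_eLpNorm_sub_le (p := 1) (by norm_num) le_rfl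
    (memLp_one_iff_integrable.2 hf) hη
  obtain ⟨Λ, hΛ⟩ := h2.lipschitzWith_of_hasCompactSupport h1 (by norm_num)
  refine ⟨g, Λ, hΛ, h1, ?_⟩
  rwa [eLpNorm_one_eq_lintegral_enorm] at h3

/-- Truncations of an integrable function converge almost everywhere. -/
theorem ae_exists_tendsto_czT (hn : 0 < n) (hK : CZKernel K M A) {f : Eu n → ℝ}
    (hf : Integrable f) :
    ∀ᵐ x, ∃ l, Tendsto (fun ε => czT K ε f x) (nhdsWithin 0 (Ioi 0)) (nhds l) := by
  obtain ⟨C, hC0, hC⟩ := hK.exists_weakType hn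
  have key : ∀ k : ℕ, ∀ᵐ x, ∃ δ : ℝ, 0 < δ ∧ ∀ ε ∈ Ioo 0 δ, ∀ ε' ∈ Ioo 0 δ,
      dist (czT K ε f x) (czT K ε' f x) < 1 / ((k : ℝ) + 1) := by
    intro k
    set τ : ℝ := 1 / ((k : ℝ) + 1) with hτ
    have hτ0 : 0 < τ := by positivity
    rw [ae_iff]
    set B : Set (Eu n) := {x | ¬ ∃ δ : ℝ, 0 < δ ∧ ∀ ε ∈ Ioo 0 δ, ∀ ε' ∈ Ioo 0 δ,
      dist (czT K ε f x) (czT K ε' f x) < τ} with hB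
    have hbound : ∀ η : ℝ, 0 < η → ENNReal.ofReal (τ / 4) * volume B ≤ ENNReal.ofReal (C * η) := by
      intro η hη
      obtain ⟨g, Λ, hgL, hgc, hfg⟩ := exists_lipschitz_approx hf hη
      have hg : Integrable g := hgL.continuous.integrable_of_hasCompactSupport hgc
      have hsub : B ≤ᵐ[volume] ({x | ∃ ε : ℝ, 0 < ε ∧
          τ / 4 < |czT K ε (fun y => f y - g y) x|} : Set (Eu n)) := by
        filter_upwards [hK.ae_integrableOn_truncation hf, hK.ae_integrableOn_truncation hg]
          with x hxf hxg hx
        have hx : ¬ ∃ δ : ℝ, 0 < δ ∧ ∀ ε ∈ Ioo 0 δ, ∀ ε' ∈ Ioo 0 δ,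
          dist (czT K ε f x) (czT K ε' f x) < τ := hx
        show ∃ ε : ℝ, 0 < ε ∧ τ / 4 < |czT K ε (fun y => f y - g y) x|
        by_contra! hcon
        apply hx
        have hcau := cauchy_map_iff_exists_tendsto.2 (hK.tendsto_czT_of_lipschitz hgL hxg)
        obtain ⟨t, ht, ht'⟩ := (Metric.cauchy_iff.1 hcau).2 (τ / 4) (by positivity)
        obtain ⟨δ, hδ, hδt⟩ := mem_nhdsGT_iff_exists_Ioo_subset.1 (mem_map.1 ht)
        refine ⟨δ, hδ, fun ε hε ε' hε' => ?_⟩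
        have h1 := ht' _ (hδt hε) _ (hδt hε')
        have h2 := hcon ε hε.1
        have h3 := hcon ε' hε'.1
        rw [czT_sub (hxf ε hε.1) (hxg ε hε.1)] at h2
        rw [czT_sub (hxf ε' hε'.1) (hxg ε' hε'.1)] at h3
        rw [Real.dist_eq] at h1 ⊢
        rw [abs_lt] at h1 ⊢
        rw [abs_le] at h2 h3
        constructor <;> linarith
      calc _ ≤ ENNReal.ofReal (τ / 4) * volume {x | ∃ ε : ℝ, 0 < ε ∧
          τ / 4 < |czT K ε (fun y => f y - g y) x|} := by gcongr 1; exact measure_mono_ae hsub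
        _ ≤ ENNReal.ofReal C * ∫⁻ x, ‖f x - g x‖ₑ := hC _ (hf.sub hg) _ (by positivity)
        _ ≤ _ := by rw [ENNReal.ofReal_mul hC0]; gcongr
    have hzero : ENNReal.ofReal (τ / 4) * volume B ≤ 0 := by
      have ht : Tendsto (fun η : ℝ => ENNReal.ofReal (C * η)) (nhdsWithin 0 (Ioi 0))
          (nhds (ENNReal.ofReal (C * 0))) :=
        ((ENNReal.continuous_ofReal.comp (continuous_const.mul continuous_id)).tendsto 0).mono_left
          nhdsWithin_le_nhds
      rw [mul_zero, ENNReal.ofReal_zero] at ht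
      refine ge_of_tendsto ht ?_
      filter_upwards [self_mem_nhdsWithin] with η hη using hbound η hη
    have := le_antisymm hzero zero_le
    rcases mul_eq_zero.1 this with h | h
    · exact absurd (ENNReal.ofReal_eq_zero.1 h) (by linarith)
    · exact h
  filter_upwards [ae_all_iff.2 key] with x hx
  rw [← cauchy_map_iff_exists_tendsto, Metric.cauchy_iff]
  refine ⟨inferInstance, fun η hη => ?_⟩
  obtain ⟨k, hk⟩ := exists_nat_one_div_lt hη
  obtain ⟨δ, hδ, h⟩ := hx k
  refine ⟨_, image_mem_map (Ioo_mem_nhdsGT hδ), ?_⟩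
  rintro _ ⟨ε, hε, rfl⟩ _ ⟨ε', hε', rfl⟩
  exact (h ε hε ε' hε').trans hk

end CZKernel

end

section

variable {n : ℕ}

theorem tendsto_ofReal_of_perturbed_bounds {F e : ℝ → ENNReal} {l : ℝ} (hl : 0 ≤ l)
    (he : Tendsto e (nhdsWithin 0 (Ioi 0)) (nhds 0))
    (hu : ∀ θ ∈ Ioo (0 : ℝ) 1, ∀ t : ℝ, 0 < t →
      F t ≤ ENNReal.ofReal (l / (1 - θ)) + ENNReal.ofReal (1 / θ) * e (θ * t))
    (hd : ∀ θ ∈ Ioo (0 : ℝ) 1, ∀ t : ℝ, 0 < t →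
      ENNReal.ofReal (l / (1 + θ)) ≤ F t + ENNReal.ofReal (1 / θ) * e (θ * t)) :
    Tendsto F (nhdsWithin 0 (Ioi 0)) (nhds (ENNReal.ofReal l)) := by
  have hscale : ∀ θ ∈ Ioo (0 : ℝ) 1, ∀ δ : ℝ, 0 < δ →
      ∀ᶠ t in nhdsWithin (0 : ℝ) (Ioi 0), ENNReal.ofReal (1 / θ) * e (θ * t) ≤ ENNReal.ofReal δ := by
    intro θ hθ δ hδ
    have h1 : Tendsto (fun t : ℝ => θ * t) (nhdsWithin 0 (Ioi 0)) (nhdsWithin 0 (Ioi 0)) := by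
      refine tendsto_nhdsWithin_iff.2 ⟨?_, ?_⟩
      · have : Tendsto (fun t : ℝ => θ * t) (nhds 0) (nhds (θ * 0)) :=
          (continuous_const.mul continuous_id).tendsto 0
        rw [mul_zero] at this
        exact this.mono_left nhdsWithin_le_nhds
      · filter_upwards [self_mem_nhdsWithin] with t ht
        have ht : 0 < t := ht
        exact mul_pos hθ.1 ht
    have h2 := ENNReal.Tendsto.const_mul (a := ENNReal.ofReal (1 / θ)) (he.comp h1)
      (Or.inr ENNReal.ofReal_ne_top)
    rw [mul_zero] at h2
    exact h2.eventually_le_const (ENNReal.ofReal_pos.2 hδ)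
  rw [ENNReal.tendsto_nhds ENNReal.ofReal_ne_top]
  intro δ' hδ'
  obtain ⟨δ, hδ, hδδ⟩ : ∃ δ : ℝ, 0 < δ ∧ ENNReal.ofReal (2 * δ) ≤ δ' := by
    rcases eq_or_ne δ' ⊤ with rfl | h
    · exact ⟨1, one_pos, le_top⟩
    · refine ⟨δ'.toReal / 2, half_pos (ENNReal.toReal_pos hδ'.ne' h), ?_⟩
      rw [mul_div_cancel₀ _ two_ne_zero, ENNReal.ofReal_toReal h]
  set θ : ℝ := δ / (l + δ) / 2 with hθ
  have hld : 0 < l + δ := by linarith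
  have hθ0 : 0 < θ := by positivity
  have hθl : θ * (l + δ) = δ / 2 := by rw [hθ]; field_simp
  have hθ1 : θ < 1 := by
    rw [hθ, div_div, div_lt_one (by positivity)]
    linarith
  filter_upwards [hscale θ ⟨hθ0, hθ1⟩ δ hδ, self_mem_nhdsWithin] with t ht ht0
  have h1 := hu θ ⟨hθ0, hθ1⟩ t ht0
  have h2 := hd θ ⟨hθ0, hθ1⟩ t ht0
  constructor
  · rw [tsub_le_iff_right]
    have h3 : l ≤ l / (1 + θ) + δ := by
      have : l * (1 - θ) ≤ l / (1 + θ) := by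
        rw [le_div_iff₀ (by linarith)]
        nlinarith [mul_nonneg hl (sq_nonneg θ)]
      nlinarith
    calc ENNReal.ofReal l ≤ ENNReal.ofReal (l / (1 + θ)) + ENNReal.ofReal δ := by
          rw [← ENNReal.ofReal_add (by positivity) hδ.le]
          exact ENNReal.ofReal_le_ofReal h3
      _ ≤ F t + ENNReal.ofReal δ + ENNReal.ofReal δ := by
          gcongr
          exact h2.trans (by gcongr)
      _ = F t + ENNReal.ofReal (2 * δ) := by
          rw [add_assoc, ← ENNReal.ofReal_add hδ.le hδ.le, two_mul]
      _ ≤ _ := by gcongr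
  · have h3 : l / (1 - θ) ≤ l + δ := by
      rw [div_le_iff₀ (by linarith)]
      nlinarith
    calc F t ≤ ENNReal.ofReal (l + δ) + ENNReal.ofReal δ := h1.trans (by gcongr)
      _ = ENNReal.ofReal l + ENNReal.ofReal (2 * δ) := by
          rw [ENNReal.ofReal_add hl hδ.le, add_assoc, ← ENNReal.ofReal_add hδ.le hδ.le, two_mul]
      _ ≤ _ := by gcongr

/-- If `λ ↦ λ |{|T - aK| > λ}|` vanishes at `0` and the distribution function of `K` is `D / λ`,
then `λ |{|T| > λ}|` tends to `D |a|`. -/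
theorem tendsto_mul_volume_of_sub {T K : Eu n → ℝ} {a D : ℝ} (hD : 0 ≤ D)
    (hK : ∀ t : ℝ, 0 < t → ENNReal.ofReal t * volume {x | t < |K x|} = ENNReal.ofReal D)
    (he : Tendsto (fun t : ℝ => ENNReal.ofReal t * volume {x | t < |T x - a * K x|})
      (nhdsWithin 0 (Ioi 0)) (nhds 0)) :
    Tendsto (fun t : ℝ => ENNReal.ofReal t * volume {x | t < |T x|})
      (nhdsWithin 0 (Ioi 0)) (nhds (ENNReal.ofReal (D * |a|))) := by
  have haK : ∀ c : ℝ, 0 < c → ∀ t : ℝ, 0 < t →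
      ENNReal.ofReal t * volume {x | c * t < |a * K x|} = ENNReal.ofReal (D * |a| / c) := by
    intro c hc t ht
    rcases eq_or_ne a 0 with rfl | ha
    · have : {x : Eu n | c * t < |0 * K x|} = ∅ := by
        ext x
        simp only [zero_mul, abs_zero, mem_ofPred_eq, mem_empty_iff_false, iff_false, not_lt]
        positivity
      rw [this]; simp
    · have ha' : 0 < |a| := abs_pos.2 ha
      have : {x : Eu n | c * t < |a * K x|} = {x | c * t / |a| < |K x|} := by
        ext x
        simp only [mem_ofPred_eq]
        rw [abs_mul, div_lt_iff₀ ha', mul_comm |a|]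
      rw [this, show t = |a| / c * (c * t / |a|) by field_simp, ENNReal.ofReal_mul (by positivity),
        mul_assoc]
      have h := hK (c * t / |a|) (by positivity)
      rw [show c * (|a| / c * (c * t / |a|)) / |a| = c * t / |a| by field_simp, h,
        ← ENNReal.ofReal_mul (by positivity)]
      congr 1; ring
  have hscale : ∀ θ : ℝ, 0 < θ → ∀ t : ℝ, 0 < t →
      ENNReal.ofReal t * volume {x | θ * t < |T x - a * K x|} = ENNReal.ofReal (1 / θ) *
        (ENNReal.ofReal (θ * t) * volume {x | θ * t < |T x - a * K x|}) := by
    intro θ hθ t ht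
    rw [← mul_assoc, ← ENNReal.ofReal_mul (by positivity)]
    congr 2; field_simp
  refine tendsto_ofReal_of_perturbed_bounds (by positivity) he ?_ ?_
  · intro θ hθ t ht
    rw [← haK (1 - θ) (by linarith [hθ.2]) t ht, ← hscale θ hθ.1 t ht, ← mul_add]
    gcongr
    refine (measure_mono ?_).trans (measure_union_le _ _)
    intro x hx
    have hx : t < |T x| := hx
    by_contra hcon
    rw [mem_union, not_or] at hcon
    have h1 : |a * K x| ≤ (1 - θ) * t := not_lt.1 hcon.1
    have h2 : |T x - a * K x| ≤ θ * t := not_lt.1 hcon.2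
    have h3 := abs_add_le (T x - a * K x) (a * K x)
    rw [sub_add_cancel] at h3
    linarith
  · intro θ hθ t ht
    rw [← haK (1 + θ) (by linarith [hθ.1]) t ht, ← hscale θ hθ.1 t ht, ← mul_add]
    gcongr
    refine (measure_mono ?_).trans (measure_union_le _ _)
    intro x hx
    have hx : (1 + θ) * t < |a * K x| := hx
    by_contra hcon
    rw [mem_union, not_or] at hcon
    have h1 : |T x| ≤ t := not_lt.1 hcon.1
    have h2 : |T x - a * K x| ≤ θ * t := not_lt.1 hcon.2
    have h3 := abs_sub (T x) (T x - a * K x)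
    rw [sub_sub_cancel] at h3
    linarith

end

section

variable {n : ℕ}

namespace CZKernel

variable {K : Eu n → ℝ} {M A : ℝ}

theorem enorm_czT_sub_le {g : Eu n → ℝ} (hg : Integrable g)
    {N R : ℝ} (hN : 2 ≤ N) (hgR : ∀ y, R ≤ ‖y‖ → g y = 0) {x : Eu n} (hxR : N * R ≤ ‖x‖)
    {ε : ℝ} (hε : 0 < ε) (hεR : ε < R)
    (hx : IntegrableOn (fun y => K (x - y) * g y) {y | ε < ‖x - y‖}) :
    ‖czT K ε g x - (∫ y, g y) * K x‖ₑ ≤ ∫⁻ y, ‖K (x - y) - K x‖ₑ * ‖g y‖ₑ := by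
  have h0 : ∀ y, y ∉ {y | ε < ‖x - y‖} → K (x - y) * g y = 0 := by
    intro y hy
    have hy : ‖x - y‖ ≤ ε := not_lt.1 hy
    have h1 := norm_sub_norm_le x y
    rw [hgR y (by nlinarith), mul_zero]
  have hi : Integrable fun y => K (x - y) * g y :=
    (integrableOn_iff_integrable_of_support_subset fun y hy => by
      by_contra hcon; exact hy (h0 y hcon)).1 hx
  rw [czT, setIntegral_eq_integral_of_forall_compl_eq_zero h0, mul_comm, ← integral_const_mul,
    ← integral_sub hi (hg.const_mul _)]
  refine (enorm_integral_le_lintegral_enorm _).trans (le_of_eq ?_)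
  refine lintegral_congr fun y => ?_
  rw [← enorm_mul, sub_mul]

theorem lintegral_lintegral_regularity_le (hK : Measurable K) {g : Eu n → ℝ} (hg : Measurable g)
    {N R η : ℝ} (hgR : ∀ y, R ≤ ‖y‖ → g y = 0)
    (hN : ∀ h : Eu n, ‖h‖ ≤ R → ∫⁻ x in {x : Eu n | N * R ≤ ‖x‖}, ‖K (x - h) - K x‖ₑ ≤
      ENNReal.ofReal η) :
    ∫⁻ x in {x : Eu n | N * R ≤ ‖x‖}, (∫⁻ y, ‖K (x - y) - K x‖ₑ * ‖g y‖ₑ) ≤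
      ENNReal.ofReal η * ∫⁻ y, ‖g y‖ₑ := by
  have hm : Measurable fun p : Eu n × Eu n => ‖K (p.1 - p.2) - K p.1‖ₑ * ‖g p.2‖ₑ :=
    (((hK.comp (measurable_fst.sub measurable_snd)).sub (hK.comp measurable_fst)).enorm).mul
      ((hg.comp measurable_snd).enorm)
  rw [lintegral_lintegral_swap hm.aemeasurable, ← lintegral_const_mul' _ _ ENNReal.ofReal_ne_top]
  refine lintegral_mono fun y => ?_
  rw [lintegral_mul_const' _ _ enorm_ne_top]
  rcases le_or_gt ‖y‖ R with h | h
  · gcongr; exact hN y h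
  · rw [hgR y h.le]; simp

/-- At small heights `T f` is indistinguishable from `(∫ f) K`. -/
theorem tendsto_mul_volume_limit_sub (hn : 0 < n) (hK : CZKernel K M A)
    (hreg : ∀ η : ℝ, 0 < η → ∃ N : ℝ, 2 ≤ N ∧ ∀ (h : Eu n) (s : ℝ), 0 < s → ‖h‖ ≤ s →
      ∫⁻ x in {x : Eu n | N * s ≤ ‖x‖}, ‖K (x - h) - K x‖ₑ ≤ ENNReal.ofReal η) {D : ℝ} (hD : 0 ≤ D)
    (hlevel : ∀ t : ℝ, 0 < t → ENNReal.ofReal t * volume {x | t < |K x|} = ENNReal.ofReal D)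
    {f T : Eu n → ℝ} (hf : Integrable f)
    (hT : ∀ᵐ x, Tendsto (fun ε => czT K ε f x) (nhdsWithin 0 (Ioi 0)) (nhds (T x))) :
    Tendsto (fun t : ℝ => ENNReal.ofReal t * volume {x | t < |T x - (∫ y, f y) * K x|})
      (nhdsWithin 0 (Ioi 0)) (nhds 0) := by
  obtain ⟨C, hC0, hC⟩ := hK.exists_weakType hn
  set F : ℝ := (∫⁻ x, ‖f x‖ₑ).toReal with hF
  have hFf : ∫⁻ x, ‖f x‖ₑ = ENNReal.ofReal F := (ENNReal.ofReal_toReal hf.2.ne).symm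
  have hF0 : 0 ≤ F := ENNReal.toReal_nonneg
  have key : ∀ η : ℝ, 0 < η → η ≤ 1 → ∃ R : ℝ, ∀ t : ℝ, 0 < t →
      ENNReal.ofReal t * volume {x | t < |T x - (∫ y, f y) * K x|} ≤
        ENNReal.ofReal t * volume (Metric.closedBall (0 : Eu n) R) +
          ENNReal.ofReal (4 * (C + (F + 1) + D) * η) := by
    intro η hη hη1
    obtain ⟨g, Λ, hgL, hgc, hfg⟩ := exists_lipschitz_approx hf hη
    have hg : Integrable g := hgL.continuous.integrable_of_hasCompactSupport hgc
    have hgm : Measurable g := hgL.continuous.measurable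
    obtain ⟨R, hR, hRg⟩ : ∃ R : ℝ, 0 < R ∧ ∀ y, R ≤ ‖y‖ → g y = 0 := by
      obtain ⟨r, hr, hrg⟩ := hgc.isCompact.isBounded.subset_closedBall_lt 0 0
      refine ⟨r + 1, by linarith, fun y hy => ?_⟩
      by_contra hcon
      have := mem_closedBall_zero_iff.1 (hrg (subset_closure (Function.mem_support.2 hcon)))
      linarith
    obtain ⟨N, hN2, hN⟩ := hreg η hη
    set G : Eu n → ENNReal := fun x => ∫⁻ y, ‖K (x - y) - K x‖ₑ * ‖g y‖ₑ with hG
    have hGm : Measurable G := by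
      have hm : Measurable fun p : Eu n × Eu n => ‖K (p.1 - p.2) - K p.1‖ₑ * ‖g p.2‖ₑ :=
        (((hK.meas.comp (measurable_fst.sub measurable_snd)).sub
          (hK.meas.comp measurable_fst)).enorm).mul ((hgm.comp measurable_snd).enorm)
      exact hm.lintegral_prod_right'
    have hgF : ∫⁻ y, ‖g y‖ₑ ≤ ENNReal.ofReal (F + 1) := by
      calc ∫⁻ y, ‖g y‖ₑ ≤ ∫⁻ y, (‖f y‖ₑ + ‖f y - g y‖ₑ) := by
            refine lintegral_mono fun y => ?_
            have := enorm_sub_le (a := f y) (b := f y - g y)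
            rwa [sub_sub_cancel] at this
        _ = (∫⁻ y, ‖f y‖ₑ) + ∫⁻ y, ‖f y - g y‖ₑ := lintegral_add_left' hf.1.enorm _
        _ ≤ ENNReal.ofReal F + ENNReal.ofReal 1 := by
            rw [hFf]; gcongr; exact hfg.trans (ENNReal.ofReal_le_ofReal hη1)
        _ = _ := (ENNReal.ofReal_add hF0 zero_le_one).symm
    have hag : |(∫ y, f y) - ∫ y, g y| ≤ η := by
      rw [← integral_sub hf hg, ← Real.norm_eq_abs]
      refine (norm_integral_le_lintegral_norm _).trans ?_
      refine ENNReal.toReal_le_of_le_ofReal (b := η) hη.le ?_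
      simpa only [ofReal_norm] using hfg
    refine ⟨N * R, fun t ht => ?_⟩
    set W : Set (Eu n) := {x : Eu n | N * R ≤ ‖x‖} with hW
    have hWm : MeasurableSet W := measurableSet_le measurable_const measurable_norm
    set S1 : Set (Eu n) := {x | ∃ ε : ℝ, 0 < ε ∧ t / 4 < |czT K ε (fun y => f y - g y) x|} with hS1
    set S2 : Set (Eu n) := {x | ENNReal.ofReal (t / 4) ≤ G x} ∩ W with hS2
    set S3 : Set (Eu n) := {x | t / 4 / η < |K x|} with hS3
    have h1 : ENNReal.ofReal t * volume S1 ≤ ENNReal.ofReal (4 * C * η) := by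
      have := hC (fun y => f y - g y) (hf.sub hg) (t / 4) (by positivity)
      calc _ = ENNReal.ofReal 4 * (ENNReal.ofReal (t / 4) * volume S1) := by
            rw [← mul_assoc, ← ENNReal.ofReal_mul (by norm_num), mul_div_cancel₀ _ (by norm_num)]
        _ ≤ ENNReal.ofReal 4 * (ENNReal.ofReal C * ENNReal.ofReal η) := by
            gcongr ENNReal.ofReal 4 * ?_
            exact this.trans (by gcongr)
        _ = _ := by
            rw [← ENNReal.ofReal_mul hC0, ← ENNReal.ofReal_mul (by norm_num), mul_assoc]
    have h2 : ENNReal.ofReal t * volume S2 ≤ ENNReal.ofReal (4 * (F + 1) * η) := by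
      have hset : MeasurableSet {x | ENNReal.ofReal (t / 4) ≤ G x} :=
        measurableSet_le measurable_const hGm
      calc _ = ENNReal.ofReal 4 * (ENNReal.ofReal (t / 4) *
            (volume.restrict W) {x | ENNReal.ofReal (t / 4) ≤ G x}) := by
            rw [← mul_assoc, ← ENNReal.ofReal_mul (by norm_num), mul_div_cancel₀ _ (by norm_num),
              Measure.restrict_apply hset]
        _ ≤ ENNReal.ofReal 4 * (ENNReal.ofReal η * ENNReal.ofReal (F + 1)) := by
            gcongr ENNReal.ofReal 4 * ?_
            refine (mul_meas_ge_le_lintegral hGm _).trans ?_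
            refine (lintegral_lintegral_regularity_le hK.meas hgm hRg
              fun h hh => hN h R hR hh).trans ?_
            gcongr
        _ = _ := by
            rw [← ENNReal.ofReal_mul hη.le, ← ENNReal.ofReal_mul (by norm_num)]
            congr 1; ring
    have h3 : ENNReal.ofReal t * volume S3 = ENNReal.ofReal (4 * D * η) := by
      have := hlevel (t / 4 / η) (by positivity)
      calc _ = ENNReal.ofReal (4 * η) * (ENNReal.ofReal (t / 4 / η) * volume S3) := by
            rw [← mul_assoc, ← ENNReal.ofReal_mul (by positivity)]
            congr 2; field_simp
        _ = _ := by
            rw [this, ← ENNReal.ofReal_mul (by positivity)]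
            congr 1; ring
    have hsub : ({x | t < |T x - (∫ y, f y) * K x|} : Set (Eu n)) ≤ᵐ[volume]
        (Metric.closedBall (0 : Eu n) (N * R) ∪ S1 ∪ S2 ∪ S3 : Set (Eu n)) := by
      filter_upwards [hT, hK.ae_integrableOn_truncation hf, hK.ae_integrableOn_truncation hg]
        with x hTx hxf hxg hx
      have hx : t < |T x - (∫ y, f y) * K x| := hx
      by_contra hcon
      have hcon : x ∉ Metric.closedBall (0 : Eu n) (N * R) ∪ S1 ∪ S2 ∪ S3 := hcon
      simp only [mem_union, not_or] at hcon
      obtain ⟨⟨⟨hcB, hc1⟩, hc2⟩, hc3⟩ := hcon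
      have hxR : N * R ≤ ‖x‖ := by
        rw [mem_closedBall_zero_iff, not_le] at hcB; exact hcB.le
      have hc1 : ∀ ε : ℝ, 0 < ε → |czT K ε (fun y => f y - g y) x| ≤ t / 4 := by
        intro ε hε
        by_contra! h
        exact hc1 ⟨ε, hε, h⟩
      have hc2 : G x < ENNReal.ofReal (t / 4) := by
        by_contra! h
        exact hc2 ⟨h, hxR⟩
      have hc3 : |K x| ≤ t / 4 / η := not_lt.1 hc3
      have hlim : |T x - (∫ y, f y) * K x| ≤ 3 / 4 * t := by
        have hcont : Tendsto (fun ε => |czT K ε f x - (∫ y, f y) * K x|) (nhdsWithin 0 (Ioi 0))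
          (nhds |T x - (∫ y, f y) * K x|) := (hTx.sub_const _).abs
        refine le_of_tendsto hcont ?_
        filter_upwards [Ioo_mem_nhdsGT hR] with ε hε
        have e1 := hc1 ε hε.1
        rw [czT_sub (hxf ε hε.1) (hxg ε hε.1)] at e1
        have e2 : |czT K ε g x - (∫ y, g y) * K x| ≤ t / 4 := by
          have := (enorm_czT_sub_le hg hN2 hRg hxR hε.1 hε.2 (hxg ε hε.1)).trans hc2.le
          rw [← ofReal_norm] at this
          exact (ENNReal.ofReal_le_ofReal_iff (by positivity)).1 this
        have e3 : |((∫ y, g y) - ∫ y, f y) * K x| ≤ t / 4 := by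
          rw [abs_mul, abs_sub_comm]
          calc _ ≤ η * (t / 4 / η) := by gcongr
            _ = _ := by field_simp
        have e4 : czT K ε f x - (∫ y, f y) * K x = (czT K ε f x - czT K ε g x) +
          (czT K ε g x - (∫ y, g y) * K x) + ((∫ y, g y) - ∫ y, f y) * K x := by ring
        rw [e4]
        refine (abs_add_three _ _ _).trans ?_
        linarith
      linarith
    calc _ ≤ ENNReal.ofReal t * volume (Metric.closedBall (0 : Eu n) (N * R) ∪ S1 ∪ S2 ∪ S3) := by
          gcongr 1; exact measure_mono_ae hsub
      _ ≤ ENNReal.ofReal t * (volume (Metric.closedBall (0 : Eu n) (N * R)) + volume S1 +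
          volume S2 + volume S3) := by
          gcongr 1
          refine (measure_union_le _ _).trans (add_le_add_left ?_ _)
          refine (measure_union_le _ _).trans (add_le_add_left ?_ _)
          exact measure_union_le _ _
      _ ≤ ENNReal.ofReal t * volume (Metric.closedBall (0 : Eu n) (N * R)) +
          ENNReal.ofReal (4 * C * η) + ENNReal.ofReal (4 * (F + 1) * η) +
          ENNReal.ofReal (4 * D * η) := by
          rw [mul_add, mul_add, mul_add, h3]
          gcongr
      _ = _ := by
          rw [add_assoc, add_assoc, ← ENNReal.ofReal_add (by positivity) (by positivity),
            ← ENNReal.ofReal_add (by positivity) (by positivity)]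
          congr 2; ring
  rw [ENNReal.tendsto_nhds_zero]
  intro δ' hδ'
  obtain ⟨δ, hδ, hδδ⟩ : ∃ δ : ℝ, 0 < δ ∧ ENNReal.ofReal (2 * δ) ≤ δ' := by
    rcases eq_or_ne δ' ⊤ with rfl | h
    · exact ⟨1, one_pos, le_top⟩
    · refine ⟨δ'.toReal / 2, half_pos (ENNReal.toReal_pos hδ'.ne' h), ?_⟩
      rw [mul_div_cancel₀ _ two_ne_zero, ENNReal.ofReal_toReal h]
  set c : ℝ := 4 * (C + (F + 1) + D) with hc
  have hc0 : 0 < c := by positivity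
  obtain ⟨R, hR⟩ := key (min 1 (δ / c)) (by positivity) (min_le_left _ _)
  have hlim : Tendsto (fun t : ℝ => ENNReal.ofReal t * volume (Metric.closedBall (0 : Eu n) R))
      (nhdsWithin 0 (Ioi 0)) (nhds 0) := by
    have h1 : Tendsto (fun t : ℝ => ENNReal.ofReal t) (nhdsWithin 0 (Ioi 0))
        (nhds (ENNReal.ofReal 0)) :=
      (ENNReal.continuous_ofReal.tendsto 0).mono_left nhdsWithin_le_nhds
    have h2 := ENNReal.Tendsto.mul_const (b := volume (Metric.closedBall (0 : Eu n) R)) h1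
      (Or.inr measure_closedBall_lt_top.ne)
    rwa [ENNReal.ofReal_zero, zero_mul] at h2
  filter_upwards [hlim.eventually_le_const (ENNReal.ofReal_pos.2 hδ), self_mem_nhdsWithin]
    with t ht ht0
  refine (hR t ht0).trans (le_trans ?_ hδδ)
  rw [two_mul, ENNReal.ofReal_add hδ.le hδ.le]
  refine add_le_add ht (ENNReal.ofReal_le_ofReal ?_)
  calc c * min 1 (δ / c) ≤ c * (δ / c) := by gcongr; exact min_le_right _ _
    _ = δ := by field_simp

end CZKernel

end

section

variable {n : ℕ}

instance : IsFiniteMeasure (sphereMeasure n) :=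
  inferInstanceAs (IsFiniteMeasure (volume : Measure (Eu n)).toSphere)

lemma norm_unitSphere (θ : unitSphere n) : ‖(θ : Eu n)‖ = 1 := by simp

lemma unitSphere_ne_zero (θ : unitSphere n) : (θ : Eu n) ≠ 0 := by
  rw [← norm_ne_zero_iff, norm_unitSphere]; exact one_ne_zero

/-- Integration in polar coordinates. -/
lemma lintegral_polar (hn : 0 < n) {F : Eu n → ENNReal} (hF : Measurable F) :
    ∫⁻ x, F x = ∫⁻ r in Ioi (0 : ℝ), ENNReal.ofReal (r ^ (n - 1)) *
      ∫⁻ θ : unitSphere n, F (r • (θ : Eu n)) ∂sphereMeasure n := by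
  have : Nonempty (Fin n) := ⟨⟨0, hn⟩⟩
  have : Nontrivial (Eu n) := inferInstance
  have hdim : Module.finrank ℝ (Eu n) = n := by simp
  have hG : Measurable fun p : unitSphere n × Ioi (0 : ℝ) => F (p.2.1 • (p.1 : Eu n)) :=
    hF.comp (by fun_prop)
  calc ∫⁻ x, F x
      = ∫⁻ x : ({(0)}ᶜ : Set (Eu n)), F x ∂((volume : Measure (Eu n)).comap (↑)) := by
        rw [lintegral_subtype_comap (measurableSet_singleton _).compl F,
          restrict_compl_singleton]
    _ = ∫⁻ p, F (p.2.1 • (p.1 : Eu n))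
          ∂(volume : Measure (Eu n)).toSphere.prod (.volumeIoiPow (Module.finrank ℝ (Eu n) - 1)) := by
        rw [← (volume : Measure (Eu n)).measurePreserving_homeomorphUnitSphereProd.lintegral_comp hG]
        refine lintegral_congr fun x => ?_
        congr 1
        have hx : (x : Eu n) ≠ 0 := x.2
        have := congrArg Subtype.val ((homeomorphUnitSphereProd (Eu n)).symm_apply_apply x)
        rw [homeomorphUnitSphereProd_symm_apply_coe] at this
        exact this.symm
    _ = ∫⁻ r : Ioi (0 : ℝ), ∫⁻ θ : unitSphere n, F (r.1 • (θ : Eu n)) ∂sphereMeasure n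
          ∂(.volumeIoiPow (n - 1)) := by
        rw [hdim]
        exact lintegral_prod_symm' _ hG
    _ = _ := by
        have hH : Measurable fun r : ℝ => ∫⁻ θ : unitSphere n, F (r • (θ : Eu n)) ∂sphereMeasure n :=
          Measurable.lintegral_prod_right' (f := fun p : ℝ × unitSphere n => F (p.1 • (p.2 : Eu n)))
            (hF.comp (by fun_prop))
        rw [Measure.volumeIoiPow]
        refine (lintegral_withDensity_eq_lintegral_mul _ (by fun_prop)
          (hH.comp measurable_subtype_coe)).trans ?_
        exact lintegral_subtype_comap measurableSet_Ioi (fun r : ℝ => ENNReal.ofReal (r ^ (n - 1)) *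
          ∫⁻ θ : unitSphere n, F (r • (θ : Eu n)) ∂sphereMeasure n)

/-- Polar coordinates restricted to a set depending only on the norm. -/
lemma setLIntegral_polar (hn : 0 < n) {F : Eu n → ENNReal} (hF : Measurable F) {S : Set ℝ}
    (hS : MeasurableSet S) :
    ∫⁻ x in {x : Eu n | ‖x‖ ∈ S}, F x = ∫⁻ r in Ioi (0 : ℝ) ∩ S, ENNReal.ofReal (r ^ (n - 1)) *
      ∫⁻ θ : unitSphere n, F (r • (θ : Eu n)) ∂sphereMeasure n := by
  have hS' : MeasurableSet {x : Eu n | ‖x‖ ∈ S} := measurable_norm hS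
  rw [← lintegral_indicator hS', lintegral_polar hn (hF.indicator hS'), inter_comm,
    ← setLIntegral_indicator hS]
  refine setLIntegral_congr_fun measurableSet_Ioi fun r hr => ?_
  have hr : 0 < r := hr
  have hnorm : ∀ θ : unitSphere n, ‖r • (θ : Eu n)‖ = r := fun θ => by
    rw [norm_smul, norm_unitSphere, mul_one, Real.norm_of_nonneg hr.le]
  by_cases h : r ∈ S
  · rw [indicator_of_mem h]
    congr 1
    refine lintegral_congr fun θ => indicator_of_mem ?_ _
    show ‖r • (θ : Eu n)‖ ∈ S
    rwa [hnorm]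
  · rw [indicator_of_notMem h]
    rw [lintegral_congr (g := fun _ => 0), lintegral_zero, mul_zero]
    refine fun θ => indicator_of_notMem (fun hh => h ?_) _
    have hh : ‖r • (θ : Eu n)‖ ∈ S := hh
    rwa [hnorm] at hh

end

section

variable {n : ℕ}

/-- The singular kernel `Ω(x) / |x|ⁿ`. -/
def omegaKernel (Ω : Eu n → ℝ) (x : Eu n) : ℝ := Ω x / ‖x‖ ^ n

lemma measurable_omegaKernel {Ω : Eu n → ℝ} (hΩ : Measurable Ω) : Measurable (omegaKernel Ω) :=
  hΩ.div (measurable_norm.pow_const n)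

lemma setLIntegral_radial_mul (hn : 0 < n) {G : Eu n → ENNReal} (hG : Measurable G)
    (hhom : ∀ c : ℝ, 0 < c → ∀ x : Eu n, x ≠ 0 → G (c • x) = G x)
    {g : ℝ → ENNReal} (hg : Measurable g) {S : Set ℝ} (hS : MeasurableSet S) :
    ∫⁻ x in {x : Eu n | ‖x‖ ∈ S}, g ‖x‖ * G x =
      (∫⁻ r in Ioi (0 : ℝ) ∩ S, ENNReal.ofReal (r ^ (n - 1)) * g r) *
        ∫⁻ θ : unitSphere n, G θ ∂sphereMeasure n := by
  have hGs : Measurable fun θ : unitSphere n => G θ := hG.comp measurable_subtype_coe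
  have hm : Measurable fun r : ℝ => ENNReal.ofReal (r ^ (n - 1)) * g r :=
    (by fun_prop : Measurable fun r : ℝ => ENNReal.ofReal (r ^ (n - 1))).mul hg
  rw [setLIntegral_polar hn (F := fun x => g ‖x‖ * G x)
    ((hg.comp measurable_norm).mul hG) hS, ← lintegral_mul_const _ hm]
  refine setLIntegral_congr_fun (measurableSet_Ioi.inter hS) fun r hr => ?_
  have hr : 0 < r := hr.1
  rw [mul_assoc]
  congr 1
  rw [← lintegral_const_mul _ hGs]
  refine lintegral_congr fun θ => ?_
  have hnorm : ‖r • (θ : Eu n)‖ = r := by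
    rw [norm_smul, norm_unitSphere, mul_one, Real.norm_of_nonneg hr.le]
  show g ‖r • (θ : Eu n)‖ * G (r • (θ : Eu n)) = _
  rw [hnorm, hhom r hr _ (unitSphere_ne_zero θ)]

lemma ofReal_pow_mul_ofReal_inv_pow (hn : 0 < n) {r : ℝ} (hr : 0 < r) :
    ENNReal.ofReal (r ^ (n - 1)) * ENNReal.ofReal (r ^ n)⁻¹ = ENNReal.ofReal r⁻¹ := by
  rw [← ENNReal.ofReal_mul (by positivity)]
  congr 1
  obtain ⟨m, rfl⟩ : ∃ m, n = m + 1 := ⟨n - 1, by omega⟩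
  rw [Nat.add_sub_cancel, pow_succ]
  field_simp

lemma lintegral_inv_Icc {a b : ℝ} (ha : 0 < a) (hab : a ≤ b) :
    ∫⁻ r in Icc a b, ENNReal.ofReal r⁻¹ = ENNReal.ofReal (Real.log (b / a)) := by
  have hci : ContinuousOn (fun r : ℝ => r⁻¹) (Icc a b) :=
    continuousOn_id.inv₀ fun r hr => (ha.trans_le hr.1).ne'
  rw [← ofReal_integral_eq_lintegral_ofReal hci.integrableOn_Icc, integral_Icc_eq_integral_Ioc,
    ← intervalIntegral.integral_of_le hab, integral_inv_of_pos ha (ha.trans_le hab)]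
  exact (ae_restrict_iff' measurableSet_Icc).2 (ae_of_all _ fun r hr =>
    inv_nonneg.2 (ha.le.trans hr.1))

lemma lintegral_rpow_Ioc (hn : 0 < n) {b : ℝ} (hb : 0 ≤ b) :
    ∫⁻ r in Ioc 0 b, ENNReal.ofReal (r ^ (n - 1)) = ENNReal.ofReal (b ^ n / n) := by
  have hci : ContinuousOn (fun r : ℝ => r ^ (n - 1)) (Icc 0 b) := by fun_prop
  rw [← ofReal_integral_eq_lintegral_ofReal (hci.integrableOn_Icc.mono_set Ioc_subset_Icc_self),
    ← intervalIntegral.integral_of_le hb, integral_pow]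
  · congr 1
    have h1 : n - 1 + 1 = n := by omega
    have h2 : ((n - 1 : ℕ) : ℝ) + 1 = n := by exact_mod_cast h1
    rw [h1, h2, zero_pow hn.ne', sub_zero]
  · exact (ae_restrict_iff' measurableSet_Ioc).2 (ae_of_all _ fun r hr =>
      pow_nonneg hr.1.le _)

section

variable {Ω : Eu n → ℝ}

lemma enorm_omegaKernel (x : Eu n) :
    ‖omegaKernel Ω x‖ₑ = ENNReal.ofReal (‖x‖ ^ n)⁻¹ * ‖Ω x‖ₑ := by
  rw [omegaKernel, div_eq_inv_mul, enorm_mul, Real.enorm_of_nonneg (by positivity)]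

lemma lintegral_omegaKernel_annulus (hn : 0 < n) (hΩ : Measurable Ω) (hhom : HomogeneousZero Ω)
    {a b : ℝ} (ha : 0 < a) (hab : a ≤ b) :
    ∫⁻ x in {x : Eu n | a ≤ ‖x‖ ∧ ‖x‖ ≤ b}, ‖omegaKernel Ω x‖ₑ =
      ENNReal.ofReal (Real.log (b / a)) * ∫⁻ θ : unitSphere n, ‖Ω θ‖ₑ ∂sphereMeasure n := by
  have := setLIntegral_radial_mul hn (G := fun x => ‖Ω x‖ₑ) hΩ.enorm
    (fun c hc x hx => by rw [hhom c hc x hx]) (g := fun r => ENNReal.ofReal (r ^ n)⁻¹)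
    (by fun_prop) (S := Icc a b) measurableSet_Icc
  simp only [← enorm_omegaKernel] at this
  refine this.trans ?_
  congr 1
  have hsub : Icc a b ⊆ Ioi 0 := fun r hr => ha.trans_le hr.1
  rw [inter_eq_right.2 hsub, ← lintegral_inv_Icc ha hab]
  exact setLIntegral_congr_fun measurableSet_Icc fun r hr =>
    ofReal_pow_mul_ofReal_inv_pow hn (ha.trans_le hr.1)

lemma lintegral_norm_mul_omegaKernel (hn : 0 < n) (hΩ : Measurable Ω) (hhom : HomogeneousZero Ω)
    (ρ : ℝ) :
    ∫⁻ x in {x : Eu n | ‖x‖ ≤ ρ}, ‖x‖ₑ * ‖omegaKernel Ω x‖ₑ =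
      ENNReal.ofReal ρ * ∫⁻ θ : unitSphere n, ‖Ω θ‖ₑ ∂sphereMeasure n := by
  have := setLIntegral_radial_mul hn (G := fun x => ‖Ω x‖ₑ) hΩ.enorm
    (fun c hc x hx => by rw [hhom c hc x hx])
    (g := fun r => ENNReal.ofReal r * ENNReal.ofReal (r ^ n)⁻¹)
    (by fun_prop) (S := Iic ρ) measurableSet_Iic
  simp only [mul_assoc, ← enorm_omegaKernel, ofReal_norm] at this
  refine this.trans ?_
  congr 1
  rw [Ioi_inter_Iic, setLIntegral_congr_fun (g := fun _ => 1) measurableSet_Ioc, setLIntegral_one,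
    Real.volume_Ioc, sub_zero]
  intro r hr
  have hr : 0 < r := hr.1
  simp only
  rw [mul_left_comm, ofReal_pow_mul_ofReal_inv_pow hn hr, ← ENNReal.ofReal_mul hr.le,
    mul_inv_cancel₀ hr.ne', ENNReal.ofReal_one]

lemma setIntegral_omegaKernel_annulus (hn : 0 < n) (hΩ : Measurable Ω) (hhom : HomogeneousZero Ω)
    (hint : Integrable (fun θ : unitSphere n => Ω (θ : Eu n)) (sphereMeasure n))
    (hmean : ∫ θ : unitSphere n, Ω (θ : Eu n) ∂(sphereMeasure n) = 0)
    {a b : ℝ} (ha : 0 < a) :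
    ∫ x in {x : Eu n | a < ‖x‖ ∧ ‖x‖ ≤ b}, omegaKernel Ω x = 0 := by
  rcases le_or_gt a b with hab | hab
  swap
  · rw [show {x : Eu n | a < ‖x‖ ∧ ‖x‖ ≤ b} = ∅ from
      eq_empty_of_forall_notMem fun x hx => by
        have hx : a < ‖x‖ ∧ ‖x‖ ≤ b := hx
        linarith [hx.1, hx.2], setIntegral_empty]
  have hK : IntegrableOn (omegaKernel Ω) {x : Eu n | a < ‖x‖ ∧ ‖x‖ ≤ b} := by
    refine ⟨(measurable_omegaKernel hΩ).aestronglyMeasurable, ?_⟩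
    have hsub : {x : Eu n | a < ‖x‖ ∧ ‖x‖ ≤ b} ⊆ {x : Eu n | a ≤ ‖x‖ ∧ ‖x‖ ≤ b} :=
      fun x hx => ⟨hx.1.le, hx.2⟩
    refine (lintegral_mono_set hsub).trans_lt ?_
    rw [lintegral_omegaKernel_annulus hn hΩ hhom ha hab]
    exact ENNReal.mul_lt_top ENNReal.ofReal_lt_top hint.2
  have key : ∀ Φ : Eu n → ℝ, Measurable Φ → HomogeneousZero Φ →
      ∫⁻ x in {x : Eu n | a < ‖x‖ ∧ ‖x‖ ≤ b}, ENNReal.ofReal (omegaKernel Φ x) =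
      (∫⁻ r in Ioi (0 : ℝ) ∩ Ioc a b, ENNReal.ofReal (r ^ (n - 1)) * ENNReal.ofReal (r ^ n)⁻¹) *
        ∫⁻ θ : unitSphere n, ENNReal.ofReal (Φ θ) ∂sphereMeasure n := by
    intro Φ hΦ hΦh
    rw [← setLIntegral_radial_mul hn (G := fun x => ENNReal.ofReal (Φ x)) hΦ.ennreal_ofReal
      (fun c hc x hx => by rw [hΦh c hc x hx]) (g := fun r => ENNReal.ofReal (r ^ n)⁻¹)
      (by fun_prop) (S := Ioc a b) measurableSet_Ioc]
    refine lintegral_congr fun x => ?_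
    rw [← ENNReal.ofReal_mul (by positivity), omegaKernel, div_eq_inv_mul]
  have hneg : ∀ x, -omegaKernel Ω x = omegaKernel (fun x => -Ω x) x := fun x => by
    rw [omegaKernel, omegaKernel, neg_div]
  have heq : ∫⁻ θ : unitSphere n, ENNReal.ofReal (Ω θ) ∂sphereMeasure n =
      ∫⁻ θ : unitSphere n, ENNReal.ofReal (-Ω θ) ∂sphereMeasure n := by
    rw [integral_eq_lintegral_pos_part_sub_lintegral_neg_part hint, sub_eq_zero] at hmean
    refine (ENNReal.toReal_eq_toReal_iff' ?_ ?_).1 hmean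
    · exact (hint.lintegral_lt_top).ne
    · exact (hint.neg.lintegral_lt_top).ne
  rw [integral_eq_lintegral_pos_part_sub_lintegral_neg_part hK, sub_eq_zero]
  simp only [hneg]
  rw [key Ω hΩ hhom, key (fun x => -Ω x) hΩ.neg fun c hc x hx => by simp only [hhom c hc x hx],
    heq]

lemma volume_lt_abs_omegaKernel (hn : 0 < n) (hΩ : Measurable Ω) (hhom : HomogeneousZero Ω)
    {t : ℝ} (ht : 0 < t) :
    ENNReal.ofReal t * volume {x : Eu n | t < |omegaKernel Ω x|} =
      ENNReal.ofReal (1 / n) * ∫⁻ θ : unitSphere n, ‖Ω θ‖ₑ ∂sphereMeasure n := by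
  have hS : MeasurableSet {x : Eu n | t < |omegaKernel Ω x|} :=
    measurableSet_lt measurable_const (measurable_omegaKernel hΩ).abs
  have hn' : (0 : ℝ) < n := by exact_mod_cast hn
  have hΩs : Measurable fun θ : unitSphere n => Ω θ := hΩ.comp measurable_subtype_coe
  have hmem : ∀ r : ℝ, 0 < r → ∀ θ : unitSphere n,
      ({x : Eu n | t < |omegaKernel Ω x|}.indicator 1 (r • (θ : Eu n)) : ENNReal) =
      (Iio (|Ω θ| / t)).indicator 1 (r ^ n) := by
    intro r hr θ
    have : r • (θ : Eu n) ∈ {x : Eu n | t < |omegaKernel Ω x|} ↔ r ^ n ∈ Iio (|Ω θ| / t) := by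
      show t < |omegaKernel Ω (r • (θ : Eu n))| ↔ r ^ n < |Ω θ| / t
      rw [omegaKernel, hhom r hr _ (unitSphere_ne_zero θ), norm_smul, norm_unitSphere, mul_one,
        Real.norm_of_nonneg hr.le, abs_div, abs_of_pos (pow_pos hr n), lt_div_iff₀ (pow_pos hr n),
        lt_div_iff₀ ht, mul_comm]
    by_cases h : r ^ n ∈ Iio (|Ω θ| / t)
    · rw [indicator_of_mem h, indicator_of_mem (this.2 h)]; rfl
    · rw [indicator_of_notMem h, indicator_of_notMem (fun hh => h (this.1 hh))]
  have hmeas : Measurable fun p : ℝ × unitSphere n => ENNReal.ofReal (p.1 ^ (n - 1)) *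
      {x : Eu n | t < |omegaKernel Ω x|}.indicator (1 : Eu n → ENNReal) (p.1 • (p.2 : Eu n)) :=
    (by fun_prop : Measurable fun p : ℝ × unitSphere n => ENNReal.ofReal (p.1 ^ (n - 1))).mul
      ((measurable_one.indicator hS).comp (by fun_prop))
  have hinner : ∀ θ : unitSphere n, ∫⁻ r in Ioi (0 : ℝ), ENNReal.ofReal (r ^ (n - 1)) *
      {x : Eu n | t < |omegaKernel Ω x|}.indicator (1 : Eu n → ENNReal) (r • (θ : Eu n)) =
      ENNReal.ofReal (1 / (n * t)) * ‖Ω θ‖ₑ := by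
    intro θ
    set b : ℝ := (|Ω θ| / t) ^ (1 / (n : ℝ)) with hb
    have hb0 : 0 ≤ b := by positivity
    have hbn : b ^ n = |Ω θ| / t := by
      rw [hb, ← Real.rpow_natCast, ← Real.rpow_mul (by positivity), one_div_mul_cancel hn'.ne',
        Real.rpow_one]
    calc _ = ∫⁻ r in Ioi (0 : ℝ), (Iio b).indicator (fun r => ENNReal.ofReal (r ^ (n - 1))) r := by
          refine setLIntegral_congr_fun measurableSet_Ioi fun r hr => ?_
          have hr : 0 < r := hr
          rw [hmem r hr]
          have : r ^ n ∈ Iio (|Ω θ| / t) ↔ r ∈ Iio b := by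
            rw [← hbn]; exact pow_lt_pow_iff_left₀ hr.le hb0 hn.ne'
          by_cases h : r ∈ Iio b
          · rw [indicator_of_mem h, indicator_of_mem (this.2 h), Pi.one_apply, mul_one]
          · rw [indicator_of_notMem h, indicator_of_notMem (fun hh => h (this.1 hh)), mul_zero]
      _ = ∫⁻ r in Ioc 0 b, ENNReal.ofReal (r ^ (n - 1)) := by
          rw [setLIntegral_indicator measurableSet_Iio, inter_comm, Ioi_inter_Iio]
          exact setLIntegral_congr Ioo_ae_eq_Ioc
      _ = _ := by
          rw [lintegral_rpow_Ioc hn hb0, hbn, Real.enorm_eq_ofReal_abs,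
            ← ENNReal.ofReal_mul (by positivity)]
          congr 1
          field_simp
  rw [← lintegral_indicator_one hS, lintegral_polar hn (measurable_one.indicator hS)]
  calc _ = ENNReal.ofReal t * ∫⁻ r in Ioi (0 : ℝ), ∫⁻ θ : unitSphere n,
        ENNReal.ofReal (r ^ (n - 1)) *
          {x : Eu n | t < |omegaKernel Ω x|}.indicator (1 : Eu n → ENNReal) (r • (θ : Eu n))
          ∂sphereMeasure n := by
        congr 1
        refine lintegral_congr fun r => ?_
        rw [lintegral_const_mul]
        exact (measurable_one.indicator hS).comp (by fun_prop)
    _ = ENNReal.ofReal t * ∫⁻ θ : unitSphere n, ENNReal.ofReal (1 / (n * t)) * ‖Ω θ‖ₑ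
          ∂sphereMeasure n := by
        rw [lintegral_lintegral_swap hmeas.aemeasurable]
        simp only [hinner]
    _ = _ := by
        rw [lintegral_const_mul _ hΩs.enorm, ← mul_assoc, ← ENNReal.ofReal_mul ht.le]
        congr 2
        field_simp

end

end

section

variable {n : ℕ}

/-- The reflection of `z` across the line spanned by `u`, scaled by `‖u‖²`. -/
def scaledReflection (u z : Eu n) : Eu n := (2 * inner ℝ u z) • u - ‖u‖ ^ 2 • z

lemma scaledReflection_eq_smul_reflection {u : Eu n} (hu : u ≠ 0) (z : Eu n) :
    scaledReflection u z = ‖u‖ ^ 2 • (ℝ ∙ u).reflection z := by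
  have hu' : ‖u‖ ≠ 0 := norm_ne_zero_iff.2 hu
  rw [Submodule.reflection_singleton_apply, smul_sub, scaledReflection, two_smul ℕ, ← add_smul,
    smul_smul]
  congr 2
  simp only [RCLike.ofReal_real_eq_id, id]
  field_simp
  ring

lemma scaledReflection_of_norm_eq_one {e : Eu n} (he : ‖e‖ = 1) (z : Eu n) :
    scaledReflection e z = (ℝ ∙ e).reflection z := by
  rw [scaledReflection_eq_smul_reflection (by rw [← norm_ne_zero_iff, he]; exact one_ne_zero), he,
    one_pow, one_smul]

lemma scaledReflection_smul (t : ℝ) (u z : Eu n) :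
    scaledReflection (t • u) z = t ^ 2 • scaledReflection u z := by
  simp only [scaledReflection, inner_smul_left, norm_smul, smul_sub, smul_smul, mul_pow,
    Real.norm_eq_abs, sq_abs]
  congr 2
  simp
  ring

/-- Reflecting across the bisector of two unit vectors swaps them. -/
lemma scaledReflection_add {ψ z : Eu n} (hψ : ‖ψ‖ = 1) (hz : ‖z‖ = 1) :
    scaledReflection (ψ + z) z = ‖ψ + z‖ ^ 2 • ψ := by
  have h : ‖ψ + z‖ ^ 2 = 2 * inner ℝ (ψ + z) z := by
    rw [norm_add_sq_real, inner_add_left, real_inner_self_eq_norm_sq, hψ, hz]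
    ring
  rw [scaledReflection, ← h, ← smul_sub, add_sub_cancel_right]

lemma norm_scaledReflection_sub_le {z u v : Eu n} (hz : ‖z‖ = 1) (hu : ‖u‖ ≤ 2) (hv : ‖v‖ ≤ 2) :
    ‖scaledReflection u z - scaledReflection v z‖ ≤ 12 * ‖u - v‖ := by
  have h1 : scaledReflection u z - scaledReflection v z =
      (2 * inner ℝ u z) • (u - v) + (2 * inner ℝ (u - v) z) • v
        - (‖u‖ ^ 2 - ‖v‖ ^ 2) • z := by
    simp only [scaledReflection, inner_sub_left]
    module
  have a1 : |inner ℝ u z| ≤ 2 := (abs_real_inner_le_norm u z).trans (by rw [hz]; linarith)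
  have a2 : |inner ℝ (u - v) z| ≤ ‖u - v‖ :=
    (abs_real_inner_le_norm _ z).trans (by rw [hz, mul_one])
  have a3 : |‖u‖ ^ 2 - ‖v‖ ^ 2| ≤ 4 * ‖u - v‖ := by
    rw [sq_sub_sq, abs_mul, abs_of_nonneg (by positivity)]
    exact mul_le_mul (by linarith) (abs_norm_sub_norm_le u v) (abs_nonneg _) (by norm_num)
  have hd := norm_nonneg (u - v)
  rw [h1]
  refine (norm_sub_le _ _).trans ?_
  refine (add_le_add_left (norm_add_le _ _) _).trans ?_
  rw [norm_smul, norm_smul, norm_smul, hz, Real.norm_eq_abs, Real.norm_eq_abs, Real.norm_eq_abs,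
    abs_mul, abs_mul, abs_two]
  have b1 : |inner ℝ u z| * ‖u - v‖ ≤ 2 * ‖u - v‖ := mul_le_mul_of_nonneg_right a1 hd
  have b2 : |inner ℝ (u - v) z| * ‖v‖ ≤ ‖u - v‖ * 2 :=
    mul_le_mul a2 hv (norm_nonneg _) hd
  nlinarith

lemma norm_normalize_sub_le {w θ : Eu n} (hθ : ‖θ‖ = 1) (hw : w ≠ 0) :
    ‖‖w‖⁻¹ • w - θ‖ ≤ 2 * ‖w - θ‖ := by
  have hw' : ‖w‖ ≠ 0 := norm_ne_zero_iff.2 hw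
  have h1 : ‖‖w‖⁻¹ • w - w‖ ≤ ‖w - θ‖ := by
    have : ‖w‖⁻¹ • w - w = (‖w‖⁻¹ * (1 - ‖w‖)) • w := by
      rw [mul_sub, mul_one, inv_mul_cancel₀ hw', sub_smul, one_smul]
    rw [this, norm_smul, norm_mul, norm_inv, norm_norm, mul_right_comm, inv_mul_cancel₀ hw',
      one_mul, Real.norm_eq_abs, ← hθ, norm_sub_rev w θ]
    exact abs_norm_sub_norm_le θ w
  calc ‖‖w‖⁻¹ • w - θ‖ = ‖(‖w‖⁻¹ • w - w) + (w - θ)‖ := by congr 1; abel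
    _ ≤ _ := (norm_add_le _ _).trans (by linarith)

/-- Points near a unit vector `θ` are scaled reflections of `z`, the reflection of `θ` across
`e`, across vectors near `e`. -/
lemma exists_scaledReflection_eq {θ e w : Eu n} {c δ : ℝ} (hθ : ‖θ‖ = 1) (he : ‖e‖ = 1)
    (hc : 0 < c) (hce : c ≤ inner ℝ e θ) (hδ : δ < c) (hw : ‖w - θ‖ ≤ δ) :
    ∃ u : Eu n, ‖u - e‖ ≤ (1 + 2 / c) * δ ∧ scaledReflection u (scaledReflection e θ) = w := by
  have hc1 : c ≤ 1 := by
    have := real_inner_le_norm e θ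
    rw [he, hθ] at this
    linarith
  set z := scaledReflection e θ with hz_def
  have hz : ‖z‖ = 1 := by
    rw [hz_def, scaledReflection_of_norm_eq_one he, LinearIsometryEquiv.norm_map, hθ]
  have hw0 : w ≠ 0 := by
    rintro rfl
    rw [zero_sub, norm_neg, hθ] at hw
    linarith
  have hwpos : 0 < ‖w‖ := norm_pos_iff.2 hw0
  set ψ := ‖w‖⁻¹ • w with hψ_def
  have hψ : ‖ψ‖ = 1 := by
    rw [hψ_def, norm_smul, norm_inv, norm_norm, inv_mul_cancel₀ hwpos.ne']
  have hψθ : ‖ψ - θ‖ ≤ 2 * δ := (norm_normalize_sub_le hθ hw0).trans (by linarith)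
  set k : ℝ := 2 * inner ℝ e θ with hk
  have hk0 : 0 < k := by linarith
  have hv : ‖(ψ + z) - k • e‖ ≤ 2 * δ := by
    have : (ψ + z) - k • e = ψ - θ := by
      rw [hz_def, scaledReflection, he, one_pow, one_smul]; abel
    rwa [this]
  set v := ψ + z with hv_def
  have hke : ‖k • e‖ = k := by rw [norm_smul, he, mul_one, Real.norm_of_nonneg hk0.le]
  have hv0 : v ≠ 0 := by
    intro h
    rw [h, zero_sub, norm_neg, hke] at hv
    linarith
  have hvpos : 0 < ‖v‖ := norm_pos_iff.2 hv0
  have hhat : ‖‖v‖⁻¹ • v - e‖ ≤ 2 / c * δ := by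
    have h1 : ‖‖k⁻¹ • v‖⁻¹ • (k⁻¹ • v) - e‖ ≤ 2 * ‖k⁻¹ • v - e‖ :=
      norm_normalize_sub_le he (smul_ne_zero (inv_ne_zero hk0.ne') hv0)
    have h2 : ‖k⁻¹ • v‖⁻¹ • (k⁻¹ • v) = ‖v‖⁻¹ • v := by
      rw [norm_smul, smul_smul, norm_inv, Real.norm_of_nonneg hk0.le]
      congr 1
      field_simp
    have h3 : k⁻¹ • v - e = k⁻¹ • (v - k • e) := by
      rw [smul_sub, smul_smul, inv_mul_cancel₀ hk0.ne', one_smul]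
    rw [h2, h3, norm_smul, norm_inv, Real.norm_of_nonneg hk0.le] at h1
    refine h1.trans ?_
    have h4 : k⁻¹ ≤ (2 * c)⁻¹ := inv_anti₀ (by positivity) (by linarith)
    calc 2 * (k⁻¹ * ‖v - k • e‖) ≤ 2 * ((2 * c)⁻¹ * (2 * δ)) := by gcongr
      _ = 2 / c * δ := by field_simp
  refine ⟨(√‖w‖ * ‖v‖⁻¹) • v, ?_, ?_⟩
  · have h5 : |√‖w‖ - 1| ≤ δ := by
      have hs := Real.sqrt_nonneg ‖w‖
      have h6 : (√‖w‖ - 1) * (√‖w‖ + 1) = ‖w‖ - ‖θ‖ := by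
        rw [hθ]; nlinarith [Real.mul_self_sqrt hwpos.le]
      have h7 : |√‖w‖ - 1| * (√‖w‖ + 1) ≤ δ := by
        rw [← abs_of_nonneg (by positivity : 0 ≤ √‖w‖ + 1), ← abs_mul, h6]
        exact (abs_norm_sub_norm_le w θ).trans hw
      nlinarith [abs_nonneg (√‖w‖ - 1)]
    have h8 : (√‖w‖ * ‖v‖⁻¹) • v - e = (√‖w‖ - 1) • (‖v‖⁻¹ • v) + (‖v‖⁻¹ • v - e) := by
      rw [sub_smul, one_smul, smul_smul]; abel
    rw [h8]
    refine (norm_add_le _ _).trans ?_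
    rw [norm_smul, norm_smul, norm_inv, norm_norm, inv_mul_cancel₀ hvpos.ne', mul_one,
      Real.norm_eq_abs]
    linarith
  · rw [scaledReflection_smul, scaledReflection_add hψ hz, ← hv_def, smul_smul, hψ_def, smul_smul]
    have : (√‖w‖ * ‖v‖⁻¹) ^ 2 * ‖v‖ ^ 2 * ‖w‖⁻¹ = 1 := by
      rw [mul_pow, Real.sq_sqrt hwpos.le]
      field_simp
    rw [this, one_smul]

/-- Lipschitz maps increase Lebesgue measure by a bounded factor. -/
lemma volume_image_le_of_lipschitzOnWith {f : Eu n → Eu n} {L : NNReal} {s : Set (Eu n)}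
    (hf : LipschitzOnWith L f s) : volume (f '' s) ≤ (L : ENNReal) ^ n * volume s := by
  rw [← EuclideanSpace.euclideanHausdorffMeasure_eq_volume n]
  have := hf.hausdorffMeasure_image_le (d := n) (by positivity)
  rw [ENNReal.rpow_natCast] at this
  simp only [Measure.euclideanHausdorffMeasure_def, Measure.smul_apply]
  rw [ENNReal.smul_def, ENNReal.smul_def, smul_eq_mul, smul_eq_mul, mul_left_comm]
  exact mul_le_mul_right this _

lemma setLIntegral_le_of_subset_image {f : Eu n → Eu n} (hfm : Measurable f) {L : NNReal}
    {U W : Set (Eu n)} (hf : LipschitzOnWith L f U) (hW : W ⊆ f '' U)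
    (F : Eu n → ENNReal) (hF : Measurable F) :
    ∫⁻ w in W, F w ≤ (L : ENNReal) ^ n * ∫⁻ u in U, F (f u) := by
  have hle : volume.restrict W ≤ (L : ENNReal) ^ n • (volume.restrict U).map f := by
    refine Measure.le_iff.2 fun B hB => ?_
    rw [Measure.restrict_apply hB, Measure.smul_apply, Measure.map_apply hfm hB,
      Measure.restrict_apply (hfm hB), smul_eq_mul]
    have hsub : B ∩ W ⊆ f '' (f ⁻¹' B ∩ U) := by
      rintro w ⟨hwB, hwW⟩
      obtain ⟨u, hu, rfl⟩ := hW hwW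
      exact ⟨u, ⟨hwB, hu⟩, rfl⟩
    exact (measure_mono hsub).trans
      (volume_image_le_of_lipschitzOnWith (hf.mono inter_subset_right))
  refine (lintegral_mono' hle le_rfl).trans ?_
  rw [lintegral_smul_measure, lintegral_map hF hfm, smul_eq_mul]

end

section

variable {n : ℕ}

lemma lintegral_sphere_comp_isometry (hn : 0 < n) {G : Eu n → ENNReal} (hG : Measurable G)
    (hhom : ∀ c : ℝ, 0 < c → ∀ x : Eu n, x ≠ 0 → G (c • x) = G x) (ρ : Eu n ≃ₗᵢ[ℝ] Eu n) :
    ∫⁻ θ : unitSphere n, G (ρ (θ : Eu n)) ∂sphereMeasure n =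
      ∫⁻ θ : unitSphere n, G θ ∂sphereMeasure n := by
  have hn' : (0 : ℝ) < n := by exact_mod_cast hn
  have h1 := setLIntegral_radial_mul hn hG hhom (g := fun _ => 1) measurable_const
    (S := Iic 1) measurableSet_Iic
  have h2 := setLIntegral_radial_mul hn (G := fun x => G (ρ x)) (hG.comp ρ.continuous.measurable)
    (fun c hc x hx => by
      rw [map_smul]
      exact hhom c hc _ (by simpa using hx)) (g := fun _ => 1) measurable_const
    (S := Iic 1) measurableSet_Iic
  have hc : ∫⁻ r in Ioi (0 : ℝ) ∩ Iic 1, ENNReal.ofReal (r ^ (n - 1)) * 1 =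
      ENNReal.ofReal (1 / n) := by
    simp only [mul_one]
    rw [Ioi_inter_Iic, lintegral_rpow_Ioc hn zero_le_one, one_pow]
  simp only [one_mul] at h1 h2
  have h3 : ∫⁻ x in {x : Eu n | ‖x‖ ∈ Iic (1 : ℝ)}, G (ρ x) =
      ∫⁻ x in {x : Eu n | ‖x‖ ∈ Iic (1 : ℝ)}, G x := by
    have hpre : ρ ⁻¹' {x : Eu n | ‖x‖ ∈ Iic (1 : ℝ)} = {x : Eu n | ‖x‖ ∈ Iic (1 : ℝ)} := by
      ext x
      show ‖ρ x‖ ∈ Iic (1 : ℝ) ↔ ‖x‖ ∈ Iic (1 : ℝ)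
      rw [LinearIsometryEquiv.norm_map]
    have := ρ.measurePreserving.setLIntegral_comp_preimage
      (s := {x : Eu n | ‖x‖ ∈ Iic (1 : ℝ)}) (measurable_norm measurableSet_Iic) hG
    rwa [hpre] at this
  rw [h1, h2, hc] at h3
  refine (ENNReal.mul_right_inj ?_ ENNReal.ofReal_ne_top).1 h3
  exact (ENNReal.ofReal_pos.2 (by positivity)).ne'

variable {Ω : Eu n → ℝ}

lemma lintegral_sphere_rotation_sub_le (hn : 0 < n) (hΩ : Measurable Ω) (hhom : HomogeneousZero Ω)
    (ρ : Eu n ≃ₗᵢ[ℝ] Eu n) :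
    ∫⁻ θ : unitSphere n, ‖Ω (ρ (θ : Eu n)) - Ω θ‖ₑ ∂sphereMeasure n ≤
      2 * ∫⁻ θ : unitSphere n, ‖Ω θ‖ₑ ∂sphereMeasure n := by
  have hm : Measurable fun θ : unitSphere n => ‖Ω (ρ (θ : Eu n))‖ₑ :=
    (hΩ.comp (ρ.continuous.measurable.comp measurable_subtype_coe)).enorm
  calc _ ≤ ∫⁻ θ : unitSphere n, ‖Ω (ρ (θ : Eu n))‖ₑ + ‖Ω θ‖ₑ ∂sphereMeasure n :=
        lintegral_mono fun θ => enorm_sub_le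
    _ = _ := by
        rw [lintegral_add_left hm, lintegral_sphere_comp_isometry hn (G := fun x => ‖Ω x‖ₑ) hΩ.enorm
          (fun c hc x hx => by rw [hhom c hc x hx]), two_mul]

lemma lintegral_sphere_rotation_sub_le_omegaRot (hn : 0 < n) (hΩ : Measurable Ω)
    (hhom : HomogeneousZero Ω)
    (hint : Integrable (fun θ : unitSphere n => Ω (θ : Eu n)) (sphereMeasure n))
    {δ : ℝ} (ρ : Eu n ≃ₗᵢ[ℝ] Eu n)
    (hdet : LinearMap.det (ρ.toLinearEquiv : Eu n →ₗ[ℝ] Eu n) = 1)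
    (hρ : ∀ x : Eu n, ‖x‖ = 1 → ‖ρ x - x‖ ≤ δ) :
    ∫⁻ θ : unitSphere n, ‖Ω (ρ (θ : Eu n)) - Ω θ‖ₑ ∂sphereMeasure n ≤
      ENNReal.ofReal (omegaRot n Ω δ) := by
  have hfin : 2 * ∫⁻ θ : unitSphere n, ‖Ω θ‖ₑ ∂sphereMeasure n < ⊤ :=
    ENNReal.mul_lt_top (by simp) hint.2
  have hm : ∀ τ : Eu n ≃ₗᵢ[ℝ] Eu n, Measurable fun θ : unitSphere n => Ω (τ (θ : Eu n)) - Ω θ :=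
    fun τ => (hΩ.comp (τ.continuous.measurable.comp measurable_subtype_coe)).sub
      (hΩ.comp measurable_subtype_coe)
  have heq : ∀ τ : Eu n ≃ₗᵢ[ℝ] Eu n,
      ∫ θ : unitSphere n, |Ω (τ (θ : Eu n)) - Ω θ| ∂sphereMeasure n =
      (∫⁻ θ : unitSphere n, ‖Ω (τ (θ : Eu n)) - Ω θ‖ₑ ∂sphereMeasure n).toReal := by
    intro τ
    exact integral_norm_eq_lintegral_enorm (hm τ).aestronglyMeasurable
  have hbdd : BddAbove {I : ℝ | ∃ ρ : Eu n ≃ₗᵢ[ℝ] Eu n,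
      LinearMap.det (ρ.toLinearEquiv : Eu n →ₗ[ℝ] Eu n) = 1 ∧
      (∀ x : Eu n, ‖x‖ = 1 → ‖ρ x - x‖ ≤ δ) ∧
      I = ∫ θ : unitSphere n, |Ω (ρ (θ : Eu n)) - Ω (θ : Eu n)| ∂(sphereMeasure n)} := by
    refine ⟨(2 * ∫⁻ θ : unitSphere n, ‖Ω θ‖ₑ ∂sphereMeasure n).toReal, ?_⟩
    rintro I ⟨τ, -, -, rfl⟩
    rw [heq]
    exact ENNReal.toReal_mono hfin.ne (lintegral_sphere_rotation_sub_le hn hΩ hhom τ)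
  rw [← ENNReal.ofReal_toReal ((lintegral_sphere_rotation_sub_le hn hΩ hhom ρ).trans_lt hfin).ne]
  refine ENNReal.ofReal_le_ofReal (le_csSup hbdd ⟨ρ, hdet, hρ, (heq ρ).symm⟩)

lemma det_reflection_trans_reflection {u e : Eu n} (hu : u ≠ 0) (he : e ≠ 0) :
    LinearMap.det (((ℝ ∙ e).reflection.trans (ℝ ∙ u).reflection).toLinearEquiv :
      Eu n →ₗ[ℝ] Eu n) = 1 := by
  have h : (((ℝ ∙ e).reflection.trans (ℝ ∙ u).reflection).toLinearEquiv : Eu n →ₗ[ℝ] Eu n) =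
      (ℝ ∙ u).reflection.toLinearMap ∘ₗ (ℝ ∙ e).reflection.toLinearMap := rfl
  rw [h, LinearMap.det_comp, Submodule.det_reflection, Submodule.det_reflection, ← pow_add]
  have h1 := (ℝ ∙ u).finrank_add_finrank_orthogonal
  have h2 := (ℝ ∙ e).finrank_add_finrank_orthogonal
  rw [finrank_span_singleton hu] at h1
  rw [finrank_span_singleton he] at h2
  exact Even.neg_one_pow ⟨Module.finrank ℝ (ℝ ∙ u)ᗮ, by omega⟩

lemma norm_reflection_reflection_sub_le {u e : Eu n} (hu : u ≠ 0) (he : ‖e‖ = 1) {x : Eu n}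
    (hx : ‖x‖ = 1) :
    ‖(ℝ ∙ e).reflection.trans (ℝ ∙ u).reflection x - x‖ ≤ 8 * ‖u - e‖ := by
  set y := (ℝ ∙ e).reflection x with hy
  have hy1 : ‖y‖ = 1 := by rw [hy, LinearIsometryEquiv.norm_map, hx]
  have hxy : x = scaledReflection e y := by
    rw [scaledReflection_of_norm_eq_one he, hy, Submodule.reflection_reflection]
  set v := ‖u‖⁻¹ • u with hv
  have hu' : ‖u‖ ≠ 0 := norm_ne_zero_iff.2 hu
  have hv1 : ‖v‖ = 1 := by rw [hv, norm_smul, norm_inv, norm_norm, inv_mul_cancel₀ hu']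
  have huy : (ℝ ∙ e).reflection.trans (ℝ ∙ u).reflection x = scaledReflection v y := by
    rw [LinearIsometryEquiv.trans_apply, ← hy, hv, scaledReflection_smul,
      scaledReflection_eq_smul_reflection hu, smul_smul, ← mul_pow, inv_mul_cancel₀ hu', one_pow,
      one_smul]
  have hve : ‖v - e‖ ≤ 2 * ‖u - e‖ := norm_normalize_sub_le he hu
  have hdecomp : scaledReflection v y - scaledReflection e y =
      (2 * inner ℝ v y) • (v - e) + (2 * inner ℝ (v - e) y) • e := by
    simp only [scaledReflection, inner_sub_left, hv1, he]
    module
  have a1 : |inner ℝ v y| ≤ 1 := (abs_real_inner_le_norm v y).trans (by rw [hv1, hy1, mul_one])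
  have a2 : |inner ℝ (v - e) y| ≤ ‖v - e‖ :=
    (abs_real_inner_le_norm _ y).trans (by rw [hy1, mul_one])
  have huy' : ‖(ℝ ∙ e).reflection.trans (ℝ ∙ u).reflection x - x‖ =
      ‖scaledReflection v y - scaledReflection e y‖ := by rw [huy, ← hxy]
  rw [huy', hdecomp]
  refine (norm_add_le _ _).trans ?_
  rw [norm_smul, norm_smul, he, mul_one, Real.norm_eq_abs, Real.norm_eq_abs, abs_mul, abs_mul,
    abs_two]
  nlinarith [mul_le_mul_of_nonneg_right a1 (norm_nonneg (v - e))]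

end

section

variable {n : ℕ}

variable {Ω : Eu n → ℝ}

lemma lintegral_cap_translation_le (hn : 0 < n) (hΩ : Measurable Ω) (hhom : HomogeneousZero Ω)
    (hint : Integrable (fun θ : unitSphere n => Ω (θ : Eu n)) (sphereMeasure n))
    {e : Eu n} (he : ‖e‖ = 1) {c δ : ℝ} (hc : 0 < c) (hδc : δ < c)
    (hr : (1 + 2 / c) * δ < 1) :
    ∫⁻ θ in {θ : unitSphere n | c ≤ inner ℝ e (θ : Eu n)},
        (∫⁻ w in Metric.closedBall (θ : Eu n) δ, ‖Ω w - Ω θ‖ₑ) ∂sphereMeasure n ≤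
      12 ^ n * volume (Metric.closedBall (0 : Eu n) ((1 + 2 / c) * δ)) *
        ENNReal.ofReal (omegaRot n Ω (8 * ((1 + 2 / c) * δ))) := by
  set r := (1 + 2 / c) * δ with hr_def
  set U := Metric.closedBall e r with hU
  have he0 : e ≠ 0 := by rw [← norm_ne_zero_iff, he]; exact one_ne_zero
  have hU2 : ∀ u ∈ U, ‖u‖ ≤ 2 := fun u hu => by
    have h1 : ‖u - e‖ ≤ r := mem_closedBall_iff_norm.1 hu
    have h2 := norm_sub_norm_le u e
    linarith
  have hU0 : ∀ u ∈ U, u ≠ 0 := by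
    rintro u hu rfl
    have h1 : ‖(0 : Eu n) - e‖ ≤ r := mem_closedBall_iff_norm.1 hu
    rw [zero_sub, norm_neg, he] at h1
    linarith
  have hqc : Continuous fun p : unitSphere n × Eu n => scaledReflection p.2 (scaledReflection e p.1) := by
    unfold scaledReflection
    fun_prop
  obtain ⟨q, hq⟩ : ∃ q : unitSphere n → Eu n → Eu n,
      ∀ θ u, q θ u = scaledReflection u (scaledReflection e θ) := ⟨_, fun _ _ => rfl⟩
  simp only [← hq] at hqc
  have hz : ∀ θ : unitSphere n, ‖scaledReflection e (θ : Eu n)‖ = 1 := fun θ => by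
    rw [scaledReflection_of_norm_eq_one he, LinearIsometryEquiv.norm_map, norm_unitSphere]
  have hΩs : Measurable fun θ : unitSphere n => Ω θ := hΩ.comp measurable_subtype_coe
  have hjoint : Measurable fun p : unitSphere n × Eu n => ‖Ω (q p.1 p.2) - Ω p.1‖ₑ :=
    ((hΩ.comp hqc.measurable).sub (hΩs.comp measurable_fst)).enorm
  have hS : MeasurableSet {θ : unitSphere n | c ≤ inner ℝ e (θ : Eu n)} :=
    measurableSet_le measurable_const (by fun_prop)
  have hΩq : ∀ θ : unitSphere n, ∀ u ∈ U,
      Ω (q θ u) = Ω ((ℝ ∙ e).reflection.trans (ℝ ∙ u).reflection (θ : Eu n)) := by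
    intro θ u hu
    have hu0 := hU0 u hu
    rw [hq, LinearIsometryEquiv.trans_apply, ← scaledReflection_of_norm_eq_one he]
    rw [scaledReflection_eq_smul_reflection hu0]
    refine hhom _ (by positivity) _ ?_
    rw [← norm_ne_zero_iff, LinearIsometryEquiv.norm_map, hz]
    exact one_ne_zero
  calc _ ≤ ∫⁻ θ in {θ : unitSphere n | c ≤ inner ℝ e (θ : Eu n)},
        12 ^ n * (∫⁻ u in U, ‖Ω (q θ u) - Ω θ‖ₑ) ∂sphereMeasure n := by
        refine setLIntegral_mono' hS fun θ hθ => ?_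
        have hqθ : Measurable (q θ) := (hqc.comp (Continuous.prodMk_right θ)).measurable
        have := setLIntegral_le_of_subset_image (f := q θ) (L := 12) (U := U)
          (W := Metric.closedBall (θ : Eu n) δ) hqθ ?_ ?_ (fun w => ‖Ω w - Ω θ‖ₑ)
          (hΩ.sub measurable_const).enorm
        · exact this
        · refine LipschitzOnWith.of_dist_le_mul fun u hu v hv => ?_
          rw [dist_eq_norm, dist_eq_norm]
          rw [hq, hq]
          exact norm_scaledReflection_sub_le (hz θ) (hU2 u hu) (hU2 v hv)
        · intro w hw
          obtain ⟨u, hu, huw⟩ := exists_scaledReflection_eq (norm_unitSphere θ) he hc hθ hδc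
            (mem_closedBall_iff_norm.1 hw)
          exact ⟨u, mem_closedBall_iff_norm.2 hu, (hq θ u).trans huw⟩
    _ ≤ ∫⁻ θ : unitSphere n, 12 ^ n * (∫⁻ u in U, ‖Ω (q θ u) - Ω θ‖ₑ) ∂sphereMeasure n :=
        setLIntegral_le_lintegral _ _
    _ = 12 ^ n * ∫⁻ u in U, (∫⁻ θ : unitSphere n, ‖Ω (q θ u) - Ω θ‖ₑ ∂sphereMeasure n) := by
        rw [lintegral_const_mul _ hjoint.lintegral_prod_right',
          lintegral_lintegral_swap hjoint.aemeasurable]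
    _ ≤ 12 ^ n * ∫⁻ _ in U, ENNReal.ofReal (omegaRot n Ω (8 * r)) := by
        refine mul_le_mul_right ?_ _
        refine setLIntegral_mono' Metric.isClosed_closedBall.measurableSet fun u hu => ?_
        have hu0 := hU0 u hu
        simp only [hΩq _ u hu]
        refine lintegral_sphere_rotation_sub_le_omegaRot hn hΩ hhom hint _
          (det_reflection_trans_reflection hu0 he0) fun x hx => ?_
        refine (norm_reflection_reflection_sub_le hu0 he hx).trans ?_
        have h1 : ‖u - e‖ ≤ r := mem_closedBall_iff_norm.1 hu
        linarith
    _ = _ := by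
        rw [setLIntegral_const, mul_assoc, mul_comm (ENNReal.ofReal _), hU,
          Measure.addHaar_closedBall_center]

/-- The signed coordinate directions. -/
def signedBasis (i : Fin n × Bool) : Eu n :=
  (if i.2 then (1 : ℝ) else -1) • EuclideanSpace.single i.1 1

lemma norm_signedBasis (i : Fin n × Bool) : ‖signedBasis i‖ = 1 := by
  unfold signedBasis
  split_ifs <;> simp

lemma exists_le_inner_signedBasis (hn : 0 < n) {θ : Eu n} (hθ : ‖θ‖ = 1) :
    ∃ i : Fin n × Bool, 1 / (n : ℝ) ≤ inner ℝ (signedBasis i) θ := by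
  have hn' : (1 : ℝ) ≤ n := by exact_mod_cast hn
  by_contra! h
  have habs : ∀ i, |θ i| ≤ 1 / n := fun i => by
    have h1 := h (i, true)
    have h2 := h (i, false)
    simp [signedBasis, EuclideanSpace.inner_single_left] at h1 h2
    rw [abs_le, one_div]
    constructor <;> linarith
  have hlt : ∀ i, θ i ^ 2 < 1 / n := fun i => by
    have h1 := h (i, true)
    have h2 := h (i, false)
    simp [signedBasis, EuclideanSpace.inner_single_left] at h1 h2
    have h3 : |θ i| < 1 / n := by
      rw [abs_lt, one_div]
      constructor <;> linarith
    have h4 : (1 : ℝ) / n ≤ 1 := by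
      rw [div_le_one (by linarith)]; exact hn'
    rw [← sq_abs]
    nlinarith [abs_nonneg (θ i)]
  have hsum : ∑ i, θ i ^ 2 = 1 := by
    have := EuclideanSpace.norm_sq_eq θ
    rw [hθ] at this
    simpa using this.symm
  have hlt2 : ∑ i, θ i ^ 2 < ∑ _i : Fin n, 1 / (n : ℝ) :=
    Finset.sum_lt_sum_of_nonempty ⟨⟨0, hn⟩, Finset.mem_univ _⟩ fun i _ => hlt i
  rw [hsum, Finset.sum_const, Finset.card_univ, Fintype.card_fin, nsmul_eq_mul,
    mul_one_div_cancel (by linarith)] at hlt2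
  exact lt_irrefl _ hlt2

/-- The constant in the comparison of averaged translations with rotations. -/
def translationConst (n : ℕ) : ENNReal :=
  (Fintype.card (Fin n × Bool) : ENNReal) * (12 ^ n * (ENNReal.ofReal ((1 + 2 * n) ^ n) *
    volume (Metric.ball (0 : Eu n) 1)))

lemma translationConst_ne_top : translationConst n ≠ ⊤ := by
  unfold translationConst
  exact ENNReal.mul_ne_top (ENNReal.natCast_ne_top _) (ENNReal.mul_ne_top (by simp)
    (ENNReal.mul_ne_top (by simp) measure_ball_lt_top.ne))

/-- Averaged translations on the sphere are controlled by the rotational modulus. -/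
lemma lintegral_sphere_translation_le (hn : 0 < n) (hΩ : Measurable Ω) (hhom : HomogeneousZero Ω)
    (hint : Integrable (fun θ : unitSphere n => Ω (θ : Eu n)) (sphereMeasure n))
    {δ : ℝ} (hδ0 : 0 ≤ δ) (hδ : (1 + 2 * n) * δ < 1) :
    ∫⁻ θ : unitSphere n,
        (∫⁻ w in Metric.closedBall (θ : Eu n) δ, ‖Ω w - Ω θ‖ₑ) ∂sphereMeasure n ≤
      translationConst n * ENNReal.ofReal (δ ^ n) *
        ENNReal.ofReal (omegaRot n Ω (8 * ((1 + 2 * n) * δ))) := by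
  have hn' : (1 : ℝ) ≤ n := by exact_mod_cast hn
  have hc : (0 : ℝ) < 1 / n := by positivity
  have hdiv : 1 + 2 / (1 / (n : ℝ)) = 1 + 2 * n := by field_simp
  have hδc : δ < 1 / n := by
    rw [lt_div_iff₀ (by linarith)]
    nlinarith
  have hcover : (univ : Set (unitSphere n)) ⊆
      ⋃ i : Fin n × Bool, {θ : unitSphere n | 1 / (n : ℝ) ≤ inner ℝ (signedBasis i) (θ : Eu n)} := by
    intro θ _
    obtain ⟨i, hi⟩ := exists_le_inner_signedBasis hn (norm_unitSphere θ)
    exact mem_iUnion.2 ⟨i, hi⟩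
  rw [← setLIntegral_univ]
  refine (lintegral_mono_set hcover).trans ?_
  refine (lintegral_iUnion_le _ _).trans ?_
  rw [tsum_fintype]
  refine (Finset.sum_le_sum fun i _ => lintegral_cap_translation_le hn hΩ hhom hint
    (norm_signedBasis i) hc hδc (by rwa [hdiv])).trans ?_
  rw [Finset.sum_const, Finset.card_univ, nsmul_eq_mul, hdiv,
    Measure.addHaar_closedBall volume (0 : Eu n) (r := (1 + 2 * n) * δ) (by positivity),
    finrank_euclideanSpace_fin, mul_pow, ENNReal.ofReal_mul (by positivity), translationConst]
  refine le_of_eq ?_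
  ring

end

section

variable {n : ℕ}

lemma lintegral_comp_smul_pos {r : ℝ} (hr : 0 < r) {G : Eu n → ENNReal} (hG : Measurable G) :
    ∫⁻ w, G w = ENNReal.ofReal (r ^ n) * ∫⁻ w, G (r • w) := by
  have h := Measure.map_addHaar_smul (volume : Measure (Eu n)) hr.ne'
  rw [finrank_euclideanSpace_fin, abs_of_pos (by positivity)] at h
  rw [← lintegral_map hG (measurable_const_smul r), h, lintegral_smul_measure, smul_eq_mul,
    ← mul_assoc, ← ENNReal.ofReal_mul (by positivity), mul_inv_cancel₀ (by positivity),
    ENNReal.ofReal_one, one_mul]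

lemma setLIntegral_closedBall_smul {r : ℝ} (hr : 0 < r) {G : Eu n → ENNReal} (hG : Measurable G)
    (x : Eu n) (s : ℝ) :
    ∫⁻ w in Metric.closedBall (r • x) s, G w =
      ENNReal.ofReal (r ^ n) * ∫⁻ w in Metric.closedBall x (s / r), G (r • w) := by
  rw [← lintegral_indicator Metric.isClosed_closedBall.measurableSet,
    lintegral_comp_smul_pos hr (hG.indicator Metric.isClosed_closedBall.measurableSet),
    ← lintegral_indicator Metric.isClosed_closedBall.measurableSet]
  congr 1
  refine lintegral_congr fun w => ?_
  have : r • w ∈ Metric.closedBall (r • x) s ↔ w ∈ Metric.closedBall x (s / r) := by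
    rw [mem_closedBall_iff_norm, mem_closedBall_iff_norm, ← smul_sub, norm_smul,
      Real.norm_of_nonneg hr.le, le_div_iff₀ hr, mul_comm]
  by_cases h : w ∈ Metric.closedBall x (s / r)
  · rw [indicator_of_mem h, indicator_of_mem (this.2 h)]
  · rw [indicator_of_notMem h, indicator_of_notMem fun hh => h (this.1 hh)]

lemma measurable_setLIntegral_closedBall {F : Eu n → Eu n → ENNReal}
    (hF : Measurable (Function.uncurry F)) (s : ℝ) :
    Measurable fun x => ∫⁻ w in Metric.closedBall x s, F x w := by
  have hS : MeasurableSet {p : Eu n × Eu n | dist p.2 p.1 ≤ s} :=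
    measurableSet_le (by fun_prop) measurable_const
  have := Measurable.lintegral_prod_right' (ν := (volume : Measure (Eu n))) (hF.indicator hS)
  convert this using 2 with x
  rw [← lintegral_indicator Metric.isClosed_closedBall.measurableSet]
  refine lintegral_congr fun w => ?_
  by_cases h : w ∈ Metric.closedBall x s
  · rw [indicator_of_mem h, indicator_of_mem (show (x, w) ∈ {p : Eu n × Eu n | dist p.2 p.1 ≤ s}
      from h)]
    rfl
  · rw [indicator_of_notMem h, indicator_of_notMem (show (x, w) ∉
      {p : Eu n × Eu n | dist p.2 p.1 ≤ s} from h)]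

/-- Inverting the radial variable in the Dini integral. -/
lemma lintegral_Ioi_inv_mul_comp_div {a R : ℝ} (ha : 0 < a) (hR : 0 < R) (ω : ℝ → ℝ) :
    ∫⁻ r in Ioi R, ENNReal.ofReal r⁻¹ * ENNReal.ofReal (ω (a / r)) =
      ∫⁻ t in Ioo 0 (a / R), ENNReal.ofReal (ω t / t) := by
  have himg : (fun t => a / t) '' Ioo 0 (a / R) = Ioi R := by
    ext r
    constructor
    · rintro ⟨t, ⟨ht0, ht⟩, rfl⟩
      show R < a / t
      rw [lt_div_iff₀ ht0, mul_comm]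
      exact (lt_div_iff₀ hR).1 ht
    · intro hr
      have hr : R < r := hr
      have hr0 : 0 < r := hR.trans hr
      refine ⟨a / r, ⟨by positivity, div_lt_div_of_pos_left ha hR hr⟩, ?_⟩
      simp only
      field_simp
  rw [← himg, lintegral_image_eq_lintegral_abs_deriv_mul (f' := fun t => -(a / t ^ 2))
    measurableSet_Ioo]
  · refine setLIntegral_congr_fun measurableSet_Ioo fun t ht => ?_
    have ht0 : 0 < t := ht.1
    rw [← ENNReal.ofReal_mul (by positivity), ← ENNReal.ofReal_mul (abs_nonneg _), abs_neg,
      abs_of_pos (by positivity), div_div_cancel₀ ha.ne']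
    congr 1
    field_simp
  · intro t ht
    have ht0 : t ≠ 0 := ht.1.ne'
    have h := (((hasDerivAt_inv ht0).const_mul a).congr_deriv
      (show a * -(t ^ 2)⁻¹ = -(a / t ^ 2) by ring)).hasDerivWithinAt (s := Ioo 0 (a / R))
    simp only [div_eq_mul_inv] at h ⊢
    exact h
  · intro t ht t' ht' h
    have h0 : t ≠ 0 := ht.1.ne'
    have h0' : t' ≠ 0 := ht'.1.ne'
    have h : a / t = a / t' := h
    field_simp at h
    exact h.symm

lemma lintegral_Ioi_inv_sq {R : ℝ} (hR : 0 < R) :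
    ∫⁻ r in Ioi R, ENNReal.ofReal (r ^ 2)⁻¹ = ENNReal.ofReal R⁻¹ := by
  have h := lintegral_Ioi_inv_mul_comp_div one_pos hR (fun t => t)
  have h1 : ∫⁻ r in Ioi R, ENNReal.ofReal (r ^ 2)⁻¹ =
      ∫⁻ r in Ioi R, ENNReal.ofReal r⁻¹ * ENNReal.ofReal (1 / r) := by
    refine setLIntegral_congr_fun measurableSet_Ioi fun r hr => ?_
    have hr : 0 < r := hR.trans hr
    rw [← ENNReal.ofReal_mul (by positivity)]
    congr 1
    field_simp
  rw [h1, h, setLIntegral_congr_fun (g := fun _ => 1) measurableSet_Ioo, setLIntegral_one,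
    Real.volume_Ioo, sub_zero, one_div]
  intro t ht
  have ht0 : t ≠ 0 := ht.1.ne'
  simp only
  rw [div_self ht0, ENNReal.ofReal_one]

end

section

variable {n : ℕ}

lemma abs_inv_pow_sub_inv_pow_le (hn : 0 < n) {a b s : ℝ} (hb : 0 < b) (ha : b / 2 ≤ a)
    (ha2 : a ≤ 2 * b) (hab : |a - b| ≤ s) :
    |(a ^ n)⁻¹ - (b ^ n)⁻¹| ≤ n * 4 ^ n * s * (b ^ (n + 1))⁻¹ := by
  have ha0 : 0 < a := by linarith
  have hs : 0 ≤ s := (abs_nonneg _).trans hab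
  have h1 : |a ^ n - b ^ n| ≤ s * n * (2 * b) ^ (n - 1) := by
    refine (abs_pow_sub_pow_le a b n).trans ?_
    rw [abs_of_pos ha0, abs_of_pos hb]
    gcongr
    exact max_le ha2 (by linarith)
  have h2 : (b / 2) ^ n ≤ a ^ n := pow_le_pow_left₀ (by positivity) ha n
  have h3 : (a ^ n)⁻¹ - (b ^ n)⁻¹ = (b ^ n - a ^ n) * ((a ^ n)⁻¹ * (b ^ n)⁻¹) := by
    field_simp
  rw [h3, abs_mul, abs_sub_comm, abs_of_pos (by positivity : 0 < (a ^ n)⁻¹ * (b ^ n)⁻¹)]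
  calc _ ≤ (s * n * (2 * b) ^ (n - 1)) * (((b / 2) ^ n)⁻¹ * (b ^ n)⁻¹) := by gcongr
    _ ≤ _ := by
      obtain ⟨m, rfl⟩ : ∃ m, n = m + 1 := ⟨n - 1, by omega⟩
      rw [Nat.add_sub_cancel]
      have h4 : (s * ((m + 1 : ℕ) : ℝ) * (2 * b) ^ m) * (((b / 2) ^ (m + 1))⁻¹ * (b ^ (m + 1))⁻¹) =
          s * ((m + 1 : ℕ) : ℝ) * (2 ^ m * 2 ^ (m + 1)) * (b ^ (m + 1 + 1))⁻¹ := by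
        rw [mul_pow, div_pow]
        field_simp
        ring
      have h5 : (2 : ℝ) ^ m * 2 ^ (m + 1) ≤ 4 ^ (m + 1) := by
        rw [show (4 : ℝ) = 2 * 2 by norm_num, mul_pow]
        gcongr <;> norm_num
      rw [h4]
      calc _ ≤ s * ((m + 1 : ℕ) : ℝ) * 4 ^ (m + 1) * (b ^ (m + 1 + 1))⁻¹ := by gcongr
        _ = _ := by ring

variable {Ω : Eu n → ℝ}

lemma enorm_omegaKernel_sub_le (hn : 0 < n) {x w : Eu n} {s : ℝ} (hx : 0 < ‖x‖)
    (hs : s ≤ ‖x‖ / 2) (hw : ‖w - x‖ ≤ s) :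
    ‖omegaKernel Ω w - omegaKernel Ω x‖ₑ ≤
      ENNReal.ofReal (2 ^ n * (‖x‖ ^ n)⁻¹) * ‖Ω w - Ω x‖ₑ +
      ENNReal.ofReal (n * 4 ^ n * s * (‖x‖ ^ (n + 1))⁻¹) * ‖Ω x‖ₑ := by
  have hd : |‖w‖ - ‖x‖| ≤ s := (abs_norm_sub_norm_le w x).trans hw
  have hd' := abs_le.1 hd
  have hw1 : ‖x‖ / 2 ≤ ‖w‖ := by linarith [hd'.1]
  have hw2 : ‖w‖ ≤ 2 * ‖x‖ := by linarith [hd'.2]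
  have hw0 : 0 < ‖w‖ := by linarith
  have hdecomp : omegaKernel Ω w - omegaKernel Ω x =
      (‖w‖ ^ n)⁻¹ * (Ω w - Ω x) + ((‖w‖ ^ n)⁻¹ - (‖x‖ ^ n)⁻¹) * Ω x := by
    rw [omegaKernel, omegaKernel]; ring
  rw [hdecomp]
  refine (enorm_add_le _ _).trans ?_
  rw [enorm_mul, enorm_mul, Real.enorm_eq_ofReal_abs ((‖w‖ ^ n)⁻¹),
    Real.enorm_eq_ofReal_abs ((‖w‖ ^ n)⁻¹ - (‖x‖ ^ n)⁻¹)]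
  refine add_le_add (mul_le_mul_left (ENNReal.ofReal_le_ofReal ?_) _)
    (mul_le_mul_left (ENNReal.ofReal_le_ofReal ?_) _)
  · rw [abs_of_pos (by positivity)]
    calc (‖w‖ ^ n)⁻¹ ≤ ((‖x‖ / 2) ^ n)⁻¹ := by gcongr
      _ = 2 ^ n * (‖x‖ ^ n)⁻¹ := by rw [div_pow, inv_div, div_eq_mul_inv]
  · exact abs_inv_pow_sub_inv_pow_le hn hx hw1 hw2 hd

/-- Oscillation of the rough part of the kernel outside a ball. -/
lemma lintegral_oscillation_le (hn : 0 < n) (hΩ : Measurable Ω) (hhom : HomogeneousZero Ω)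
    (hint : Integrable (fun θ : unitSphere n => Ω (θ : Eu n)) (sphereMeasure n))
    {s R : ℝ} (hs : 0 < s) (hR : (1 + 2 * n) * s < R) :
    ∫⁻ x in {x : Eu n | ‖x‖ ∈ Ioi R}, (ENNReal.ofReal (2 ^ n * (‖x‖ ^ n)⁻¹) *
        ∫⁻ w in Metric.closedBall x s, ‖Ω w - Ω x‖ₑ) ≤
      ENNReal.ofReal (s ^ n) * (ENNReal.ofReal (2 ^ n) * translationConst n *
        ∫⁻ t in Ioo 0 (8 * (1 + 2 * n) * s / R), ENNReal.ofReal (omegaRot n Ω t / t)) := by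
  have hR0 : 0 < R := lt_of_le_of_lt (by positivity) hR
  have : NeZero n := ⟨hn.ne'⟩
  have : Nontrivial (Eu n) := inferInstance
  have ha : 0 < 8 * (1 + 2 * (n : ℝ)) * s := by positivity
  have hH : Measurable fun x : Eu n => ∫⁻ w in Metric.closedBall x s, ‖Ω w - Ω x‖ₑ :=
    measurable_setLIntegral_closedBall (F := fun x w => ‖Ω w - Ω x‖ₑ)
      ((hΩ.comp measurable_snd).sub (hΩ.comp measurable_fst)).enorm s
  have hm : Measurable fun x : Eu n => ENNReal.ofReal (2 ^ n * (‖x‖ ^ n)⁻¹) *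
      ∫⁻ w in Metric.closedBall x s, ‖Ω w - Ω x‖ₑ :=
    (by fun_prop : Measurable fun x : Eu n => ENNReal.ofReal (2 ^ n * (‖x‖ ^ n)⁻¹)).mul hH
  rw [setLIntegral_polar hn hm measurableSet_Ioi, inter_eq_right.2 (Ioi_subset_Ioi hR0.le)]
  rw [← lintegral_Ioi_inv_mul_comp_div ha hR0, ← mul_assoc,
    ← lintegral_const_mul' _ _ (ENNReal.mul_ne_top ENNReal.ofReal_ne_top
      (ENNReal.mul_ne_top ENNReal.ofReal_ne_top translationConst_ne_top))]
  refine setLIntegral_mono' measurableSet_Ioi fun r hr => ?_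
  have hr : R < r := hr
  have hr0 : 0 < r := hR0.trans hr
  have hscale : ∀ θ : unitSphere n,
      ∫⁻ w in Metric.closedBall (r • (θ : Eu n)) s, ‖Ω w - Ω (r • (θ : Eu n))‖ₑ =
      ENNReal.ofReal (r ^ n) * ∫⁻ w in Metric.closedBall (θ : Eu n) (s / r), ‖Ω w - Ω θ‖ₑ := by
    intro θ
    rw [setLIntegral_closedBall_smul (G := fun w => ‖Ω w - Ω (r • (θ : Eu n))‖ₑ) hr0
      (hΩ.sub measurable_const).enorm]
    congr 1
    rw [hhom r hr0 _ (unitSphere_ne_zero θ)]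
    refine lintegral_congr_ae (ae_restrict_of_ae ?_)
    filter_upwards [Measure.ae_ne volume (0 : Eu n)] with w hw
    rw [hhom r hr0 _ hw]
  have hnorm : ∀ θ : unitSphere n, ‖r • (θ : Eu n)‖ = r := fun θ => by
    rw [norm_smul, norm_unitSphere, mul_one, Real.norm_of_nonneg hr0.le]
  simp only [hscale, hnorm]
  have hH' : Measurable fun θ : unitSphere n =>
      ∫⁻ w in Metric.closedBall (θ : Eu n) (s / r), ‖Ω w - Ω θ‖ₑ :=
    (measurable_setLIntegral_closedBall (F := fun x w => ‖Ω w - Ω x‖ₑ)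
      ((hΩ.comp measurable_snd).sub (hΩ.comp measurable_fst)).enorm (s / r)).comp
        measurable_subtype_coe
  rw [lintegral_const_mul _ (hH'.const_mul _), lintegral_const_mul _ hH']
  have hδ : (1 + 2 * (n : ℝ)) * (s / r) < 1 := by
    rw [← mul_div_assoc, div_lt_one hr0]
    exact hR.trans hr
  have hkey := lintegral_sphere_translation_le hn hΩ hhom hint (by positivity : 0 ≤ s / r) hδ
  have harg : 8 * ((1 + 2 * (n : ℝ)) * (s / r)) = 8 * (1 + 2 * n) * s / r := by ring
  rw [harg] at hkey
  have hconst : ENNReal.ofReal (r ^ (n - 1)) * (ENNReal.ofReal (2 ^ n * (r ^ n)⁻¹) *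
      (ENNReal.ofReal (r ^ n) * ENNReal.ofReal ((s / r) ^ n))) =
      ENNReal.ofReal (s ^ n) * ENNReal.ofReal (2 ^ n) * ENNReal.ofReal r⁻¹ := by
    rw [← ENNReal.ofReal_mul (by positivity), ← ENNReal.ofReal_mul (by positivity),
      ← ENNReal.ofReal_mul (by positivity), ← ENNReal.ofReal_mul (by positivity),
      ← ENNReal.ofReal_mul (by positivity)]
    congr 1
    obtain ⟨m, rfl⟩ : ∃ m, n = m + 1 := ⟨n - 1, by omega⟩
    rw [Nat.add_sub_cancel, div_pow]
    field_simp
    ring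
  calc _ ≤ ENNReal.ofReal (r ^ (n - 1)) * (ENNReal.ofReal (2 ^ n * (r ^ n)⁻¹) *
        (ENNReal.ofReal (r ^ n) * (translationConst n * ENNReal.ofReal ((s / r) ^ n) *
          ENNReal.ofReal (omegaRot n Ω (8 * (1 + 2 * n) * s / r))))) := by gcongr
    _ = (ENNReal.ofReal (r ^ (n - 1)) * (ENNReal.ofReal (2 ^ n * (r ^ n)⁻¹) *
          (ENNReal.ofReal (r ^ n) * ENNReal.ofReal ((s / r) ^ n)))) * (translationConst n *
          ENNReal.ofReal (omegaRot n Ω (8 * (1 + 2 * n) * s / r))) := by ring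
    _ = _ := by rw [hconst]; ring

lemma lintegral_tail_le (hn : 0 < n) (hΩ : Measurable Ω) (hhom : HomogeneousZero Ω)
    {s R : ℝ} (hs : 0 < s) (hR : 0 < R) :
    ∫⁻ x in {x : Eu n | ‖x‖ ∈ Ioi R}, ENNReal.ofReal (n * 4 ^ n * s * (‖x‖ ^ (n + 1))⁻¹) * ‖Ω x‖ₑ =
      ENNReal.ofReal (n * 4 ^ n * (s / R)) * ∫⁻ θ : unitSphere n, ‖Ω θ‖ₑ ∂sphereMeasure n := by
  rw [setLIntegral_radial_mul hn (G := fun x => ‖Ω x‖ₑ) hΩ.enorm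
    (fun c hc x hx => by rw [hhom c hc x hx])
    (g := fun r => ENNReal.ofReal (n * 4 ^ n * s * (r ^ (n + 1))⁻¹)) (by fun_prop)
    (S := Ioi R) measurableSet_Ioi, inter_eq_right.2 (Ioi_subset_Ioi hR.le)]
  congr 1
  have h : ∀ r ∈ Ioi R, ENNReal.ofReal (r ^ (n - 1)) *
      ENNReal.ofReal (n * 4 ^ n * s * (r ^ (n + 1))⁻¹) =
      ENNReal.ofReal (n * 4 ^ n * s) * ENNReal.ofReal (r ^ 2)⁻¹ := by
    intro r hr
    have hr0 : 0 < r := hR.trans hr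
    rw [← ENNReal.ofReal_mul (by positivity), ← ENNReal.ofReal_mul (by positivity)]
    congr 1
    obtain ⟨m, rfl⟩ : ∃ m, n = m + 1 := ⟨n - 1, by omega⟩
    rw [Nat.add_sub_cancel]
    field_simp
    ring
  rw [setLIntegral_congr_fun measurableSet_Ioi h, lintegral_const_mul' _ _ ENNReal.ofReal_ne_top,
    lintegral_Ioi_inv_sq hR, ← ENNReal.ofReal_mul (by positivity)]
  congr 1
  ring

end

section

variable {n : ℕ}

/-- A fixed translation is controlled by averages over balls. -/
lemma lintegral_translation_le_oscillation {K : Eu n → ℝ} (hK : Measurable K) {s R N : ℝ}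
    (hs : 0 < s) (hR : R + s < N * s) {h : Eu n} (hh : ‖h‖ ≤ s) :
    ENNReal.ofReal (s ^ n) * volume (Metric.ball (0 : Eu n) 1) *
        (∫⁻ x in {x : Eu n | N * s ≤ ‖x‖}, ‖K (x - h) - K x‖ₑ) ≤
      2 * ∫⁻ x in {x : Eu n | ‖x‖ ∈ Ioi R},
        ∫⁻ w in Metric.closedBall x (2 * s), ‖K w - K x‖ₑ := by
  have hS : MeasurableSet {x : Eu n | N * s ≤ ‖x‖} := measurableSet_le measurable_const measurable_norm
  have hT : MeasurableSet {x : Eu n | ‖x‖ ∈ Ioi R} := measurable_norm measurableSet_Ioi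
  have hmF : Measurable (Function.uncurry fun x w : Eu n => ‖K w - K x‖ₑ) :=
    ((hK.comp measurable_snd).sub (hK.comp measurable_fst)).enorm
  obtain ⟨G, hG⟩ : ∃ G : Eu n → ENNReal, ∀ x, G x =
    ∫⁻ w in Metric.closedBall x (2 * s), ‖K w - K x‖ₑ := ⟨_, fun _ => rfl⟩
  have hGm : Measurable G := by
    rw [funext hG]
    exact measurable_setLIntegral_closedBall (F := fun x w => ‖K w - K x‖ₑ) hmF (2 * s)
  have hpt : ∀ x : Eu n, ENNReal.ofReal (s ^ n) * volume (Metric.ball (0 : Eu n) 1) *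
      ‖K (x - h) - K x‖ₑ ≤ G (x - h) + G x := by
    intro x
    have hball : Metric.closedBall x s ⊆ Metric.closedBall (x - h) (2 * s) := by
      refine Metric.closedBall_subset_closedBall' ?_
      rw [dist_eq_norm, sub_sub_cancel]
      linarith
    have hball' : Metric.closedBall x s ⊆ Metric.closedBall x (2 * s) :=
      Metric.closedBall_subset_closedBall (by linarith)
    have hm : ∀ c : ℝ, Measurable fun w : Eu n => ‖K w - c‖ₑ := fun c =>
      (hK.sub measurable_const).enorm
    calc _ = ∫⁻ _ in Metric.closedBall x s, ‖K (x - h) - K x‖ₑ := by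
          rw [setLIntegral_const, Measure.addHaar_closedBall volume x hs.le,
            finrank_euclideanSpace_fin, mul_comm]
      _ ≤ ∫⁻ w in Metric.closedBall x s, ‖K w - K (x - h)‖ₑ + ‖K w - K x‖ₑ := by
          refine lintegral_mono fun w => ?_
          have : K (x - h) - K x = (K w - K x) - (K w - K (x - h)) := by ring
          rw [this, add_comm]
          exact enorm_sub_le
      _ = (∫⁻ w in Metric.closedBall x s, ‖K w - K (x - h)‖ₑ) +
          ∫⁻ w in Metric.closedBall x s, ‖K w - K x‖ₑ := lintegral_add_left (hm _) _
      _ ≤ _ := by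
          rw [hG, hG]
          exact add_le_add (lintegral_mono_set hball) (lintegral_mono_set hball')
  have hsub : ∀ x ∈ {x : Eu n | N * s ≤ ‖x‖}, R < ‖x - h‖ ∧ R < ‖x‖ := by
    intro x hx
    have hx : N * s ≤ ‖x‖ := hx
    have := norm_sub_norm_le x h
    constructor <;> linarith
  calc _ = ∫⁻ x in {x : Eu n | N * s ≤ ‖x‖}, ENNReal.ofReal (s ^ n) *
        volume (Metric.ball (0 : Eu n) 1) * ‖K (x - h) - K x‖ₑ := by
        rw [lintegral_const_mul' _ _
          (ENNReal.mul_ne_top ENNReal.ofReal_ne_top measure_ball_lt_top.ne)]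
    _ ≤ ∫⁻ x in {x : Eu n | N * s ≤ ‖x‖}, ({x : Eu n | ‖x‖ ∈ Ioi R}.indicator G (x - h) +
        {x : Eu n | ‖x‖ ∈ Ioi R}.indicator G x) := by
        refine setLIntegral_mono' hS fun x hx => ?_
        rw [indicator_of_mem (show x - h ∈ {x : Eu n | ‖x‖ ∈ Ioi R} from (hsub x hx).1),
          indicator_of_mem (show x ∈ {x : Eu n | ‖x‖ ∈ Ioi R} from (hsub x hx).2)]
        exact hpt x
    _ ≤ ∫⁻ x : Eu n, ({x : Eu n | ‖x‖ ∈ Ioi R}.indicator G (x - h) +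
        {x : Eu n | ‖x‖ ∈ Ioi R}.indicator G x) := setLIntegral_le_lintegral _ _
    _ = (∫⁻ x : Eu n, {x : Eu n | ‖x‖ ∈ Ioi R}.indicator G (x - h)) +
        ∫⁻ x : Eu n, {x : Eu n | ‖x‖ ∈ Ioi R}.indicator G x :=
        lintegral_add_right _ (hGm.indicator hT)
    _ = 2 * ∫⁻ x in {x : Eu n | ‖x‖ ∈ Ioi R}, G x := by
        rw [lintegral_sub_right_eq_self (fun x => {x : Eu n | ‖x‖ ∈ Ioi R}.indicator G x) h,
          lintegral_indicator hT, two_mul]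
    _ = _ := by simp only [hG]

variable {Ω : Eu n → ℝ}

lemma lintegral_oscillation_omegaKernel_le (hn : 0 < n) (hΩ : Measurable Ω)
    (hhom : HomogeneousZero Ω)
    (hint : Integrable (fun θ : unitSphere n => Ω (θ : Eu n)) (sphereMeasure n))
    {s R : ℝ} (hs : 0 < s) (hR : (1 + 2 * n) * s < R) :
    ∫⁻ x in {x : Eu n | ‖x‖ ∈ Ioi R}, ∫⁻ w in Metric.closedBall x s,
        ‖omegaKernel Ω w - omegaKernel Ω x‖ₑ ≤
      ENNReal.ofReal (s ^ n) * (ENNReal.ofReal (2 ^ n) * translationConst n *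
        (∫⁻ t in Ioo 0 (8 * (1 + 2 * n) * s / R), ENNReal.ofReal (omegaRot n Ω t / t)) +
        volume (Metric.ball (0 : Eu n) 1) * (ENNReal.ofReal (n * 4 ^ n * (s / R)) *
          ∫⁻ θ : unitSphere n, ‖Ω θ‖ₑ ∂sphereMeasure n)) := by
  have hn' : (1 : ℝ) ≤ n := by exact_mod_cast hn
  have hR0 : 0 < R := lt_of_le_of_lt (by positivity) hR
  have hsR : s ≤ R / 2 := by nlinarith
  have hT : MeasurableSet {x : Eu n | ‖x‖ ∈ Ioi R} := measurable_norm measurableSet_Ioi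
  have hm2 : Measurable fun x : Eu n =>
      ENNReal.ofReal (n * 4 ^ n * s * (‖x‖ ^ (n + 1))⁻¹) * ‖Ω x‖ₑ :=
    (by fun_prop : Measurable fun x : Eu n =>
      ENNReal.ofReal (n * 4 ^ n * s * (‖x‖ ^ (n + 1))⁻¹)).mul hΩ.enorm
  calc _ ≤ ∫⁻ x in {x : Eu n | ‖x‖ ∈ Ioi R}, ((ENNReal.ofReal (2 ^ n * (‖x‖ ^ n)⁻¹) *
        ∫⁻ w in Metric.closedBall x s, ‖Ω w - Ω x‖ₑ) +
        (ENNReal.ofReal (s ^ n) * volume (Metric.ball (0 : Eu n) 1)) *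
        (ENNReal.ofReal (n * 4 ^ n * s * (‖x‖ ^ (n + 1))⁻¹) * ‖Ω x‖ₑ)) := by
        refine setLIntegral_mono' hT fun x hx => ?_
        have hx : R < ‖x‖ := hx
        calc _ ≤ ∫⁻ w in Metric.closedBall x s,
              (ENNReal.ofReal (2 ^ n * (‖x‖ ^ n)⁻¹) * ‖Ω w - Ω x‖ₑ +
              ENNReal.ofReal (n * 4 ^ n * s * (‖x‖ ^ (n + 1))⁻¹) * ‖Ω x‖ₑ) := by
              refine setLIntegral_mono' Metric.isClosed_closedBall.measurableSet fun w hw => ?_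
              exact enorm_omegaKernel_sub_le hn (hR0.trans hx) (by linarith)
                (by rw [← dist_eq_norm]; exact hw)
          _ = _ := by
              rw [lintegral_add_right _ measurable_const,
                lintegral_const_mul' _ _ ENNReal.ofReal_ne_top, setLIntegral_const,
                Measure.addHaar_closedBall volume x hs.le, finrank_euclideanSpace_fin]
              congr 1
              rw [mul_comm]
    _ = (∫⁻ x in {x : Eu n | ‖x‖ ∈ Ioi R}, (ENNReal.ofReal (2 ^ n * (‖x‖ ^ n)⁻¹) *
        ∫⁻ w in Metric.closedBall x s, ‖Ω w - Ω x‖ₑ)) +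
        ENNReal.ofReal (s ^ n) * volume (Metric.ball (0 : Eu n) 1) *
        (ENNReal.ofReal (n * 4 ^ n * (s / R)) *
          ∫⁻ θ : unitSphere n, ‖Ω θ‖ₑ ∂sphereMeasure n) := by
        rw [lintegral_add_right _ (hm2.const_mul _), lintegral_const_mul _ hm2,
          lintegral_tail_le hn hΩ hhom hs hR0]
    _ ≤ _ := by
        rw [mul_add, ← mul_assoc (ENNReal.ofReal (s ^ n)) (volume _)]
        exact add_le_add_left (lintegral_oscillation_le hn hΩ hhom hint hs hR) _

lemma tendsto_dini_tail {ω : ℝ → ℝ}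
    (h : ∫⁻ δ in Ioo (0 : ℝ) 1, ENNReal.ofReal (ω δ / δ) < ⊤) :
    Tendsto (fun τ => ∫⁻ t in Ioo 0 τ, ENNReal.ofReal (ω t / t)) (nhdsWithin 0 (Ioi 0)) (nhds 0) := by
  have h1 : Tendsto (fun τ : ℝ => volume.restrict (Ioo (0 : ℝ) 1) (Ioo 0 τ))
      (nhdsWithin 0 (Ioi 0)) (nhds 0) := by
    have h2 : Tendsto (fun τ : ℝ => ENNReal.ofReal τ) (nhdsWithin 0 (Ioi 0)) (nhds 0) := by
      have := (ENNReal.continuous_ofReal.tendsto (0 : ℝ)).mono_left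
        (nhdsWithin_le_nhds (s := Ioi 0))
      rwa [ENNReal.ofReal_zero] at this
    refine tendsto_of_tendsto_of_tendsto_of_le_of_le tendsto_const_nhds h2 (fun _ => zero_le)
      fun τ => ?_
    refine (Measure.restrict_apply_le _ _).trans ?_
    rw [Real.volume_Ioo, sub_zero]
  refine (tendsto_setLIntegral_zero h.ne h1).congr' ?_
  filter_upwards [Ioo_mem_nhdsGT (zero_lt_one (α := ℝ))] with τ hτ
  rw [Measure.restrict_restrict measurableSet_Ioo, inter_eq_left.2 (Ioo_subset_Ioo_right hτ.2.le)]

/-- The smallness at infinity of the Hörmander integral of a Dini kernel. -/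
lemma exists_hormander_le (hn : 0 < n) (hΩ : Measurable Ω) (hhom : HomogeneousZero Ω)
    (hdini : L1Dini n Ω) {η : ℝ} (hη : 0 < η) :
    ∃ N, 2 ≤ N ∧ ∀ (h : Eu n) (s : ℝ), 0 < s → ‖h‖ ≤ s →
      ∫⁻ x in {x : Eu n | N * s ≤ ‖x‖}, ‖omegaKernel Ω (x - h) - omegaKernel Ω x‖ₑ ≤
        ENNReal.ofReal η := by
  have hn' : (1 : ℝ) ≤ n := by exact_mod_cast hn
  have hint := hdini.1
  have hW : ∫⁻ θ : unitSphere n, ‖Ω θ‖ₑ ∂sphereMeasure n ≠ ⊤ := hint.2.ne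
  have hv0 : volume (Metric.ball (0 : Eu n) 1) ≠ 0 := (Metric.measure_ball_pos _ _ one_pos).ne'
  have hvt : volume (Metric.ball (0 : Eu n) 1) ≠ ⊤ := measure_ball_lt_top.ne
  have hinv : Tendsto (fun r : ℝ => 1 / r) atTop (nhdsWithin 0 (Ioi 0)) := by
    simpa only [one_div] using tendsto_inv_atTop_nhdsGT_zero (𝕜 := ℝ)
  have hE : Tendsto (fun r : ℝ => ∫⁻ t in Ioo 0 (8 * (1 + 2 * n) * (1 / r)),
      ENNReal.ofReal (omegaRot n Ω t / t)) atTop (nhds 0) := by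
    refine (tendsto_dini_tail hdini.2).comp ?_
    refine tendsto_nhdsWithin_iff.2 ⟨?_, ?_⟩
    · have := (hinv.mono_right nhdsWithin_le_nhds).const_mul (8 * (1 + 2 * (n : ℝ)))
      rwa [mul_zero] at this
    · filter_upwards [eventually_gt_atTop (0 : ℝ)] with r hr
      exact (by positivity : 0 < 8 * (1 + 2 * (n : ℝ)) * (1 / r))
  have hL : Tendsto (fun r : ℝ => ENNReal.ofReal (n * 4 ^ n * (1 / r))) atTop (nhds 0) := by
    have := (hinv.mono_right nhdsWithin_le_nhds).const_mul ((n : ℝ) * 4 ^ n)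
    rw [mul_zero] at this
    have := (ENNReal.continuous_ofReal.tendsto (0 : ℝ)).comp this
    rwa [ENNReal.ofReal_zero] at this
  have hC : ENNReal.ofReal (2 ^ n) * translationConst n ≠ ⊤ :=
    ENNReal.mul_ne_top ENNReal.ofReal_ne_top translationConst_ne_top
  have hlim : Tendsto (fun r : ℝ => 2 * ENNReal.ofReal (2 ^ n) *
      (ENNReal.ofReal (2 ^ n) * translationConst n *
        (∫⁻ t in Ioo 0 (8 * (1 + 2 * n) * (1 / r)), ENNReal.ofReal (omegaRot n Ω t / t)) +
        volume (Metric.ball (0 : Eu n) 1) * (ENNReal.ofReal (n * 4 ^ n * (1 / r)) *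
          ∫⁻ θ : unitSphere n, ‖Ω θ‖ₑ ∂sphereMeasure n))) atTop (nhds 0) := by
    have h1 := ENNReal.Tendsto.const_mul hE (Or.inr hC)
    have h2 := ENNReal.Tendsto.const_mul (ENNReal.Tendsto.mul_const hL (Or.inr hW)) (Or.inr hvt)
    have h3 := ENNReal.Tendsto.const_mul (h1.add h2)
      (Or.inr (ENNReal.mul_ne_top (by simp) ENNReal.ofReal_ne_top :
        2 * ENNReal.ofReal (2 ^ n) ≠ ⊤))
    simpa only [mul_zero, zero_mul, add_zero] using h3
  have hpos : 0 < volume (Metric.ball (0 : Eu n) 1) * ENNReal.ofReal η :=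
    ENNReal.mul_pos hv0 (ENNReal.ofReal_pos.2 hη).ne'
  obtain ⟨r, hr, hr'⟩ := ((hlim.eventually (Iio_mem_nhds hpos)).and
    (eventually_gt_atTop (1 + 2 * (n : ℝ)))).exists
  have hr0 : 0 < r := by linarith
  refine ⟨2 * r + 2, by linarith, fun h s hs hh => ?_⟩
  have h1 := lintegral_translation_le_oscillation (N := 2 * r + 2) (R := r * (2 * s))
    (measurable_omegaKernel hΩ) hs (by nlinarith) hh
  have h2 := lintegral_oscillation_omegaKernel_le hn hΩ hhom hint (s := 2 * s) (R := r * (2 * s))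
    (by positivity) (by gcongr)
  have e1 : 2 * s / (r * (2 * s)) = 1 / r := by field_simp
  rw [mul_div_assoc, e1] at h2
  have hsn : 0 < ENNReal.ofReal (s ^ n) := ENNReal.ofReal_pos.2 (by positivity)
  have h3 := h1.trans (mul_le_mul_right h2 2)
  rw [mul_pow, ENNReal.ofReal_mul (by positivity)] at h3
  have h4 : ENNReal.ofReal (s ^ n) * (volume (Metric.ball (0 : Eu n) 1) *
      (∫⁻ x in {x : Eu n | (2 * r + 2) * s ≤ ‖x‖}, ‖omegaKernel Ω (x - h) - omegaKernel Ω x‖ₑ)) ≤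
      ENNReal.ofReal (s ^ n) * (volume (Metric.ball (0 : Eu n) 1) * ENNReal.ofReal η) := by
    rw [← mul_assoc]
    refine h3.trans ((le_of_eq ?_).trans (mul_le_mul_right (le_of_lt hr) _))
    ring
  have h5 := (ENNReal.mul_le_mul_iff_right hsn.ne' ENNReal.ofReal_ne_top).1 h4
  exact (ENNReal.mul_le_mul_iff_right hv0 hvt).1 h5

lemma exists_czKernel_omegaKernel (hn : 0 < n) (hΩ : Measurable Ω) (hhom : HomogeneousZero Ω)
    (hdini : L1Dini n Ω) (hmean : ∫ θ : unitSphere n, Ω θ ∂sphereMeasure n = 0) :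
    ∃ M A, CZKernel (omegaKernel Ω) M A := by
  have hW : ∫⁻ θ : unitSphere n, ‖Ω θ‖ₑ ∂sphereMeasure n ≠ ⊤ := hdini.1.2.ne
  obtain ⟨A, hA⟩ : ∃ A : ℝ, A = (∫⁻ θ : unitSphere n, ‖Ω θ‖ₑ ∂sphereMeasure n).toReal + 1 :=
    ⟨_, rfl⟩
  have hA0 : 0 < A := by rw [hA]; positivity
  have hWA : ∫⁻ θ : unitSphere n, ‖Ω θ‖ₑ ∂sphereMeasure n ≤ ENNReal.ofReal A := by
    rw [← ENNReal.ofReal_toReal hW]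
    exact ENNReal.ofReal_le_ofReal (by linarith)
  obtain ⟨M, hM, hreg⟩ := exists_hormander_le hn hΩ hhom hdini hA0
  refine ⟨M, A, hM, hA0.le, measurable_omegaKernel hΩ, ?_, ?_, hreg, ?_⟩
  · intro a b ha hab
    rw [lintegral_omegaKernel_annulus hn hΩ hhom ha hab, mul_comm,
      ENNReal.ofReal_mul hA0.le]
    exact mul_le_mul_left hWA _
  · intro ρ hρ
    rw [lintegral_norm_mul_omegaKernel hn hΩ hhom ρ, mul_comm, ENNReal.ofReal_mul hA0.le]
    exact mul_le_mul_left hWA _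
  · intro a b ha
    exact setIntegral_omegaKernel_annulus hn hΩ hhom hdini.1 hmean ha

end

section

variable {n : ℕ}

lemma exists_measurable_homogeneous_extension {β : Type*} [MeasurableSpace β] [Nonempty β]
    {g : unitSphere n → β} (hg : Measurable g) :
    ∃ G : Eu n → β, Measurable G ∧ (∀ c : ℝ, 0 < c → ∀ x : Eu n, x ≠ 0 → G (c • x) = G x) ∧
      ∀ θ : unitSphere n, G θ = g θ := by
  obtain ⟨G, hG, hGg⟩ := (MeasurableEmbedding.subtype_coe
    (Metric.isClosed_sphere (x := (0 : Eu n)) (ε := 1)).measurableSet).exists_measurable_extend hg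
    (fun _ => ‹Nonempty β›)
  refine ⟨fun x => G (‖x‖⁻¹ • x), hG.comp (by fun_prop), fun c hc x hx => ?_, fun θ => ?_⟩
  · dsimp only
    rw [norm_smul, Real.norm_of_nonneg hc.le, smul_smul, mul_inv, mul_right_comm,
      inv_mul_cancel₀ hc.ne', one_mul]
  · dsimp only
    rw [norm_unitSphere, inv_one, one_smul]
    exact congrFun hGg θ

lemma exists_homogeneous_null_cover {P : Eu n → Prop}
    (hP : ∀ᵐ θ : unitSphere n ∂sphereMeasure n, P θ)
    (hhom : ∀ c : ℝ, 0 < c → ∀ x : Eu n, x ≠ 0 → P (c • x) → P x) :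
    ∃ G : Eu n → ENNReal, Measurable G ∧
      (∀ c : ℝ, 0 < c → ∀ x : Eu n, x ≠ 0 → G (c • x) = G x) ∧
      (∫⁻ θ : unitSphere n, G θ ∂sphereMeasure n = 0) ∧ ∀ x ≠ 0, G x = 0 → P x := by
  obtain ⟨t, ht, htm, ht0⟩ := exists_measurable_superset_of_null (ae_iff.1 hP)
  obtain ⟨G, hG, hGhom, hGt⟩ := exists_measurable_homogeneous_extension
    (g := t.indicator fun _ => (1 : ENNReal)) (measurable_const.indicator htm)
  refine ⟨G, hG, hGhom, ?_, fun x hx hGx => ?_⟩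
  · simp only [hGt]
    rw [lintegral_indicator htm, setLIntegral_const, ht0, mul_zero]
  · have hx0 : 0 < ‖x‖⁻¹ := inv_pos.2 (norm_pos_iff.2 hx)
    refine hhom _ hx0 x hx ?_
    by_contra hcon
    have hmem : ‖x‖⁻¹ • x ∈ Metric.sphere (0 : Eu n) 1 := by
      rw [mem_sphere_zero_iff_norm, norm_smul, norm_inv, norm_norm,
        inv_mul_cancel₀ (norm_pos_iff.2 hx).ne']
    have h1 := hGt ⟨_, hmem⟩
    rw [indicator_of_mem (ht hcon), hGhom _ hx0 x hx, hGx] at h1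
    exact zero_ne_one h1

lemma ae_of_ae_sphere (hn : 0 < n) {P : Eu n → Prop}
    (hP : ∀ᵐ θ : unitSphere n ∂sphereMeasure n, P θ)
    (hhom : ∀ c : ℝ, 0 < c → ∀ x : Eu n, x ≠ 0 → P (c • x) → P x) :
    ∀ᵐ x : Eu n, P x := by
  have : NeZero n := ⟨hn.ne'⟩
  have : Nontrivial (Eu n) := inferInstance
  obtain ⟨G, hG, hGhom, hG0, hGP⟩ := exists_homogeneous_null_cover hP hhom
  have h1 : ∫⁻ x, G x = 0 := by
    rw [lintegral_polar hn hG, setLIntegral_congr_fun (g := fun _ => 0) measurableSet_Ioi,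
      lintegral_zero]
    intro r hr
    have : ∀ θ : unitSphere n, G (r • (θ : Eu n)) = G θ := fun θ =>
      hGhom r hr _ (unitSphere_ne_zero θ)
    simp only [this, hG0, mul_zero]
  filter_upwards [(lintegral_eq_zero_iff hG).1 h1, Measure.ae_ne volume (0 : Eu n)] with x hx hx0
  exact hGP x hx0 hx

lemma ae_sphere_comp_isometry (hn : 0 < n) {P : Eu n → Prop}
    (hP : ∀ᵐ θ : unitSphere n ∂sphereMeasure n, P θ)
    (hhom : ∀ c : ℝ, 0 < c → ∀ x : Eu n, x ≠ 0 → P (c • x) → P x) (ρ : Eu n ≃ₗᵢ[ℝ] Eu n) :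
    ∀ᵐ θ : unitSphere n ∂sphereMeasure n, P (ρ θ) := by
  obtain ⟨G, hG, hGhom, hG0, hGP⟩ := exists_homogeneous_null_cover hP hhom
  rw [← lintegral_sphere_comp_isometry hn hG hGhom ρ] at hG0
  have hm : Measurable fun θ : unitSphere n => G (ρ (θ : Eu n)) :=
    hG.comp (ρ.continuous.measurable.comp measurable_subtype_coe)
  filter_upwards [(lintegral_eq_zero_iff hm).1 hG0] with θ hθ
  exact hGP _ (by simpa using unitSphere_ne_zero θ) hθ

/-- A Borel measurable homogeneous representative of `Ω`. -/
lemma exists_measurable_representative (hn : 0 < n) {Ω : Eu n → ℝ} (hhom : HomogeneousZero Ω)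
    (hdini : L1Dini n Ω) :
    ∃ Ω' : Eu n → ℝ, Measurable Ω' ∧ HomogeneousZero Ω' ∧ L1Dini n Ω' ∧
      (∀ᵐ θ : unitSphere n ∂sphereMeasure n, Ω θ = Ω' θ) ∧ ∀ᵐ x : Eu n, Ω x = Ω' x := by
  obtain ⟨Ω', hΩ', hhom', hext⟩ := exists_measurable_homogeneous_extension
    hdini.1.aestronglyMeasurable.stronglyMeasurable_mk.measurable
  have hae : ∀ᵐ θ : unitSphere n ∂sphereMeasure n, Ω θ = Ω' θ := by
    filter_upwards [hdini.1.aestronglyMeasurable.ae_eq_mk] with θ hθ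
    rw [hθ, hext]
  have hP : ∀ c : ℝ, 0 < c → ∀ x : Eu n, x ≠ 0 → Ω (c • x) = Ω' (c • x) → Ω x = Ω' x := by
    intro c hc x hx h
    rwa [hhom c hc x hx, hhom' c hc x hx] at h
  have hω : omegaRot n Ω' = omegaRot n Ω := by
    funext δ
    have hint : ∀ ρ : Eu n ≃ₗᵢ[ℝ] Eu n,
        ∫ θ : unitSphere n, |Ω' (ρ (θ : Eu n)) - Ω' (θ : Eu n)| ∂sphereMeasure n =
        ∫ θ : unitSphere n, |Ω (ρ (θ : Eu n)) - Ω (θ : Eu n)| ∂sphereMeasure n := by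
      intro ρ
      refine integral_congr_ae ?_
      filter_upwards [hae, ae_sphere_comp_isometry hn (P := fun x => Ω x = Ω' x) hae hP ρ] with θ h1 h2
      rw [h1, h2]
    unfold omegaRot
    simp only [hint]
  refine ⟨Ω', hΩ', hhom', ⟨hdini.1.congr hae, ?_⟩, hae, ae_of_ae_sphere hn (P := fun x => Ω x = Ω' x) hae hP⟩
  rw [hω]
  exact hdini.2

end

section

variable {n : ℕ}

lemma setIntegral_eq_czT_rnDeriv {Ω Ω' : Eu n → ℝ} (hΩ : ∀ᵐ x : Eu n, Ω x = Ω' x)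
    {ν : Measure (Eu n)} [IsFiniteMeasure ν] (hν : ν ≪ volume) (ε : ℝ) (x : Eu n) :
    ∫ y in {y | ε < ‖x - y‖}, Ω (x - y) / ‖x - y‖ ^ n ∂ν =
      czT (omegaKernel Ω') ε (fun y => (ν.rnDeriv volume y).toReal) x := by
  rw [czT, ← setIntegral_rnDeriv_smul hν (measurableSet_lt_norm_sub ε x)]
  refine integral_congr_ae (ae_restrict_of_ae ?_)
  filter_upwards [(Measure.measurePreserving_sub_left volume x).quasiMeasurePreserving.ae hΩ]
    with y hy
  rw [smul_eq_mul, mul_comm, omegaKernel, hy]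

lemma signedMeasure_univ_eq_integral {μ : SignedMeasure (Eu n)}
    (hpos : μ.toJordanDecomposition.posPart ≪ volume)
    (hneg : μ.toJordanDecomposition.negPart ≪ volume) :
    μ univ = ∫ y, ((μ.toJordanDecomposition.posPart.rnDeriv volume y).toReal -
      (μ.toJordanDecomposition.negPart.rnDeriv volume y).toReal) := by
  rw [integral_sub Measure.integrable_toReal_rnDeriv Measure.integrable_toReal_rnDeriv,
    Measure.integral_toReal_rnDeriv hpos, Measure.integral_toReal_rnDeriv hneg]
  conv_lhs => rw [← SignedMeasure.toSignedMeasure_toJordanDecomposition μ]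
  rw [JordanDecomposition.toSignedMeasure, sub_apply,
    Measure.toSignedMeasure_apply_measurable MeasurableSet.univ,
    Measure.toSignedMeasure_apply_measurable MeasurableSet.univ]

end

/-- If `Ω` is homogeneous of degree zero, integrable with mean value zero on
`S^{n-1}`, and satisfies the `L¹`-Dini condition, and `μ` is a signed measure on `ℝⁿ`
absolutely continuous w.r.t. Lebesgue measure with `|μ|(ℝⁿ) < ∞`, then
`lim_{λ→0⁺} λ · m({x : |T_Ω μ(x)| > λ}) = (1/n) ‖Ω‖_{L¹(S^{n-1})} |μ(ℝⁿ)|`. -/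
theorem limiting_behavior_singular_integral_signed_measure
    {n : ℕ} (hn : 0 < n) (Ω : EuclideanSpace ℝ (Fin n) → ℝ)
    (hhom : HomogeneousZero Ω)
    (hmean : ∫ θ : unitSphere n, Ω (θ : EuclideanSpace ℝ (Fin n)) ∂(sphereMeasure n) = 0)
    (hdini : L1Dini n Ω)
    (μ : SignedMeasure (EuclideanSpace ℝ (Fin n)))
    (hac : μ ≪ᵥ (volume : Measure (EuclideanSpace ℝ (Fin n))).toENNRealVectorMeasure)
    (hfin : μ.totalVariation Set.univ < ⊤) :
    Tendsto (fun lam : ℝ =>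
        ENNReal.ofReal lam * volume {x : EuclideanSpace ℝ (Fin n) | lam < |TOmega n Ω μ x|})
      (nhdsWithin 0 (Ioi 0))
      (nhds (ENNReal.ofReal ((1 / n) *
        (∫ θ : unitSphere n, |Ω (θ : EuclideanSpace ℝ (Fin n))| ∂(sphereMeasure n)) *
        |μ Set.univ|))) := by
  obtain ⟨Ω', hΩ', hhom', hdini', hsphere, hspace⟩ := exists_measurable_representative hn hhom hdini
  have hmean' : ∫ θ : unitSphere n, Ω' θ ∂sphereMeasure n = 0 := by
    rw [← hmean]
    exact (integral_congr_ae hsphere).symm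
  have habs : ∫ θ : unitSphere n, |Ω (θ : Eu n)| ∂sphereMeasure n =
      ∫ θ : unitSphere n, |Ω' (θ : Eu n)| ∂sphereMeasure n := by
    refine integral_congr_ae ?_
    filter_upwards [hsphere] with θ hθ
    rw [hθ]
  rw [habs]
  obtain ⟨hpos, hneg⟩ := (SignedMeasure.totalVariation_absolutelyContinuous_iff μ volume).1 (by
    have := (SignedMeasure.absolutelyContinuous_ennreal_iff μ _).1 hac
    rwa [VectorMeasure.ennrealToMeasure_toENNRealVectorMeasure] at this)
  obtain ⟨M, A, hK⟩ := exists_czKernel_omegaKernel hn hΩ' hhom' hdini' hmean'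
  have hD : 0 ≤ (1 / (n : ℝ)) * ∫ θ : unitSphere n, |Ω' (θ : Eu n)| ∂sphereMeasure n :=
    mul_nonneg (by positivity) (integral_nonneg fun _ => abs_nonneg _)
  have hlevel : ∀ t > 0, ENNReal.ofReal t * volume {x : Eu n | t < |omegaKernel Ω' x|} =
      ENNReal.ofReal ((1 / (n : ℝ)) * ∫ θ : unitSphere n, |Ω' (θ : Eu n)| ∂sphereMeasure n) := by
    intro t ht
    have hW : ∫⁻ θ : unitSphere n, ‖Ω' θ‖ₑ ∂sphereMeasure n =
        ENNReal.ofReal (∫ θ : unitSphere n, |Ω' (θ : Eu n)| ∂sphereMeasure n) :=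
      (ofReal_integral_norm_eq_lintegral_enorm hdini'.1).symm
    rw [volume_lt_abs_omegaKernel hn hΩ' hhom' ht, ENNReal.ofReal_mul (by positivity), hW]
  have hint₁ : Integrable (fun y => (μ.toJordanDecomposition.posPart.rnDeriv volume y).toReal) :=
    Measure.integrable_toReal_rnDeriv
  have hint₂ : Integrable (fun y => (μ.toJordanDecomposition.negPart.rnDeriv volume y).toReal) :=
    Measure.integrable_toReal_rnDeriv
  obtain ⟨f, hf⟩ : ∃ f : Eu n → ℝ, f = fun y =>
      (μ.toJordanDecomposition.posPart.rnDeriv volume y).toReal -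
      (μ.toJordanDecomposition.negPart.rnDeriv volume y).toReal := ⟨_, rfl⟩
  have hfint : Integrable f := by
    rw [hf]
    exact hint₁.sub hint₂
  have hT : ∀ᵐ x, Tendsto (fun ε => czT (omegaKernel Ω') ε f x) (nhdsWithin 0 (Ioi 0))
      (nhds (TOmega n Ω μ x)) := by
    filter_upwards [hK.ae_exists_tendsto_czT hn hfint, hK.ae_integrableOn_truncation hint₁,
      hK.ae_integrableOn_truncation hint₂] with x ⟨l, hl⟩ h₁ h₂
    have heq : ∀ᶠ ε in nhdsWithin (0 : ℝ) (Ioi 0),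
        czT (omegaKernel Ω') ε f x = truncT n Ω μ x ε := by
      filter_upwards [self_mem_nhdsWithin] with ε hε
      rw [hf, CZKernel.czT_sub (h₁ ε hε) (h₂ ε hε), truncT, setIntegral_eq_czT_rnDeriv hspace hpos,
        setIntegral_eq_czT_rnDeriv hspace hneg]
    rw [TOmega, (hl.congr' heq).limUnder_eq]
    exact hl
  have hμ : μ univ = ∫ y, f y := by
    rw [hf]
    exact signedMeasure_univ_eq_integral hpos hneg
  have hmain := hK.tendsto_mul_volume_limit_sub hn
    (fun η hη => exists_hormander_le hn hΩ' hhom' hdini' hη) hD hlevel hfint hT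
  rw [hμ]
  exact tendsto_mul_volume_of_sub hD hlevel hmain
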